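/- For every ε > 0 there is a constant C(ε) such that the following holds for all coprime squarefree positive integers r and s, with d = r·s², and all real X > 0: every finite set of pairwise GL₂(ℤ)-inequivalent forms f ∈ V_ℤ with 0 < |Disc(f)| < X and d | Disc(f) has cardinality at most C(ε)·(X/d^{1−ε} + (r·s)^{2+ε}). -/

import Mathlib

open scoped Classical

noncomputable section

/-- An integral binary cubic form `a u³ + b u²v + c uv² + d v³`, recorded by its
coefficient quadruple `(a, b, c, d)`. -/
abbrev BCF := ℤ × ℤ × ℤ × ℤ

namespace BCF

/-- The discriminant of a binary cubic form. -/
def disc (f : BCF) : ℤ :=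
  f.2.1 ^ 2 * f.2.2.1 ^ 2 - 4 * f.1 * f.2.2.1 ^ 3 - 4 * f.2.1 ^ 3 * f.2.2.2
    - 27 * f.1 ^ 2 * f.2.2.2 ^ 2 + 18 * f.1 * f.2.1 * f.2.2.1 * f.2.2.2

/-- The (twisted) action of a matrix `γ` with `det γ = ±1` on binary cubic forms:
`(γ·f)(u,v) = (det γ)⁻¹ · f((u,v)·γ)`, written out on coefficients (for `det γ = ±1`,
dividing by the determinant is the same as multiplying by it). -/
def act (γ : Matrix (Fin 2) (Fin 2) ℤ) (f : BCF) : BCF :=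
  let a := f.1; let b := f.2.1; let c := f.2.2.1; let d := f.2.2.2
  let α := γ 0 0; let β := γ 1 0; let g := γ 0 1; let δ := γ 1 1
  (γ.det * (a * α ^ 3 + b * α ^ 2 * g + c * α * g ^ 2 + d * g ^ 3),
   γ.det * (3 * a * α ^ 2 * β + b * (α ^ 2 * δ + 2 * α * β * g)
      + c * (2 * α * g * δ + β * g ^ 2) + 3 * d * g ^ 2 * δ),
   γ.det * (3 * a * α * β ^ 2 + b * (2 * α * β * δ + β ^ 2 * g)
      + c * (α * δ ^ 2 + 2 * β * g * δ) + 3 * d * g * δ ^ 2),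
   γ.det * (a * β ^ 3 + b * β ^ 2 * δ + c * β * δ ^ 2 + d * δ ^ 3))

/-- `SL₂(ℤ)`-equivalence of binary cubic forms. -/
def SLeq (f g : BCF) : Prop := ∃ γ : Matrix (Fin 2) (Fin 2) ℤ, γ.det = 1 ∧ act γ f = g

/-- `GL₂(ℤ)`-equivalence of binary cubic forms. -/
def GLeq (f g : BCF) : Prop :=
  ∃ γ : Matrix (Fin 2) (Fin 2) ℤ, (γ.det = 1 ∨ γ.det = -1) ∧ act γ f = g

/-- The Davenport–Heilbronn set `U_p`: `f` is not a multiple of `p`, and no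
`GL₂(ℤ)`-transform of `f` has leading coefficient divisible by `p²` and second
coefficient divisible by `p`. -/
def inUp (p : ℕ) (f : BCF) : Prop :=
  (¬ ((p:ℤ) ∣ f.1 ∧ (p:ℤ) ∣ f.2.1 ∧ (p:ℤ) ∣ f.2.2.1 ∧ (p:ℤ) ∣ f.2.2.2)) ∧
  ∀ γ : Matrix (Fin 2) (Fin 2) ℤ, (γ.det = 1 ∨ γ.det = -1) →
    ¬ ((p:ℤ) ^ 2 ∣ (act γ f).1 ∧ (p:ℤ) ∣ (act γ f).2.1)

/-- Membership in the dual lattice `V̂_ℤ`: the middle coefficients are divisible by 3. -/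
def inDual (x : BCF) : Prop := (3:ℤ) ∣ x.2.1 ∧ (3:ℤ) ∣ x.2.2.1

/-- The pairing `[x, y] = x₄y₁ − x₃y₂/3 + x₂y₃/3 − x₁y₄` (an integer for `x ∈ V̂_ℤ`). -/
def pairQ (x y : BCF) : ℚ :=
  (x.2.2.2 * y.1 : ℤ) - ((x.2.2.1 * y.2.1 : ℤ) : ℚ) / 3
    + ((x.2.1 * y.2.2.1 : ℤ) : ℚ) / 3 - (x.1 * y.2.2.2 : ℤ)

/-- `Φ_q`, the characteristic function of forms nonmaximal at every prime `p | q`. -/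
def nonmaxAll (q : ℕ) (f : BCF) : Prop := ∀ p : ℕ, p.Prime → p ∣ q → ¬ inUp p f

/-- The cubic Gauss sum `Φ̂_q(x) = q⁻⁸ Σ_y Φ_q(y) exp(2πi [x,y]/q²)`, the sum running
over forms `y` with coefficients in `{0, …, q² − 1}`. -/
noncomputable def PhiHat (q : ℕ) (x : BCF) : ℂ :=
  ((q : ℂ) ^ 8)⁻¹ *
    ∑ y1 ∈ Finset.range (q ^ 2), ∑ y2 ∈ Finset.range (q ^ 2),
    ∑ y3 ∈ Finset.range (q ^ 2), ∑ y4 ∈ Finset.range (q ^ 2),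
      (if nonmaxAll q ((y1 : ℤ), (y2 : ℤ), (y3 : ℤ), (y4 : ℤ)) then 1 else 0) *
        Complex.exp (2 * Real.pi * Complex.I *
          ((pairQ x ((y1 : ℤ), (y2 : ℤ), (y3 : ℤ), (y4 : ℤ)) : ℚ) : ℂ) / (q : ℂ) ^ 2)

/-- The order of the stabilizer of `x` in `SL₂(ℤ)`. -/
noncomputable def stabCard (x : BCF) : ℕ :=
  Nat.card {γ : Matrix (Fin 2) (Fin 2) ℤ // γ.det = 1 ∧ act γ x = x}

end BCF

namespace BCF

/-- Hessian coefficients. -/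
def hA (f : BCF) : ℤ := f.2.1 ^ 2 - 3 * f.1 * f.2.2.1
def hB (f : BCF) : ℤ := f.2.1 * f.2.2.1 - 9 * f.1 * f.2.2.2
def hC (f : BCF) : ℤ := f.2.2.1 ^ 2 - 3 * f.2.1 * f.2.2.2

lemma hess_disc (f : BCF) : 4 * hA f * hC f - hB f ^ 2 = 3 * disc f := by
  simp only [hA, hB, hC, disc]; ring

lemma hA_act (γ : Matrix (Fin 2) (Fin 2) ℤ) (f : BCF) :
    hA (act γ f) = γ.det ^ 4 * (hA f * γ 0 0 ^ 2 + hB f * γ 0 0 * γ 0 1 + hC f * γ 0 1 ^ 2) := by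
  simp only [hA, hB, hC, act, Matrix.det_fin_two]; ring

lemma hC_act (γ : Matrix (Fin 2) (Fin 2) ℤ) (f : BCF) :
    hC (act γ f) = γ.det ^ 4 * (hA f * γ 1 0 ^ 2 + hB f * γ 1 0 * γ 1 1 + hC f * γ 1 1 ^ 2) := by
  simp only [hA, hB, hC, act, Matrix.det_fin_two]; ring

lemma hB_act (γ : Matrix (Fin 2) (Fin 2) ℤ) (f : BCF) :
    hB (act γ f) = γ.det ^ 4 * (2 * hA f * γ 0 0 * γ 1 0
      + hB f * (γ 0 0 * γ 1 1 + γ 1 0 * γ 0 1) + 2 * hC f * γ 0 1 * γ 1 1) := by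
  simp only [hA, hB, hC, act, Matrix.det_fin_two]; ring

lemma disc_act (γ : Matrix (Fin 2) (Fin 2) ℤ) (f : BCF) (h : γ.det = 1 ∨ γ.det = -1) :
    disc (act γ f) = disc f := by
  have h1 := hess_disc (act γ f)
  have h2 := hess_disc f
  rw [hA_act, hB_act, hC_act] at h1
  have h4 : γ.det ^ 2 = 1 := by rcases h with h | h <;> simp [h]
  have h5 : γ.det ^ 4 = 1 := by rw [show (4:ℕ) = 2 * 2 from rfl, pow_mul, h4]; simp
  rw [h5] at h1
  have h6 : (γ 0 0 * γ 1 1 - γ 0 1 * γ 1 0) ^ 2 = 1 := by rw [← Matrix.det_fin_two]; exact h4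
  have h7 : 3 * disc (act γ f) = (γ 0 0 * γ 1 1 - γ 0 1 * γ 1 0) ^ 2 * (3 * disc f) := by
    rw [← h1, ← h2]; ring
  rw [h6] at h7; linarith

lemma act_mul (γ δ : Matrix (Fin 2) (Fin 2) ℤ) (f : BCF) :
    act γ (act δ f) = act (γ * δ) f := by
  simp only [act, Matrix.det_mul, Matrix.mul_apply, Fin.sum_univ_two, Prod.mk.injEq]
  refine ⟨?_, ?_, ?_, ?_⟩ <;> ring

lemma act_one (f : BCF) : act 1 f = f := by
  simp [act]

lemma GLeq.refl (f : BCF) : GLeq f f := ⟨1, by simp, act_one f⟩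

lemma GLeq.trans {f g h : BCF} (h1 : GLeq f g) (h2 : GLeq g h) : GLeq f h := by
  obtain ⟨γ, hγ, rfl⟩ := h1
  obtain ⟨δ, hδ, rfl⟩ := h2
  refine ⟨δ * γ, ?_, (act_mul _ _ _).symm⟩
  rw [Matrix.det_mul]
  rcases hγ with h | h <;> rcases hδ with h' | h' <;> simp [h, h']

lemma GLeq.symm {f g : BCF} (h1 : GLeq f g) : GLeq g f := by
  obtain ⟨γ, hγ, rfl⟩ := h1
  have hu : IsUnit γ.det := by rcases hγ with h | h <;> simp [h]
  have e : γ⁻¹ * γ = 1 := Matrix.nonsing_inv_mul _ hu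
  refine ⟨γ⁻¹, ?_, ?_⟩
  · have := congrArg Matrix.det e
    rw [Matrix.det_mul, Matrix.det_one] at this
    rcases hγ with h | h <;> rw [h] at this
    · left; linarith
    · right; linarith
  · rw [act_mul, e, act_one]

def glSetoid : Setoid BCF := ⟨GLeq, GLeq.refl, GLeq.symm, GLeq.trans⟩

lemma GLeq.disc_eq {f g : BCF} (h : GLeq f g) : disc g = disc f := by
  obtain ⟨γ, hγ, rfl⟩ := h
  exact disc_act _ _ hγ

/-- `s` divides the Hessian. -/
def HDvd (s : ℤ) (f : BCF) : Prop := s ∣ hA f ∧ s ∣ hB f ∧ s ∣ hC f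

lemma GLeq.hdvd {f g : BCF} (h : GLeq f g) {s : ℤ} (hs : HDvd s f) : HDvd s g := by
  obtain ⟨γ, hγ, rfl⟩ := h
  obtain ⟨⟨a, ha⟩, ⟨b, hb⟩, ⟨c, hc⟩⟩ := hs
  refine ⟨?_, ?_, ?_⟩
  · rw [hA_act, ha, hb, hc]
    exact ⟨γ.det ^ 4 * (a * γ 0 0 ^ 2 + b * γ 0 0 * γ 0 1 + c * γ 0 1 ^ 2), by ring⟩
  · rw [hB_act, ha, hb, hc]
    exact ⟨γ.det ^ 4 * (2 * a * γ 0 0 * γ 1 0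
      + b * (γ 0 0 * γ 1 1 + γ 1 0 * γ 0 1) + 2 * c * γ 0 1 * γ 1 1), by ring⟩
  · rw [hC_act, ha, hb, hc]
    exact ⟨γ.det ^ 4 * (a * γ 1 0 ^ 2 + b * γ 1 0 * γ 1 1 + c * γ 1 1 ^ 2), by ring⟩

end BCF

namespace BCF

/-- Gauss reduction of positive definite real binary quadratic forms. -/
lemma gauss_reduce (A B C : ℝ) (hA : 0 < A) (hD : 0 < 4 * A * C - B ^ 2) :
    ∃ α g β δ : ℤ, α * δ - g * β = 1 ∧
      |2 * A * α * β + B * (α * δ + β * g) + 2 * C * g * δ| ≤ A * α ^ 2 + B * α * g + C * g ^ 2 ∧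
      A * α ^ 2 + B * α * g + C * g ^ 2 ≤ A * β ^ 2 + B * β * δ + C * δ ^ 2 ∧
      0 < A * α ^ 2 + B * α * g + C * g ^ 2 := by
  let Q : ℤ × ℤ → ℝ := fun z => A * z.1 ^ 2 + B * z.1 * z.2 + C * z.2 ^ 2
  have hQ : ∀ z, 4 * A * Q z = (2 * A * z.1 + B * z.2) ^ 2 + (4 * A * C - B ^ 2) * z.2 ^ 2 := by
    intro z; simp only [Q]; ring
  have hCpos : 0 < C := by
    by_contra h
    nlinarith [sq_nonneg B, mul_nonneg hA.le (neg_nonneg.2 (not_lt.1 h))]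
  have hQ' : ∀ z, 4 * C * Q z = (2 * C * z.2 + B * z.1) ^ 2 + (4 * A * C - B ^ 2) * z.1 ^ 2 := by
    intro z; simp only [Q]; ring
  let T : Set (ℤ × ℤ) := {z | IsCoprime z.1 z.2 ∧ Q z ≤ A}
  have hTfin : T.Finite := by
    obtain ⟨N, hN⟩ := exists_nat_gt ((4 * A * A + 4 * C * A) / (4 * A * C - B ^ 2))
    rw [div_lt_iff₀ hD] at hN
    have key : ∀ x : ℤ, (4 * A * C - B ^ 2) * (x:ℝ) ^ 2 ≤ 4 * A * A + 4 * C * A → |x| ≤ N := by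
      intro x hx
      by_contra hc
      push Not at hc
      have h1 : (N:ℝ) + 1 ≤ |(x:ℝ)| := by exact_mod_cast hc
      have h2 : (N:ℝ) ≤ (x:ℝ) ^ 2 := by
        rw [← sq_abs]; nlinarith [(Nat.cast_nonneg N : (0:ℝ) ≤ N)]
      nlinarith
    refine Set.Finite.subset ((Set.finite_Icc (-(N:ℤ)) N).prod (Set.finite_Icc (-(N:ℤ)) N)) ?_
    rintro z ⟨_, hz⟩
    refine ⟨?_, ?_⟩
    · apply abs_le.1 (key _ _)
      have := hQ' z
      nlinarith [sq_nonneg (2 * C * z.2 + B * z.1), mul_le_mul_of_nonneg_left hz hCpos.le, mul_pos hA hA]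
    · apply abs_le.1 (key _ _)
      have := hQ z
      nlinarith [sq_nonneg (2 * A * z.1 + B * z.2), mul_le_mul_of_nonneg_left hz hA.le, mul_pos hA hCpos]
  have hTne : T.Nonempty := ⟨(1, 0), by simp [T, Q, isCoprime_one_left]⟩
  obtain ⟨z, hzT, hzmin⟩ := Set.exists_min_image T Q hTfin hTne
  have hmin : ∀ w : ℤ × ℤ, IsCoprime w.1 w.2 → Q z ≤ Q w := by
    intro w hw
    by_cases h : Q w ≤ A
    · exact hzmin w ⟨hw, h⟩
    · exact hzT.2.trans (not_le.1 h).le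
  obtain ⟨x, y⟩ := z
  obtain ⟨⟨u, v, huv⟩, hle⟩ := hzT
  simp only at huv
  have hpos : 0 < Q (x, y) := by
    have h := hQ (x, y)
    have h' := hQ' (x, y)
    by_contra hc
    push Not at hc
    have h1 : (4 * A * C - B ^ 2) * (y:ℝ) ^ 2 ≤ 0 := by
      simp only at h; nlinarith [sq_nonneg (2 * A * x + B * y)]
    have h2 : (4 * A * C - B ^ 2) * (x:ℝ) ^ 2 ≤ 0 := by
      simp only at h'; nlinarith [sq_nonneg (2 * C * y + B * x)]
    have h3 : (y:ℝ) ^ 2 = 0 := le_antisymm (by nlinarith) (sq_nonneg _)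
    have h4 : (x:ℝ) ^ 2 = 0 := le_antisymm (by nlinarith) (sq_nonneg _)
    have h5 : y = 0 := by exact_mod_cast pow_eq_zero_iff (two_ne_zero) |>.1 h3
    have h6 : x = 0 := by exact_mod_cast pow_eq_zero_iff (two_ne_zero) |>.1 h4
    simp [h5, h6] at huv
  set A' := Q (x, y) with hA'
  set B0 : ℝ := 2 * A * x * (-v) + B * (x * u + (-v) * y) + 2 * C * y * u with hB0
  let n : ℤ := round (-B0 / (2 * A'))
  refine ⟨x, y, -v + n * x, u + n * y, by linear_combination huv, ?_, ?_, hpos⟩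
  · have h1 := abs_sub_round (-B0 / (2 * A'))
    have h2 : (2 * A * x * ((-v + n * x : ℤ):ℝ) + B * (x * ((u + n * y : ℤ):ℝ) + ((-v + n * x : ℤ):ℝ) * y)
        + 2 * C * y * ((u + n * y : ℤ):ℝ)) = -(2 * A') * (-B0 / (2 * A') - n) := by
      have : -(2 * A') * (-B0 / (2 * A') - n) = B0 + 2 * A' * n := by field_simp; ring
      rw [this, hB0, hA']; push_cast; simp only [Q]; ring
    rw [h2, abs_mul, abs_neg, abs_of_pos (by linarith)]
    calc 2 * A' * _ ≤ 2 * A' * (1 / 2) := by gcongr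
      _ = A' := by ring
  · exact hmin (-v + n * x, u + n * y) ⟨-y, x, by linear_combination huv⟩

/-- A cubic with nonzero leading coefficient has a real root. -/
lemma cubic_root (a b c d : ℝ) (ha : a ≠ 0) : ∃ x : ℝ, a * x ^ 3 + b * x ^ 2 + c * x + d = 0 := by
  wlog hpos : 0 < a generalizing a b c d
  · obtain ⟨x, hx⟩ := this (-a) (-b) (-c) (-d) (by simpa using ha)
      (by have := lt_of_le_of_ne (not_lt.1 hpos) ha; linarith)
    exact ⟨x, by linarith⟩
  set M : ℝ := (1 + |b| + |c| + |d|) / a + 1 with hM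
  have hb := abs_nonneg b
  have hc := abs_nonneg c
  have hd := abs_nonneg d
  have hM1 : 1 ≤ M := by
    have : 0 ≤ (1 + |b| + |c| + |d|) / a := by positivity
    linarith
  have haM : |b| + |c| + |d| ≤ a * M := by
    have : a * M = 1 + |b| + |c| + |d| + a := by rw [hM]; field_simp
    linarith
  have h3 : |b| * M ^ 2 + |c| * M + |d| ≤ a * M ^ 3 := by
    have : (|b| + |c| + |d|) * M ^ 2 ≤ a * M * M ^ 2 := by gcongr
    nlinarith [mul_nonneg hc (by nlinarith : 0 ≤ M ^ 2 - M), mul_nonneg hd (by nlinarith : 0 ≤ M ^ 2 - 1)]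
  have hcont : Continuous (fun x : ℝ => a * x ^ 3 + b * x ^ 2 + c * x + d) := by fun_prop
  have hM0 : 0 ≤ M := by linarith
  have hiv := intermediate_value_Icc (by linarith : -M ≤ M) hcont.continuousOn
  have : (0:ℝ) ∈ Set.Icc (a * (-M) ^ 3 + b * (-M) ^ 2 + c * (-M) + d) (a * M ^ 3 + b * M ^ 2 + c * M + d) := by
    constructor
    · nlinarith [le_abs_self b, neg_abs_le b, le_abs_self c, neg_abs_le c, le_abs_self d, neg_abs_le d,
        mul_le_mul_of_nonneg_right (le_abs_self b) (sq_nonneg M), mul_le_mul_of_nonneg_right (neg_abs_le c) hM0]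
    · nlinarith [mul_le_mul_of_nonneg_right (neg_abs_le b) (sq_nonneg M), neg_abs_le d, 
        mul_le_mul_of_nonneg_right (neg_abs_le c) hM0]
  obtain ⟨x, _, hx⟩ := hiv this
  exact ⟨x, hx⟩

lemma exists_fourth_root (A C : ℝ) (hA : 0 < A) (h : A ≤ C) : ∃ t : ℝ, 1 ≤ t ∧ C = A * t ^ 4 := by
  refine ⟨√√(C / A), ?_, ?_⟩
  · rw [Real.one_le_sqrt, Real.one_le_sqrt, le_div_iff₀ hA]; linarith
  · have h1 : 0 ≤ C / A := div_nonneg (by linarith) hA.le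
    rw [show (4:ℕ) = 2 * 2 from rfl, pow_mul, Real.sq_sqrt (Real.sqrt_nonneg _), Real.sq_sqrt h1]
    field_simp

lemma le_of_sq_le_sq' {x y : ℝ} (h : x ^ 2 ≤ y ^ 2) (hy : 0 ≤ y) : x ≤ y := by
  by_contra hc
  push Not at hc
  nlinarith

/-- Being in the box with parameters `L`, `t`. -/
def InBox (L t : ℝ) (g : BCF) : Prop :=
  |(g.1:ℝ)| * t ^ 3 ≤ L ∧ |(g.2.1:ℝ)| * t ≤ L ∧ |(g.2.2.1:ℝ)| ≤ L * t ∧ |(g.2.2.2:ℝ)| ≤ L * t ^ 3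

set_option maxHeartbeats 1000000 in
lemma box_of_pos (a b c d D l t A B C : ℝ) (hl : 0 < l) (ht : 1 ≤ t) (hApos : 0 < A)
    (hA : A = b ^ 2 - 3 * a * c) (hB : B = b * c - 9 * a * d) (hC : C = c ^ 2 - 3 * b * d)
    (hD : 3 * D = 4 * A * C - B ^ 2) (hBA : |B| ≤ A) (hCt : C = A * t ^ 4) (hDl : D ≤ l ^ 4) :
    |a| * t ^ 3 ≤ 4 * l ∧ |b| * t ≤ 4 * l ∧ |c| ≤ 4 * l * t ∧ |d| ≤ 4 * l * t ^ 3 := by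
  have hDe : D = b ^ 2 * c ^ 2 - 4 * a * c ^ 3 - 4 * b ^ 3 * d - 27 * a ^ 2 * d ^ 2 + 18 * a * b * c * d := by
    rw [hA, hB, hC] at hD; linarith
  have s1 : 4 * A ^ 3 = (2 * b ^ 3 + 27 * a ^ 2 * d - 9 * a * b * c) ^ 2 + 27 * a ^ 2 * D := by
    rw [hA, hDe]; ring
  have s2 : 4 * C ^ 3 = (2 * c ^ 3 + 27 * d ^ 2 * a - 9 * d * c * b) ^ 2 + 27 * d ^ 2 * D := by
    rw [hC, hDe]; ring
  have ht4 : 1 ≤ t ^ 4 := one_le_pow₀ ht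
  have hAC : A ≤ C := by rw [hCt]; nlinarith
  have hB2 : B ^ 2 ≤ A * C := by
    rw [← sq_abs]; nlinarith [abs_nonneg B]
  have hDge : A ^ 2 * t ^ 4 ≤ D := by
    have : A * C = A ^ 2 * t ^ 4 := by rw [hCt]; ring
    linarith
  have t0 : 0 < t := by linarith
  have hAt : A * t ^ 2 ≤ l ^ 2 := by
    apply le_of_sq_le_sq' _ (by positivity)
    calc (A * t ^ 2) ^ 2 = A ^ 2 * t ^ 4 := by ring
      _ ≤ (l ^ 2) ^ 2 := by rw [← pow_mul]; exact hDge.trans hDl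
  -- a
  have ha2 : a ^ 2 * t ^ 6 ≤ l ^ 2 := by
    have h1 : 27 * a ^ 2 * (A ^ 2 * t ^ 4) ≤ 4 * A ^ 3 := by
      have : 27 * a ^ 2 * (A ^ 2 * t ^ 4) ≤ 27 * a ^ 2 * D := by gcongr
      linarith [sq_nonneg (2 * b ^ 3 + 27 * a ^ 2 * d - 9 * a * b * c)]
    have h2 : 27 * a ^ 2 * t ^ 4 ≤ 4 * A := by
      have : A ^ 2 * (27 * a ^ 2 * t ^ 4) ≤ A ^ 2 * (4 * A) := by linarith
      exact le_of_mul_le_mul_left this (by positivity)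
    have h3 : 27 * a ^ 2 * t ^ 4 * t ^ 2 ≤ 4 * A * t ^ 2 := by gcongr
    linarith [sq_nonneg (a * t ^ 3), sq_nonneg l]
  have ha : |a| * t ^ 3 ≤ l := by
    apply le_of_sq_le_sq' _ hl.le
    rw [mul_pow, sq_abs, ← pow_mul]; exact ha2
  have hd2 : d ^ 2 ≤ l ^ 2 * t ^ 6 := by
    have h1 : 27 * d ^ 2 * (A ^ 2 * t ^ 4) ≤ 4 * C ^ 3 := by
      have : 27 * d ^ 2 * (A ^ 2 * t ^ 4) ≤ 27 * d ^ 2 * D := by gcongr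
      linarith [sq_nonneg (2 * c ^ 3 + 27 * d ^ 2 * a - 9 * d * c * b)]
    have h2 : 27 * d ^ 2 ≤ 4 * A * t ^ 8 := by
      have : A ^ 2 * t ^ 4 * (27 * d ^ 2) ≤ A ^ 2 * t ^ 4 * (4 * A * t ^ 8) := by
        rw [hCt] at h1; linarith
      exact le_of_mul_le_mul_left this (by positivity)
    have h3 : 4 * (A * t ^ 2) * t ^ 6 ≤ 4 * l ^ 2 * t ^ 6 := by gcongr
    nlinarith [sq_nonneg d]
  have hd : |d| ≤ l * t ^ 3 := by
    apply le_of_sq_le_sq' _ (by positivity)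
    rw [sq_abs, mul_pow, ← pow_mul]; exact hd2
  have had : |a * d| ≤ l ^ 2 := by
    rw [abs_mul]
    have h1 : |a| * |d| * t ^ 3 ≤ l ^ 2 * t ^ 3 := by
      calc |a| * |d| * t ^ 3 = (|a| * t ^ 3) * |d| := by ring
        _ ≤ l * (l * t ^ 3) := by gcongr
        _ = _ := by ring
    exact le_of_mul_le_mul_right h1 (by positivity)
  have hAl : A ≤ l ^ 2 := by nlinarith [one_le_pow₀ ht (n := 2)]
  have hbc : |b * c| ≤ 10 * l ^ 2 := by
    have : b * c = B + 9 * (a * d) := by rw [hB]; ring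
    rw [this]
    calc _ ≤ |B| + |9 * (a * d)| := abs_add_le _ _
      _ ≤ A + 9 * |a * d| := by rw [abs_mul 9]; norm_num; exact hBA
      _ ≤ _ := by linarith
  have hcub : ∀ y : ℝ, 0 ≤ y → y ^ 3 ≤ y * l ^ 2 + 30 * l ^ 3 → y ≤ 4 * l := by
    intro y hy h
    by_contra hc
    push Not at hc
    have h1 : 16 * l ^ 2 ≤ y ^ 2 := by nlinarith
    have h2 : y * (16 * l ^ 2) ≤ y * y ^ 2 := by gcongr
    nlinarith [mul_pos hl hl, mul_pos (mul_pos hl hl) hl]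
  have hd4 : l * t ^ 3 ≤ 4 * l * t ^ 3 := mul_le_mul_of_nonneg_right (by linarith) (by positivity)
  refine ⟨by linarith, ?_, ?_, hd.trans hd4⟩
  · apply hcub _ (by positivity)
    have e : b ^ 3 = b * A + 3 * a * (b * c) := by rw [hA]; ring
    have h1 : |b| ^ 3 ≤ |b| * A + 3 * |a| * (10 * l ^ 2) := by
      rw [← abs_pow, e]
      calc _ ≤ |b * A| + |3 * a * (b * c)| := abs_add_le _ _
        _ = |b| * A + 3 * |a| * |b * c| := by
          rw [abs_mul, abs_of_pos hApos, abs_mul (3 * a), abs_mul 3]; norm_num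
        _ ≤ _ := by gcongr
    calc (|b| * t) ^ 3 = |b| ^ 3 * t ^ 3 := by ring
      _ ≤ (|b| * A + 3 * |a| * (10 * l ^ 2)) * t ^ 3 := by gcongr
      _ = (|b| * t) * (A * t ^ 2) + 30 * l ^ 2 * (|a| * t ^ 3) := by ring
      _ ≤ (|b| * t) * l ^ 2 + 30 * l ^ 2 * l := by gcongr
      _ = _ := by ring
  · have : |c| / t ≤ 4 * l := by
      apply hcub _ (by positivity)
      have e : c ^ 3 = c * C + 3 * d * (b * c) := by rw [hC]; ring
      have h1 : |c| ^ 3 ≤ |c| * C + 3 * |d| * (10 * l ^ 2) := by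
        rw [← abs_pow, e]
        calc _ ≤ |c * C| + |3 * d * (b * c)| := abs_add_le _ _
          _ = |c| * C + 3 * |d| * |b * c| := by
            rw [abs_mul, abs_of_pos (by linarith : 0 < C), abs_mul (3 * d), abs_mul 3]; norm_num
          _ ≤ _ := by gcongr
      have h2 : |c| ^ 3 ≤ (|c| / t * l ^ 2 + 30 * l ^ 3) * t ^ 3 := by
        calc |c| ^ 3 ≤ |c| * C + 3 * |d| * (10 * l ^ 2) := h1
          _ = |c| * ((A * t ^ 2) * t ^ 2) + 30 * l ^ 2 * |d| := by rw [hCt]; ring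
          _ ≤ |c| * (l ^ 2 * t ^ 2) + 30 * l ^ 2 * (l * t ^ 3) := by gcongr
          _ = _ := by field_simp
      rw [div_pow, div_le_iff₀ (by positivity)]
      exact h2
    rwa [div_le_iff₀ t0] at this

lemma box_of_neg (α β P Q R l t : ℝ) (hl : 0 < l) (ht : 1 ≤ t) (hP : 0 < P)
    (hQ : |Q| ≤ P) (hR : R = P * t ^ 4)
    (hD : (4 * P * R - Q ^ 2) * (P * β ^ 2 - Q * α * β + R * α ^ 2) ^ 2 ≤ l ^ 4) :
    |α * P| * t ^ 3 ≤ 4 * l ∧ |α * Q + β * P| * t ≤ 4 * l ∧ |α * R + β * Q| ≤ 4 * l * t ∧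
      |β * R| ≤ 4 * l * t ^ 3 := by
  have t0 : 0 < t := by linarith
  have ht2 : 1 ≤ t ^ 2 := one_le_pow₀ ht
  have ht4 : 1 ≤ t ^ 4 := one_le_pow₀ ht
  have hQ2 : Q ^ 2 ≤ P ^ 2 * t ^ 4 := by
    rw [← sq_abs]; nlinarith [abs_nonneg Q, sq_nonneg P]
  have hN : P / 2 * (β ^ 2 + t ^ 4 * α ^ 2) ≤ P * β ^ 2 - Q * α * β + R * α ^ 2 := by
    have h1 : |Q * α * β| ≤ P * (|t ^ 2 * α| * |β|) := by
      rw [abs_mul, abs_mul, abs_mul (t ^ 2), abs_of_nonneg (by positivity : 0 ≤ t ^ 2)]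
      calc |Q| * |α| * |β| ≤ P * |α| * |β| := by gcongr
        _ = P * (1 * |α| * |β|) := by ring
        _ ≤ _ := by gcongr
    have h2 : |t ^ 2 * α| * |β| ≤ (β ^ 2 + t ^ 4 * α ^ 2) / 2 := by
      have e : t ^ 4 * α ^ 2 = |t ^ 2 * α| ^ 2 := by rw [sq_abs]; ring
      rw [e, ← sq_abs β]; nlinarith [sq_nonneg (|t ^ 2 * α| - |β|)]
    have h3 := le_abs_self (Q * α * β)
    have h4 : P * (|t ^ 2 * α| * |β|) ≤ P * ((β ^ 2 + t ^ 4 * α ^ 2) / 2) := by gcongr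
    rw [hR]; nlinarith
  set E := β ^ 2 + t ^ 4 * α ^ 2 with hE
  have hE0 : 0 ≤ E := by positivity
  have h5 : (P ^ 2 * t ^ 2 * E) ^ 2 ≤ (2 * l ^ 2) ^ 2 := by
    have h6 : 3 * (P ^ 2 * t ^ 4) * (P / 2 * E) ^ 2 ≤ l ^ 4 := by
      refine le_trans ?_ hD
      have h8 : 3 * (P ^ 2 * t ^ 4) ≤ 4 * P * R - Q ^ 2 := by rw [hR]; linarith
      have h9 : 0 ≤ 3 * (P ^ 2 * t ^ 4) := by positivity
      exact mul_le_mul h8 (pow_le_pow_left₀ (by positivity) hN 2) (by positivity) (h9.trans h8)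
    linarith [sq_nonneg (P ^ 2 * t ^ 2 * E), pow_pos hl 4]
  have h7 : P ^ 2 * t ^ 2 * E ≤ 2 * l ^ 2 := le_of_sq_le_sq' h5 (by positivity)
  have hb : |β * P| * t ≤ 3 / 2 * l := by
    apply le_of_sq_le_sq' _ (by positivity)
    rw [mul_pow, sq_abs]
    have : 0 ≤ P ^ 2 * t ^ 2 * (t ^ 4 * α ^ 2) := by positivity
    rw [hE] at h7; linarith [sq_nonneg l, h7]
  have ha : |α * P| * t ^ 3 ≤ 3 / 2 * l := by
    apply le_of_sq_le_sq' _ (by positivity)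
    rw [mul_pow, sq_abs]
    have : 0 ≤ P ^ 2 * t ^ 2 * β ^ 2 := by positivity
    rw [hE] at h7; linarith [sq_nonneg l, h7]
  have haQ : |α * Q| ≤ |α * P| := by
    rw [abs_mul, abs_mul, abs_of_pos hP]; gcongr
  have hbQ : |β * Q| ≤ |β * P| := by
    rw [abs_mul, abs_mul, abs_of_pos hP]; gcongr
  refine ⟨by linarith, ?_, ?_, ?_⟩
  · have h1 : |α * Q| * t ≤ |α * P| * t ^ 3 := by
      calc |α * Q| * t ≤ |α * P| * t * 1 := by rw [mul_one]; gcongr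
        _ ≤ |α * P| * t * t ^ 2 := by gcongr
        _ = _ := by ring
    calc _ ≤ (|α * Q| + |β * P|) * t := by gcongr; exact abs_add_le _ _
      _ ≤ _ := by linarith
  · have h1 : |α * R| = |α * P| * t ^ 3 * t := by
      rw [hR, ← mul_assoc, abs_mul (α * P), abs_of_pos (by positivity : 0 < t ^ 4)]; ring
    have h2 : |β * Q| ≤ (|β * P| * t) * t := by
      calc |β * Q| ≤ |β * P| * 1 := by rw [mul_one]; exact hbQ
        _ ≤ |β * P| * t ^ 2 := by gcongr
        _ = _ := by ring
    calc _ ≤ |α * R| + |β * Q| := abs_add_le _ _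
      _ ≤ 3 / 2 * l * t + 3 / 2 * l * t := by rw [h1]; gcongr; exact h2.trans (by gcongr)
      _ ≤ _ := by nlinarith [mul_pos hl t0]
  · have h1 : |β * R| = |β * P| * t * t ^ 3 := by
      rw [hR, ← mul_assoc, abs_mul (β * P), abs_of_pos (by positivity : 0 < t ^ 4)]; ring
    rw [h1]; exact mul_le_mul_of_nonneg_right (by linarith) (by positivity)

lemma exists_box (f : BCF) (l : ℝ) (hl : 0 < l) (h0 : disc f ≠ 0) (hf : |(disc f : ℝ)| ≤ l ^ 4) :
    ∃ g, GLeq f g ∧ ∃ t : ℝ, 1 ≤ t ∧ InBox (4 * l) t g := by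
  rcases lt_or_gt_of_ne h0 with hneg | hpos
  · -- negative discriminant: factor off a real linear form
    have hfac : ∃ α β P Q R : ℝ, 0 < P ∧ (f.1:ℝ) = α * P ∧ (f.2.1:ℝ) = α * Q + β * P ∧
        (f.2.2.1:ℝ) = α * R + β * Q ∧ (f.2.2.2:ℝ) = β * R := by
      have hfac0 : ∃ α β P Q R : ℝ, (f.1:ℝ) = α * P ∧ (f.2.1:ℝ) = α * Q + β * P ∧
        (f.2.2.1:ℝ) = α * R + β * Q ∧ (f.2.2.2:ℝ) = β * R := by
        by_cases ha : (f.1:ℝ) = 0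
        · exact ⟨0, 1, f.2.1, f.2.2.1, f.2.2.2, by simp [ha], by simp, by simp, by simp⟩
        · obtain ⟨x, hx⟩ := cubic_root f.1 f.2.1 f.2.2.1 f.2.2.2 ha
          exact ⟨1, -x, f.1, f.2.1 + f.1 * x, f.2.2.1 + f.2.1 * x + f.1 * x ^ 2,
            by ring, by ring, by ring, by linear_combination hx⟩
      obtain ⟨α, β, P, Q, R, h1, h2, h3, h4⟩ := hfac0
      have hPne : P ≠ 0 := by
        rintro rfl
        have e : (disc f : ℝ) = (α * R * Q + β * Q ^ 2) ^ 2 * 1 - 4 * α * Q * (α * Q) ^ 2 * 0 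
            + ((disc f : ℝ) - (α * R * Q + β * Q ^ 2) ^ 2) := by ring
        have e2 : (disc f : ℝ) = (Q * α * (α * R - β * Q)) ^ 2 := by
          simp only [disc]; push_cast; rw [h1, h2, h3, h4]; ring
        have : (disc f : ℝ) < 0 := by exact_mod_cast hneg
        nlinarith [sq_nonneg (Q * α * (α * R - β * Q))]
      rcases lt_or_gt_of_ne hPne with h | h
      · exact ⟨-α, -β, -P, -Q, -R, by linarith, by linarith, by linarith, by linarith, by linarith⟩
      · exact ⟨α, β, P, Q, R, h, h1, h2, h3, h4⟩
    obtain ⟨α, β, P, Q, R, hP, h1, h2, h3, h4⟩ := hfac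
    have hd : (disc f : ℝ) = -((4 * P * R - Q ^ 2) * (P * β ^ 2 - Q * α * β + R * α ^ 2) ^ 2) := by
      simp only [disc]; push_cast; rw [h1, h2, h3, h4]; ring
    have hneg' : (disc f : ℝ) < 0 := by exact_mod_cast hneg
    have hdpos : 0 < 4 * P * R - Q ^ 2 := by
      by_contra hc
      push Not at hc
      nlinarith [mul_nonneg (neg_nonneg.2 hc) (sq_nonneg (P * β ^ 2 - Q * α * β + R * α ^ 2))]
    obtain ⟨x, y, z, w, hdet, hB, hC, hA⟩ := gauss_reduce P Q R hP hdpos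
    have hdetR : (x:ℝ) * w - y * z = 1 := by exact_mod_cast hdet
    set γ : Matrix (Fin 2) (Fin 2) ℤ := !![x, y; z, w] with hγ
    have hγd : γ.det = 1 := by rw [hγ, Matrix.det_fin_two_of]; exact hdet
    refine ⟨act γ f, ⟨γ, Or.inl hγd, rfl⟩, ?_⟩
    set P' := P * (x:ℝ) ^ 2 + Q * x * y + R * y ^ 2 with hP'
    set Q' := 2 * P * (x:ℝ) * z + Q * (x * w + z * y) + 2 * R * y * w with hQ'
    set R' := P * (z:ℝ) ^ 2 + Q * z * w + R * w ^ 2 with hR'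
    obtain ⟨t, ht, htR⟩ := exists_fourth_root P' R' hA hC
    refine ⟨t, ht, ?_⟩
    have e1 : 4 * P' * R' - Q' ^ 2 = 4 * P * R - Q ^ 2 := by
      have : 4 * P' * R' - Q' ^ 2 = (4 * P * R - Q ^ 2) * ((x:ℝ) * w - y * z) ^ 2 := by
        rw [hP', hQ', hR']; ring
      rw [this, hdetR]; ring
    have e2 : P' * (α * z + β * w) ^ 2 - Q' * (α * x + β * y) * (α * z + β * w)
        + R' * (α * x + β * y) ^ 2 = P * β ^ 2 - Q * α * β + R * α ^ 2 := by
      have : P' * (α * z + β * w) ^ 2 - Q' * (α * x + β * y) * (α * z + β * w)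
        + R' * (α * x + β * y) ^ 2 = (P * β ^ 2 - Q * α * β + R * α ^ 2) * ((x:ℝ) * w - y * z) ^ 2 := by
        rw [hP', hQ', hR']; ring
      rw [this, hdetR]; ring
    have := box_of_neg (α * x + β * y) (α * z + β * w) P' Q' R' l t hl ht hA hB htR (by
      rw [e1, e2]
      rw [abs_of_neg hneg', hd] at hf; linarith)
    refine ⟨?_, ?_, ?_, ?_⟩
    · convert this.1 using 3
      simp only [act, hγd]; simp only [hγ, Matrix.of_apply, Matrix.cons_val', Matrix.cons_val_zero, Matrix.cons_val_one, Matrix.cons_val_fin_one]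
      push_cast; rw [h1, h2, h3, h4]; ring
    · convert this.2.1 using 3
      simp only [act, hγd]; simp only [hγ, Matrix.of_apply, Matrix.cons_val', Matrix.cons_val_zero, Matrix.cons_val_one, Matrix.cons_val_fin_one]
      push_cast; rw [h1, h2, h3, h4]; ring
    · convert this.2.2.1 using 2
      simp only [act, hγd]; simp only [hγ, Matrix.of_apply, Matrix.cons_val', Matrix.cons_val_zero, Matrix.cons_val_one, Matrix.cons_val_fin_one]
      push_cast; rw [h1, h2, h3, h4]; ring
    · convert this.2.2.2 using 2
      simp only [act, hγd]; simp only [hγ, Matrix.of_apply, Matrix.cons_val', Matrix.cons_val_zero, Matrix.cons_val_one, Matrix.cons_val_fin_one]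
      push_cast; rw [h1, h2, h3, h4]; ring
  · -- positive discriminant: reduce the Hessian
    have hHd : (4 * (hA f:ℝ) * hC f - (hB f:ℝ) ^ 2) = 3 * disc f := by exact_mod_cast hess_disc f
    have hpos' : (0:ℝ) < disc f := by exact_mod_cast hpos
    have hApos : (0:ℝ) < hA f := by
      have s1 : 4 * (hA f : ℝ) ^ 3 = (2 * (f.2.1:ℝ) ^ 3 + 27 * f.1 ^ 2 * f.2.2.2
          - 9 * f.1 * f.2.1 * f.2.2.1) ^ 2 + 27 * (f.1:ℝ) ^ 2 * disc f := by
        simp only [hA, disc]; push_cast; ring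
      have h2 : 0 ≤ (hA f:ℝ) ^ 3 := by nlinarith [sq_nonneg (2 * (f.2.1:ℝ) ^ 3 + 27 * f.1 ^ 2 * f.2.2.2
          - 9 * f.1 * f.2.1 * f.2.2.1), mul_nonneg (sq_nonneg (f.1:ℝ)) hpos'.le]
      have h3 : 0 ≤ (hA f:ℝ) := by
        by_contra hc
        push Not at hc
        have : (hA f:ℝ) ^ 3 < 0 := by
          have := mul_pos_of_neg_of_neg hc hc
          nlinarith
        linarith
      rcases h3.lt_or_eq with h | h
      · exact h
      · rw [← h] at hHd; nlinarith [sq_nonneg (hB f:ℝ)]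
    obtain ⟨x, y, z, w, hdet, hBr, hCr, hAr⟩ := gauss_reduce _ _ _ hApos (by rw [hHd]; linarith)
    set γ : Matrix (Fin 2) (Fin 2) ℤ := !![x, y; z, w] with hγ
    have hγd : γ.det = 1 := by rw [hγ, Matrix.det_fin_two_of]; exact hdet
    refine ⟨act γ f, ⟨γ, Or.inl hγd, rfl⟩, ?_⟩
    have eA : (hA (act γ f) : ℝ) = hA f * (x:ℝ) ^ 2 + hB f * x * y + hC f * y ^ 2 := by
      rw [hA_act, hγd]; simp [hγ]
    have eC : (hC (act γ f) : ℝ) = hA f * (z:ℝ) ^ 2 + hB f * z * w + hC f * w ^ 2 := by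
      rw [hC_act, hγd]; simp [hγ]
    have eB : (hB (act γ f) : ℝ) = 2 * hA f * (x:ℝ) * z + hB f * (x * w + z * y) + 2 * hC f * y * w := by
      rw [hB_act, hγd]; simp [hγ]
    rw [← eA] at hBr hCr hAr
    rw [← eB] at hBr
    rw [← eC] at hCr
    have hD := hess_disc (act γ f)
    rw [disc_act _ _ (Or.inl hγd)] at hD
    set g := act γ f
    obtain ⟨t, ht, htR⟩ := exists_fourth_root _ _ hAr hCr
    refine ⟨t, ht, ?_⟩
    exact box_of_pos g.1 g.2.1 g.2.2.1 g.2.2.2 (disc f) l t (hA g) (hB g) (hC g) hl ht hAr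
      (by simp [hA]) (by simp [hB]) (by simp [hC]) (by exact_mod_cast hD.symm) hBr htR
      ((le_abs_self _).trans hf)

end BCF

namespace BCF

/-- Value of a cubic at a point of the projective line. -/
def evP {F : Type*} [Field F] (a b c d : F) : Option F → F
  | none => a
  | some x => a * x ^ 3 + b * x ^ 2 + c * x + d

lemma card_evP {F : Type*} [Field F] [Fintype F] (a b c d : F)
    (h : ¬ (a = 0 ∧ b = 0 ∧ c = 0 ∧ d = 0)) :
    (Finset.univ.filter (fun P : Option F => evP a b c d P = 0)).card ≤ 3 := by
  let f : Polynomial F := Polynomial.C a * Polynomial.X ^ 3 + Polynomial.C b * Polynomial.X ^ 2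
    + Polynomial.C c * Polynomial.X + Polynomial.C d
  have hf : f ≠ 0 := by
    intro h0
    apply h
    have e : ∀ n, f.coeff n = 0 := by intro n; rw [h0]; simp
    have e0 := e 0
    have e1 := e 1
    have e2 := e 2
    have e3 := e 3
    simp [f, Polynomial.coeff_X, Polynomial.coeff_C] at e0 e1 e2 e3
    exact ⟨e3, e2, e1, e0⟩
  have hroot : ∀ x : F, evP a b c d (some x) = 0 → x ∈ f.roots.toFinset := by
    intro x hx
    rw [Multiset.mem_toFinset, Polynomial.mem_roots hf]
    simp only [evP] at hx
    simp [f, hx]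
  by_cases ha : a = 0
  · have hdeg : f.natDegree ≤ 2 := by
      simp only [f, ha]; simp only [map_zero, zero_mul, zero_add]; compute_degree
    have hsub : (Finset.univ.filter (fun P : Option F => evP a b c d P = 0)) ⊆
        insert none (f.roots.toFinset.image some) := by
      intro P hP
      rw [Finset.mem_filter] at hP
      cases P with
      | none => simp
      | some x => 
        apply Finset.mem_insert_of_mem
        exact Finset.mem_image_of_mem _ (hroot x hP.2)
    refine (Finset.card_le_card hsub).trans ((Finset.card_insert_le _ _).trans ?_)
    have := (Finset.card_image_le (s := f.roots.toFinset) (f := (some : F → Option F))).trans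
      ((Multiset.toFinset_card_le _).trans ((Polynomial.card_roots' f).trans hdeg))
    omega
  · have hdeg : f.natDegree ≤ 3 := by
      simp only [f]; compute_degree
    have hsub : (Finset.univ.filter (fun P : Option F => evP a b c d P = 0)) ⊆
        (f.roots.toFinset.image some) := by
      intro P hP
      rw [Finset.mem_filter] at hP
      cases P with
      | none => exact absurd hP.2 ha
      | some x => exact Finset.mem_image_of_mem _ (hroot x hP.2)
    refine (Finset.card_le_card hsub).trans ?_
    exact (Finset.card_image_le (s := f.roots.toFinset) (f := (some : F → Option F))).trans
      ((Multiset.toFinset_card_le _).trans ((Polynomial.card_roots' f).trans hdeg))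

/-- Coefficients of the cube of the linear form vanishing at `P`. -/
def cubeVec {F : Type*} [Field F] : Option F → (Fin 4 → F)
  | none => ![0, 0, 0, 1]
  | some x => ![1, -3 * x, 3 * x ^ 2, -x ^ 3]

/-- Coefficients of `L_P² (m u + n v)`. -/
def dblVec {F : Type*} [Field F] : Option F → F → F → (Fin 4 → F)
  | none, m, n => ![0, 0, m, n]
  | some x, m, n => ![m, n - 2 * x * m, x ^ 2 * m - 2 * x * n, x ^ 2 * n]

lemma card_cubeVec {F : Type*} [Field F] [Fintype F] (h3 : (3:F) ≠ 0) (k : Fin 4 → F) (hk : k ≠ 0) :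
    (Finset.univ.filter (fun P : Option F => ∑ i, k i * cubeVec P i = 0)).card ≤ 3 := by
  have h := card_evP (-k 3) (3 * k 2) (-3 * k 1) (k 0) (by
    rintro ⟨h1, h2, h4, h5⟩
    apply hk
    funext i
    fin_cases i
    · exact h5
    · simpa [h3] using h4
    · simpa [h3] using h2
    · simpa using h1)
  refine le_trans (Finset.card_le_card ?_) h
  intro P hP
  rw [Finset.mem_filter] at hP ⊢
  refine ⟨Finset.mem_univ _, ?_⟩
  have := hP.2
  cases P with
  | none => simp [cubeVec, Fin.sum_univ_four] at this; simp [evP, this]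
  | some x => 
    simp [cubeVec, Fin.sum_univ_four] at this
    simp only [evP]; linear_combination this

/-- A set of integers in a residue class and in a short interval. -/
lemma card_congr_le (T : Finset ℤ) (m : ℕ) (hm : 0 < m) (L : ℝ) (hL : 0 ≤ L)
    (h : ∀ x ∈ T, ∀ y ∈ T, (m:ℤ) ∣ x - y ∧ ((x - y : ℤ) : ℝ) ≤ L) : (T.card : ℝ) ≤ L / m + 1 := by
  rcases T.eq_empty_or_nonempty with rfl | hne
  · simp; positivity
  set x0 := T.min' hne with hx0
  have hx0T : x0 ∈ T := T.min'_mem hne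
  have hm' : (0:ℝ) < m := by exact_mod_cast hm
  have : T.card ≤ (Finset.range (⌊L / m⌋₊ + 1)).card := by
    apply Finset.card_le_card_of_injOn (fun x => ((x - x0) / m).toNat)
    · intro x hx
      have hx' : x ∈ T := hx
      obtain ⟨⟨k, hk⟩, h2⟩ := h x hx' x0 hx0T
      have h3 : x0 ≤ x := T.min'_le x hx'
      have hk0 : 0 ≤ k := by
        by_contra hc
        push Not at hc
        have : (0:ℤ) < m := by exact_mod_cast hm
        nlinarith
      simp only [Finset.coe_range, Set.mem_Iio]
      rw [hk, Int.mul_ediv_cancel_left _ (by positivity)]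
      rw [Nat.lt_succ_iff]
      apply Nat.le_floor
      rw [le_div_iff₀ hm']
      have h4 : ((k.toNat : ℕ) : ℝ) = (k:ℝ) := by
        have : ((k.toNat : ℕ) : ℤ) = k := Int.toNat_of_nonneg hk0
        exact_mod_cast this
      rw [h4]
      rw [hk] at h2; push_cast at h2; linarith
    · intro x hx y hy hxy
      have hx' : x ∈ T := hx
      have hy' : y ∈ T := hy
      obtain ⟨⟨k, hk⟩, h2⟩ := h x hx' x0 hx0T
      obtain ⟨⟨l, hl⟩, h2'⟩ := h y hy' x0 hx0T
      have h3 : x0 ≤ x := T.min'_le x hx'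
      have h3' : x0 ≤ y := T.min'_le y hy'
      have hmz : (0:ℤ) < m := by exact_mod_cast hm
      have hk0 : 0 ≤ k := by
        by_contra hc; push Not at hc; nlinarith
      have hl0 : 0 ≤ l := by
        by_contra hc; push Not at hc; nlinarith
      simp only [hk, hl] at hxy
      rw [Int.mul_ediv_cancel_left _ (by positivity), Int.mul_ediv_cancel_left _ (by positivity)] at hxy
      have : k = l := by omega
      rw [this] at hk; linarith
  rw [Finset.card_range] at this
  calc (T.card : ℝ) ≤ ((⌊L / m⌋₊ + 1 : ℕ) : ℝ) := by exact_mod_cast this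
    _ ≤ L / m + 1 := by push_cast; gcongr; exact Nat.floor_le (by positivity)

end BCF

namespace BCF

/-- The exponential sum over the box `∏ [0, K i)`. -/
def expSum (q : ℕ) [NeZero q] (K : Fin 4 → ℕ) (x : Fin 4 → ZMod q) : ℂ :=
  ∏ i, ∑ k ∈ Finset.range (K i), ZMod.stdAddChar ((k : ZMod q) * x i)

lemma stdAddChar_sum (q : ℕ) [NeZero q] (x : Fin 4 → ZMod q) :
    ∏ i, (ZMod.stdAddChar (x i) : ℂ) = ZMod.stdAddChar (∑ i, x i) := by
  simp [Fin.prod_univ_four, Fin.sum_univ_four, AddChar.map_add_eq_mul]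

lemma expSum_eq (q : ℕ) [NeZero q] (K : Fin 4 → ℕ) (x : Fin 4 → ZMod q) :
    expSum q K x = ∑ k ∈ Fintype.piFinset (fun i => Finset.range (K i)),
      (ZMod.stdAddChar (∑ i, (k i : ZMod q) * x i) : ℂ) := by
  unfold expSum
  rw [Finset.prod_univ_sum]
  exact Finset.sum_congr rfl fun k _ => stdAddChar_sum q _

lemma sum_subgroup_char (q : ℕ) [NeZero q] (H : AddSubgroup (Fin 4 → ZMod q)) (m : Fin 4 → ZMod q) :
    ∑ x : H, (ZMod.stdAddChar (∑ i, m i * x.1 i) : ℂ) =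
      if ∀ h ∈ H, ∑ i, m i * h i = 0 then (Nat.card H : ℂ) else 0 := by
  let χ : AddChar H ℂ :=
    { toFun := fun x => ZMod.stdAddChar (∑ i, m i * x.1 i)
      map_zero_eq_one' := by simp
      map_add_eq_mul' := by
        intro x y
        rw [← AddChar.map_add_eq_mul]
        congr 1
        simp only [AddSubgroup.coe_add, Pi.add_apply, mul_add, Finset.sum_add_distrib] }
  have h := AddChar.sum_eq_ite χ
  have e : (χ = 0) ↔ ∀ h ∈ H, ∑ i, m i * h i = 0 := by
    constructor
    · intro h0 h hh
      have h1 : χ ⟨h, hh⟩ = 1 := by rw [h0]; rfl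
      apply ZMod.injective_stdAddChar
      rw [AddChar.map_zero_eq_one]
      exact h1
    · intro h0
      ext x
      show (ZMod.stdAddChar (∑ i, m i * x.1 i) : ℂ) = 1
      rw [h0 x.1 x.2, AddChar.map_zero_eq_one]
  rw [Nat.card_eq_fintype_card]
  simp only [e] at h
  exact h

/-- Integer vectors `m` with `|m i| < K i` annihilating `H`. -/
def annSet (q : ℕ) (K : Fin 4 → ℕ) (H : AddSubgroup (Fin 4 → ZMod q)) : Finset (Fin 4 → ℤ) :=
  (Fintype.piFinset (fun i => Finset.Ioo (-(K i : ℤ)) (K i))).filter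
    (fun m => ∀ h ∈ H, ∑ i, (m i : ZMod q) * h i = 0)

lemma mem_annSet {q : ℕ} {K : Fin 4 → ℕ} {H : AddSubgroup (Fin 4 → ZMod q)} {m : Fin 4 → ℤ} :
    m ∈ annSet q K H ↔ (∀ i, m i ∈ Finset.Ioo (-(K i : ℤ)) (K i)) ∧
      ∀ h ∈ H, ∑ i, (m i : ZMod q) * h i = 0 := by
  unfold annSet
  rw [Finset.mem_filter, Fintype.mem_piFinset]

lemma fourier_bound (q : ℕ) [NeZero q] (K : Fin 4 → ℕ) (H : AddSubgroup (Fin 4 → ZMod q)) :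
    ∑ x : H, ‖expSum q K x.1‖ ^ 2 ≤ (Nat.card H : ℝ) * ((∏ i, (K i : ℝ)) * (annSet q K H).card) := by
  set Bx := Fintype.piFinset (fun i => Finset.range (K i)) with hBx
  have h1 : ((∑ x : H, ‖expSum q K x.1‖ ^ 2 : ℝ) : ℂ) =
      ∑ k ∈ Bx, ∑ l ∈ Bx, if ∀ h ∈ H, ∑ i, ((k i : ZMod q) - (l i : ZMod q)) * h i = 0
        then (Nat.card H : ℂ) else 0 := by
    push_cast
    have : ∀ x : H, ((‖expSum q K x.1‖ : ℂ)) ^ 2 = ∑ k ∈ Bx, ∑ l ∈ Bx,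
        (ZMod.stdAddChar (∑ i, ((k i : ZMod q) - (l i : ZMod q)) * x.1 i) : ℂ) := by
      intro x
      rw [← Complex.mul_conj', expSum_eq, map_sum, Finset.sum_mul_sum]
      refine Finset.sum_congr rfl fun k _ => Finset.sum_congr rfl fun l _ => ?_
      rw [← AddChar.map_neg_eq_conj, ← AddChar.map_add_eq_mul]
      congr 1
      simp only [sub_mul, Finset.sum_sub_distrib]; ring
    rw [Finset.sum_congr rfl fun x _ => this x, Finset.sum_comm]
    refine Finset.sum_congr rfl fun k _ => ?_
    rw [Finset.sum_comm]
    refine Finset.sum_congr rfl fun l _ => ?_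
    exact sum_subgroup_char q H (fun i => (k i : ZMod q) - (l i : ZMod q))
  have h2 : (∑ x : H, ‖expSum q K x.1‖ ^ 2 : ℝ) =
      ∑ k ∈ Bx, ∑ l ∈ Bx, if ∀ h ∈ H, ∑ i, ((k i : ZMod q) - (l i : ZMod q)) * h i = 0
        then (Nat.card H : ℝ) else 0 := by
    have := congrArg Complex.re h1
    rw [Complex.ofReal_re] at this
    rw [this]
    simp only [Complex.re_sum]
    refine Finset.sum_congr rfl fun k _ => Finset.sum_congr rfl fun l _ => ?_
    split_ifs <;> simp
  rw [h2]
  have h3 : ∀ k ∈ Bx, (∑ l ∈ Bx, if ∀ h ∈ H, ∑ i, ((k i : ZMod q) - (l i : ZMod q)) * h i = 0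
        then (Nat.card H : ℝ) else 0) ≤ (Nat.card H : ℝ) * (annSet q K H).card := by
    intro k hk
    rw [← Finset.sum_filter, Finset.sum_const, nsmul_eq_mul, mul_comm]
    gcongr
    apply Finset.card_le_card_of_injOn (fun l => fun i => (k i : ℤ) - (l i : ℤ))
    · intro l hl
      have hl' := Finset.mem_filter.1 (Finset.mem_coe.1 hl)
      apply Finset.mem_coe.2
      have hk' := Fintype.mem_piFinset.1 hk
      have hl'' := Fintype.mem_piFinset.1 hl'.1
      refine mem_annSet.2 ⟨fun i => ?_, ?_⟩
      · have a1 := Finset.mem_range.1 (hk' i)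
        have a2 := Finset.mem_range.1 (hl'' i)
        refine Finset.mem_Ioo.2 ⟨?_, ?_⟩ <;> dsimp only <;> omega
      · simpa using hl'.2
    · intro l _ l' _ h
      funext i
      have := congrFun h i
      simp only at this
      omega
  refine (Finset.sum_le_sum h3).trans ?_
  rw [Finset.sum_const, hBx, Fintype.card_piFinset, nsmul_eq_mul]
  simp only [Finset.card_range]
  push_cast
  apply le_of_eq; ring

/-- Lower bound for the exponential sum on the box. -/
lemma expSum_lower (q : ℕ) [NeZero q] (K : Fin 4 → ℕ) (B : Fin 4 → ℝ) (x : Fin 4 → ℤ)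
    (hx : ∀ i, |(x i : ℝ)| ≤ B i) (hK : ∀ i, K i = 1 ∨ 8 * (K i) * B i ≤ q) :
    (∏ i, (K i : ℝ) / 2) ≤ ‖expSum q K (fun i => (x i : ZMod q))‖ := by
  unfold expSum
  rw [norm_prod]
  apply Finset.prod_le_prod
  · intro i _; positivity
  intro i _
  rcases hK i with h1 | h1
  · rw [h1]; simp; norm_num
  · have hq : (0:ℝ) < q := by exact_mod_cast Nat.pos_of_ne_zero (NeZero.ne q)
    refine le_trans ?_ (Complex.re_le_norm _)
    rw [Complex.re_sum]
    have : ∀ k ∈ Finset.range (K i), (1/2 : ℝ) ≤ (ZMod.stdAddChar ((k : ZMod q) * ((x i : ℤ) : ZMod q)) : ℂ).re := by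
      intro k hk
      have hk' := Finset.mem_range.1 hk
      have e : ((k : ZMod q) * ((x i : ℤ) : ZMod q)) = (((k : ℤ) * x i : ℤ) : ZMod q) := by push_cast; rfl
      rw [e, ZMod.stdAddChar_coe]
      have e2 : (2 * (Real.pi : ℂ) * Complex.I * (((k : ℤ) * x i : ℤ) : ℂ) / (q : ℂ)) =
          ((2 * Real.pi * (k * x i) / q : ℝ) : ℂ) * Complex.I := by push_cast; ring
      rw [e2, Complex.exp_ofReal_mul_I_re]
      set y : ℝ := 2 * Real.pi * (k * x i) / q with hy
      have hyle : |y| ≤ 1 := by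
        rw [hy, abs_div, abs_of_pos hq, div_le_one hq, abs_mul, abs_mul, abs_mul, abs_of_pos Real.pi_pos]
        have hkK : (k:ℝ) ≤ K i := by exact_mod_cast hk'.le
        have hB : 0 ≤ B i := (abs_nonneg _).trans (hx i)
        rw [abs_of_nonneg (Nat.cast_nonneg k : (0:ℝ) ≤ k), abs_two]
        calc 2 * Real.pi * ((k:ℝ) * |(x i : ℝ)|) ≤ 2 * 4 * ((K i : ℝ) * B i) := by
              gcongr
              · exact Real.pi_le_four
              · exact hx i
          _ ≤ q := by linarith
      have h2 := Real.one_sub_sq_div_two_le_cos (x := y)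
      have h3 : y ^ 2 ≤ 1 := by rw [← sq_abs]; exact pow_le_one₀ (abs_nonneg _) hyle
      linarith
    have h5 := Finset.sum_le_sum this
    rw [Finset.sum_const, Finset.card_range, nsmul_eq_mul] at h5
    linarith

end BCF

namespace BCF

lemma sqf_dvd {q : ℕ} (hq : Squarefree q) (n : ℤ) (h : ∀ p : ℕ, p.Prime → p ∣ q → (p:ℤ) ∣ n) :
    (q:ℤ) ∣ n := by
  rw [Int.natCast_dvd]
  rw [← Nat.prod_primeFactors_of_squarefree hq]
  apply Finset.prod_primes_dvd
  · intro p hp; exact (Nat.prime_of_mem_primeFactors hp).prime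
  · intro p hp
    exact Int.natCast_dvd.1 (h p (Nat.prime_of_mem_primeFactors hp) (Nat.dvd_of_mem_primeFactors hp))

/-- Prime divisors of `q` as a type. -/
abbrev PI (q : ℕ) := {p : ℕ // p ∈ q.primeFactors}

instance (q : ℕ) (p : PI q) : Fact (p.1).Prime := ⟨Nat.prime_of_mem_primeFactors p.2⟩

lemma PI.dvd {q : ℕ} (p : PI q) : p.1 ∣ q := Nat.dvd_of_mem_primeFactors p.2

/-- Reduction modulo `p`. -/
def red {q : ℕ} (p : PI q) : (Fin 4 → ZMod q) →+ (Fin 4 → ZMod p.1) :=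
  (ZMod.castHom p.dvd (ZMod p.1)).toAddMonoidHom.compLeft (Fin 4)

lemma red_apply {q : ℕ} (p : PI q) (x : Fin 4 → ZMod q) (i : Fin 4) :
    red p x i = ZMod.castHom p.dvd (ZMod p.1) (x i) := rfl

lemma red_int {q : ℕ} (p : PI q) (x : Fin 4 → ℤ) :
    red p (fun i => (x i : ZMod q)) = fun i => (x i : ZMod p.1) := by
  funext i; rw [red_apply]; simp

/-- Local systems of subgroups. -/
abbrev LocSys (q : ℕ) := ∀ p : PI q, Option (ZMod p.1) → AddSubgroup (Fin 4 → ZMod p.1)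

/-- The global subgroup attached to a choice of points. -/
def HP {q : ℕ} (Loc : LocSys q) (P : ∀ p : PI q, Option (ZMod p.1)) : AddSubgroup (Fin 4 → ZMod q) :=
  ⨅ p : PI q, (Loc p (P p)).comap (red p)

lemma mem_HP {q : ℕ} {Loc : LocSys q} {P : ∀ p : PI q, Option (ZMod p.1)} {x : Fin 4 → ZMod q} :
    x ∈ HP Loc P ↔ ∀ p, red p x ∈ Loc p (P p) := by
  unfold HP; simp [AddSubgroup.mem_iInf]

lemma red_inj {q : ℕ} [NeZero q] (hq : Squarefree q) (x y : Fin 4 → ZMod q)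
    (h : ∀ p : PI q, red p x = red p y) : x = y := by
  funext i
  have h1 : (((x i).val : ℤ) : ZMod q) = (((y i).val : ℤ) : ZMod q) := by
    rw [eq_comm, ZMod.intCast_eq_intCast_iff_dvd_sub]
    apply sqf_dvd hq
    intro p hp hpq
    have hpm : p ∈ q.primeFactors := Nat.mem_primeFactors.2 ⟨hp, hpq, NeZero.ne q⟩
    have h2 := congrFun (h ⟨p, hpm⟩) i
    rw [red_apply, red_apply] at h2
    have e : ∀ z : ZMod q, ZMod.castHom hpq (ZMod p) z = ((z.val : ℤ) : ZMod p) := by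
      intro z
      conv_lhs => rw [← ZMod.natCast_zmod_val z]
      simp
    have h3 : (((x i).val : ℤ) : ZMod p) = (((y i).val : ℤ) : ZMod p) := by
      rw [← e, ← e]; exact h2
    rw [eq_comm, ZMod.intCast_eq_intCast_iff_dvd_sub] at h3
    exact h3
  simpa using h1

lemma card_HP {q : ℕ} [NeZero q] (hq : Squarefree q) (Loc : LocSys q)
    (P : ∀ p : PI q, Option (ZMod p.1)) (w : PI q → ℕ)
    (hw : ∀ p P, Nat.card (Loc p P) ≤ w p) : Nat.card (HP Loc P) ≤ ∏ p, w p := by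
  have h1 : Nat.card (HP Loc P) ≤ Nat.card (∀ p : PI q, Loc p (P p)) := by
    apply Nat.card_le_card_of_injective
      (fun x : HP Loc P => fun p => (⟨red p x.1, mem_HP.1 x.2 p⟩ : Loc p (P p)))
    intro x y h
    apply Subtype.ext
    apply red_inj hq
    intro p
    have := congrFun h p
    exact congrArg Subtype.val this
  rw [Nat.card_pi] at h1
  exact h1.trans (Finset.prod_le_prod' fun p _ => hw p _)

lemma ann_HP {q : ℕ} [NeZero q] (Loc : LocSys q)
    (P : ∀ p : PI q, Option (ZMod p.1)) (hc : ∀ p P, cubeVec P ∈ Loc p P) (m : Fin 4 → ℤ)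
    (hm : ∀ h ∈ HP Loc P, ∑ i, (m i : ZMod q) * h i = 0) (p : PI q) :
    ∑ i, (m i : ZMod p.1) * cubeVec (P p) i = 0 := by
  obtain ⟨k, hk⟩ := p.dvd
  have hy : ∀ i, ∃ y : ℤ, (y : ZMod p.1) = cubeVec (P p) i := fun i =>
    ZMod.intCast_surjective _
  choose y hy using hy
  have hmem : (fun i => (((k:ℤ) * y i : ℤ) : ZMod q)) ∈ HP Loc P := by
    rw [mem_HP]
    intro p'
    rw [red_int p' (fun i => (k:ℤ) * y i)]
    by_cases hpp : p' = p
    · subst hpp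
      have : (fun i => (((k:ℤ) * y i : ℤ) : ZMod p'.1)) = k • cubeVec (P p') := by
        funext i; push_cast; rw [hy i]; simp
      rw [this]
      exact AddSubgroup.nsmul_mem _ (hc p' (P p')) k
    · have hd : p'.1 ∣ k := by
        have h1 : p'.1 ∣ p.1 * k := hk ▸ p'.dvd
        have hp1 : p.1.Prime := Fact.out
        have hp2 : p'.1.Prime := Fact.out
        rcases (Nat.Prime.dvd_mul hp2).1 h1 with h | h
        · exact absurd (Subtype.ext ((Nat.prime_dvd_prime_iff_eq hp2 hp1).1 h)) hpp
        · exact h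
      have : (fun i => (((k:ℤ) * y i : ℤ) : ZMod p'.1)) = 0 := by
        funext i; push_cast
        rw [(ZMod.natCast_eq_zero_iff k p'.1).2 hd]; simp
      rw [this]; exact AddSubgroup.zero_mem _
  have h2 := hm _ hmem
  have h3 : ((k * ∑ i, m i * y i : ℤ) : ZMod q) = 0 := by
    rw [← h2, Finset.mul_sum]; push_cast
    exact Finset.sum_congr rfl fun i _ => by ring
  rw [ZMod.intCast_zmod_eq_zero_iff_dvd] at h3
  have hk0 : (k:ℤ) ≠ 0 := by
    rintro h; apply NeZero.ne q; rw [hk]; simp [Int.natCast_eq_zero.1 h]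
  have h4 : ((p.1:ℕ):ℤ) ∣ ∑ i, m i * y i := by
    obtain ⟨z, hz⟩ := h3
    refine ⟨z, mul_left_cancel₀ hk0 ?_⟩
    rw [hz]; rw [show (q:ℤ) = (p.1:ℤ) * k by exact_mod_cast hk]; ring
  rw [← ZMod.intCast_zmod_eq_zero_iff_dvd] at h4
  rw [← h4]; push_cast
  exact Finset.sum_congr rfl fun i _ => by rw [hy i]

lemma card_points {q : ℕ} [NeZero q] (h3 : Nat.Coprime q 3) (m : Fin 4 → ℤ) (j : Fin 4) :
    (Finset.univ.filter (fun P : ∀ p : PI q, Option (ZMod p.1) =>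
      ∀ p : PI q, ∑ i, (m i : ZMod p.1) * cubeVec (P p) i = 0)).card
      ≤ 3 ^ q.primeFactors.card * Int.gcd (m j) q := by
  have e : (Finset.univ.filter (fun P : ∀ p : PI q, Option (ZMod p.1) =>
      ∀ p : PI q, ∑ i, (m i : ZMod p.1) * cubeVec (P p) i = 0)) =
      Fintype.piFinset (fun p : PI q => Finset.univ.filter
        (fun Q : Option (ZMod p.1) => ∑ i, (m i : ZMod p.1) * cubeVec Q i = 0)) := by
    ext P; simp
  rw [e, Fintype.card_piFinset]
  have hle : ∀ p : PI q, (Finset.univ.filter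
        (fun Q : Option (ZMod p.1) => ∑ i, (m i : ZMod p.1) * cubeVec Q i = 0)).card
        ≤ 3 * (if (p.1:ℤ) ∣ m j then p.1 else 1) := by
    intro p
    have hp : p.1.Prime := Fact.out
    split_ifs with hd
    · refine (Finset.card_le_univ _).trans ?_
      rw [Fintype.card_option, ZMod.card]
      have := hp.two_le; omega
    · rw [mul_one]
      refine le_trans (le_of_eq ?_) (card_cubeVec (F := ZMod p.1) ?_ (fun i => (m i : ZMod p.1)) ?_)
      · congr
      · intro h0
        have : p.1 ∣ 3 := (ZMod.natCast_eq_zero_iff 3 p.1).1 (by exact_mod_cast h0)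
        have := Nat.dvd_gcd p.dvd this
        rw [h3] at this
        exact hp.one_lt.ne' (Nat.dvd_one.1 this)
      · intro h0
        apply hd
        have := congrFun h0 j
        exact (ZMod.intCast_zmod_eq_zero_iff_dvd _ _).1 this
  refine (Finset.prod_le_prod' fun p _ => hle p).trans ?_
  rw [Finset.prod_mul_distrib, Finset.prod_const, Finset.card_univ, Fintype.card_coe]
  apply Nat.mul_le_mul_left
  rw [Finset.prod_ite, Finset.prod_const_one, mul_one]
  apply Nat.le_of_dvd
  · apply Nat.pos_of_ne_zero
    rw [Ne, Int.gcd_eq_zero_iff]; rintro ⟨_, h⟩; exact NeZero.ne q (by exact_mod_cast h)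
  have : ∏ x ∈ Finset.univ.filter (fun p : PI q => (p.1:ℤ) ∣ m j), x.1 =
      ∏ x ∈ (Finset.univ.filter (fun p : PI q => (p.1:ℤ) ∣ m j)).map ⟨Subtype.val, Subtype.val_injective⟩, x := by
    rw [Finset.prod_map]; rfl
  rw [this]
  apply Finset.prod_primes_dvd
  · intro p hp
    obtain ⟨x, _, rfl⟩ := Finset.mem_map.1 hp
    exact (Nat.prime_of_mem_primeFactors x.2).prime
  · intro p hp
    obtain ⟨x, hx, rfl⟩ := Finset.mem_map.1 hp
    exact Int.dvd_gcd (Finset.mem_filter.1 hx).2 (by exact_mod_cast Nat.dvd_of_mem_primeFactors x.2)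

lemma sum_gcd (q K : ℕ) (hq : Squarefree q) :
    (∑ n ∈ Finset.Ioo (-(K:ℤ)) K, if n = 0 then 0 else (Int.gcd n q : ℝ)) ≤ 2 ^ q.primeFactors.card * (2 * K) := by
  have hq0 : q ≠ 0 := hq.ne_zero
  set N := (Finset.Ioo (-(K:ℤ)) K).filter (fun n => n ≠ 0) with hN
  have e1 : (∑ n ∈ Finset.Ioo (-(K:ℤ)) K, if n = 0 then 0 else (Int.gcd n q : ℝ)) =
      ∑ n ∈ N, (Int.gcd n q : ℝ) := by
    rw [hN, Finset.sum_filter]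
    refine Finset.sum_congr rfl fun n _ => ?_
    by_cases h : n = 0 <;> simp [h]
  rw [e1]
  have h1 : ∀ n ∈ N, (Int.gcd n q : ℝ) ≤ ∑ g ∈ q.divisors, if (g:ℤ) ∣ n then (g:ℝ) else 0 := by
    intro n _
    have hmem : Int.gcd n q ∈ q.divisors :=
      Nat.mem_divisors.2 ⟨by exact_mod_cast Int.gcd_dvd_right n q, hq0⟩
    refine le_trans ?_ (Finset.single_le_sum (f := fun g : ℕ => if (g:ℤ) ∣ n then (g:ℝ) else 0) ?_ hmem)
    · simp only [Int.gcd_dvd_left n q, if_true]; exact le_rfl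
    · intro i _; positivity
  refine (Finset.sum_le_sum h1).trans ?_
  rw [Finset.sum_comm]
  have h2 : ∀ g ∈ q.divisors, (∑ n ∈ N, if (g:ℤ) ∣ n then (g:ℝ) else 0) ≤ 2 * K := by
    intro g hg
    have hg0 : 0 < g := Nat.pos_of_mem_divisors hg
    rw [← Finset.sum_filter, Finset.sum_const, nsmul_eq_mul]
    have hc : (N.filter (fun n => (g:ℤ) ∣ n)).card ≤ 2 * (K / g) := by
      have hsub : N.filter (fun n => (g:ℤ) ∣ n) ⊆
          ((Finset.Icc (-((K/g:ℕ):ℤ)) ((K/g:ℕ):ℤ)).erase 0).image (fun z => (g:ℤ) * z) := by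
        intro n hn
        rw [Finset.mem_filter, hN, Finset.mem_filter, Finset.mem_Ioo] at hn
        obtain ⟨⟨⟨ha, hb⟩, hc⟩, z, rfl⟩ := hn
        rw [Finset.mem_image]
        refine ⟨z, Finset.mem_erase.2 ⟨?_, ?_⟩, rfl⟩
        · rintro rfl; simp at hc
        · have hg' : (0:ℤ) < g := by exact_mod_cast hg0
          rw [Finset.mem_Icc]; push_cast
          constructor
          · have : -z ≤ (K:ℤ) / g := by rw [Int.le_ediv_iff_mul_le hg']; nlinarith
            linarith
          · rw [Int.le_ediv_iff_mul_le hg']; nlinarith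
      refine (Finset.card_le_card hsub).trans (Finset.card_image_le.trans ?_)
      rw [Finset.card_erase_of_mem (Finset.mem_Icc.2 ⟨neg_nonpos.2 (Int.natCast_nonneg _), Int.natCast_nonneg _⟩), Int.card_Icc]
      omega
    have h5 : ((K / g : ℕ) : ℝ) * g ≤ K := by exact_mod_cast Nat.div_mul_le_self K g
    calc ((N.filter (fun n => (g:ℤ) ∣ n)).card : ℝ) * g ≤ ((2 * (K / g) : ℕ) : ℝ) * g := by gcongr
      _ = 2 * (((K / g : ℕ) : ℝ) * g) := by push_cast; ring
      _ ≤ 2 * K := by linarith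
  refine (Finset.sum_le_sum h2).trans ?_
  rw [Finset.sum_const, nsmul_eq_mul]
  have h3 : q.divisors.card = 2 ^ q.primeFactors.card := by
    rw [Nat.card_divisors hq0]
    rw [Finset.prod_congr rfl (g := fun _ => 2), Finset.prod_const]
    intro p hp
    have := (Nat.squarefree_iff_factorization_le_one hq0).1 hq p
    have h4 := (Nat.prime_of_mem_primeFactors hp).factorization_pos_of_dvd hq0 (Nat.dvd_of_mem_primeFactors hp)
    omega
  rw [h3]; push_cast; rfl

end BCF

namespace BCF

lemma sum_ann {q : ℕ} [NeZero q] (hq : Squarefree q) (h3 : Nat.Coprime q 3) (Loc : LocSys q)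
    (hc : ∀ p P, cubeVec P ∈ Loc p P) (K : Fin 4 → ℕ) :
    (∑ P : ∀ p : PI q, Option (ZMod p.1), ((annSet q K (HP Loc P)).card : ℝ)) ≤
      3 ^ q.primeFactors.card * (q + 64 * 2 ^ q.primeFactors.card * ∏ i, (K i : ℝ)) := by
  set Bx := Fintype.piFinset (fun i => Finset.Ioo (-(K i : ℤ)) (K i)) with hBx
  set w := q.primeFactors.card with hw
  have h1 : ∀ P : ∀ p : PI q, Option (ZMod p.1), ((annSet q K (HP Loc P)).card : ℝ) ≤
      ∑ m ∈ Bx, if (∀ p : PI q, ∑ i, (m i : ZMod p.1) * cubeVec (P p) i = 0) then (1:ℝ) else 0 := by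
    intro P
    rw [← Finset.sum_filter, Finset.sum_const, nsmul_eq_mul, mul_one]
    gcongr
    intro m hm
    rw [mem_annSet] at hm
    refine Finset.mem_filter.2 ⟨Fintype.mem_piFinset.2 hm.1, ?_⟩
    exact fun p => ann_HP Loc P hc m hm.2 p
  refine (Finset.sum_le_sum fun P _ => h1 P).trans ?_
  rw [Finset.sum_comm]
  have h2 : ∀ m ∈ Bx, (∑ P : ∀ p : PI q, Option (ZMod p.1),
      if (∀ p : PI q, ∑ i, (m i : ZMod p.1) * cubeVec (P p) i = 0) then (1:ℝ) else 0) ≤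
      3 ^ w * ((if m = 0 then (q:ℝ) else 0) + ∑ j, if m j = 0 then 0 else (Int.gcd (m j) q : ℝ)) := by
    intro m _
    have hcard : ∀ j, (∑ P : ∀ p : PI q, Option (ZMod p.1),
      if (∀ p : PI q, ∑ i, (m i : ZMod p.1) * cubeVec (P p) i = 0) then (1:ℝ) else 0) ≤
      3 ^ w * (Int.gcd (m j) q : ℝ) := by
      intro j
      rw [← Finset.sum_filter, Finset.sum_const, nsmul_eq_mul, mul_one]
      have := card_points h3 m j
      have h5 := (Nat.cast_le (α := ℝ)).2 this
      push_cast at h5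
      refine le_trans (le_of_eq ?_) h5
      congr
    have hnn : ∀ j, (0:ℝ) ≤ if m j = 0 then 0 else (Int.gcd (m j) q : ℝ) := by
      intro j; split_ifs <;> positivity
    by_cases hm : m = 0
    · refine (hcard 0).trans ?_
      rw [if_pos hm]
      gcongr
      rw [hm]
      simp
    · have : ∃ j, m j ≠ 0 := by
        by_contra hcon
        push Not at hcon
        exact hm (funext hcon)
      obtain ⟨j, hj⟩ := this
      refine (hcard j).trans ?_
      rw [if_neg hm, zero_add]
      gcongr
      refine le_trans (le_of_eq ?_) (Finset.single_le_sum (fun j _ => hnn j) (Finset.mem_univ j))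
      rw [if_neg hj]
  refine (Finset.sum_le_sum h2).trans ?_
  rw [← Finset.mul_sum, Finset.sum_add_distrib]
  gcongr
  · rw [Finset.sum_ite_eq']; split_ifs <;> simp
  rw [Finset.sum_comm]
  have h4 : ∀ j ∈ (Finset.univ : Finset (Fin 4)), (∑ m ∈ Bx, if m j = 0 then 0 else (Int.gcd (m j) q : ℝ)) ≤
      16 * 2 ^ w * ∏ i, (K i : ℝ) := by
    intro j _
    have e : ∀ m : Fin 4 → ℤ, (if m j = 0 then 0 else (Int.gcd (m j) q : ℝ)) =
        ∏ i, if i = j then (if m i = 0 then 0 else (Int.gcd (m i) q : ℝ)) else 1 := by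
      intro m; rw [Finset.prod_ite_eq' Finset.univ j]; simp
    rw [Finset.sum_congr rfl fun m _ => e m, hBx,
      ← Finset.prod_univ_sum (fun i => Finset.Ioo (-(K i : ℤ)) (K i))
        (fun i n => if i = j then (if n = 0 then 0 else (Int.gcd n q : ℝ)) else 1)]
    calc _ ≤ ∏ i, (if i = j then (2:ℝ) ^ w else 1) * (2 * K i) := by
          apply Finset.prod_le_prod
          · intro i _
            apply Finset.sum_nonneg; intro n _; positivity
          · intro i _
            split_ifs with hij
            · exact sum_gcd q (K i) hq
            · rw [Finset.sum_const, nsmul_eq_mul, mul_one, one_mul, Int.card_Ioo]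
              have : ((K i : ℤ) - -(K i : ℤ) - 1).toNat ≤ 2 * K i := by omega
              exact_mod_cast this
      _ = _ := by
          rw [Finset.prod_mul_distrib, Finset.prod_ite_eq' Finset.univ j, Finset.prod_mul_distrib]
          simp; ring
  refine (Finset.sum_le_sum h4).trans (le_of_eq ?_)
  simp; ring

/-- Counting integer points in a box lying in the union of the local subgroups. -/
theorem box_count {q : ℕ} [NeZero q] (hq : Squarefree q) (h3 : Nat.Coprime q 3) (Loc : LocSys q)
    (hc : ∀ p P, cubeVec P ∈ Loc p P) (w : PI q → ℕ) (hw : ∀ p P, Nat.card (Loc p P) ≤ w p)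
    (F : Finset (Fin 4 → ℤ)) (B : Fin 4 → ℝ) (hB : ∀ i, 1 ≤ B i)
    (hFB : ∀ f ∈ F, ∀ i, |(f i : ℝ)| ≤ B i)
    (hF : ∀ f ∈ F, ∀ p : PI q, ∃ P, (fun i => (f i : ZMod p.1)) ∈ Loc p P) :
    (F.card : ℝ) ≤ 2 ^ 28 * 6 ^ q.primeFactors.card * (∏ p, (w p : ℝ)) *
      ((∏ i, B i) / q ^ 3 + (∏ i, max (B i) q) / q ^ 4) := by
  have hq0 : (0:ℝ) < q := by exact_mod_cast Nat.pos_of_ne_zero (NeZero.ne q)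
  set ω := q.primeFactors.card with hω
  set K : Fin 4 → ℕ := fun i => max 1 ⌊(q:ℝ) / (8 * B i)⌋₊ with hK
  set M : Fin 4 → ℝ := fun i => 2 * B i / q + 1 with hM
  have hMpos : ∀ i, 0 ≤ M i := fun i => by have := hB i; simp only [hM]; positivity
  have hK1 : ∀ i, 1 ≤ K i := fun i => le_max_left _ _
  have hK1' : ∀ i, (1:ℝ) ≤ K i := fun i => by exact_mod_cast hK1 i
  have hKor : ∀ i, K i = 1 ∨ 8 * (K i) * B i ≤ q := by
    intro i
    rcases le_total ⌊(q:ℝ) / (8 * B i)⌋₊ 1 with h | h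
    · left; simp only [hK]; exact max_eq_left h
    · right
      have e : K i = ⌊(q:ℝ) / (8 * B i)⌋₊ := max_eq_right h
      have hb : 0 < 8 * B i := by linarith [hB i]
      have := Nat.floor_le (a := (q:ℝ) / (8 * B i)) (by positivity)
      rw [← e, le_div_iff₀ hb] at this
      linarith
  have hMK : ∀ i, M i / K i ≤ 32 * B i / q := by
    intro i
    have hb := hB i
    have hk := hK1' i
    rw [div_le_div_iff₀ (by linarith) hq0]
    have e : M i * q = 2 * B i + q := by simp only [hM]; field_simp
    rw [e]
    rcases lt_or_ge (q:ℝ) (8 * B i) with h | h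
    · nlinarith
    · have h5 : (q:ℝ) / (8 * B i) < ⌊(q:ℝ) / (8 * B i)⌋₊ + 1 := Nat.lt_floor_add_one _
      have h6 : ((⌊(q:ℝ) / (8 * B i)⌋₊ : ℕ) : ℝ) ≤ K i := by
        exact_mod_cast (le_max_right 1 _)
      have h7 : (q:ℝ) / (8 * B i) ≤ 2 * K i := by linarith
      rw [div_le_iff₀ (by linarith)] at h7
      nlinarith
  have hM3 : ∀ i, M i ≤ 3 * (max (B i) q / q) := by
    intro i
    have h1 := le_max_left (B i) (q:ℝ)
    have h2 := le_max_right (B i) (q:ℝ)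
    have e : M i = (2 * B i + q) / q := by simp only [hM]; field_simp
    rw [e, ← mul_div_assoc]
    gcongr; linarith
  -- the main inequality
  have main : (F.card : ℝ) * ∏ i, ((K i : ℝ) / 2) ^ 2 ≤
      (∏ i, M i) * ((∏ p, (w p : ℝ)) * ((∏ i, (K i : ℝ)) *
        (3 ^ ω * (q + 64 * 2 ^ ω * ∏ i, (K i : ℝ))))) := by
    set E : (Fin 4 → ℤ) → ℝ := fun f => ‖expSum q K (fun i => (f i : ZMod q))‖ ^ 2 with hE
    have s1 : (F.card : ℝ) * ∏ i, ((K i : ℝ) / 2) ^ 2 ≤ ∑ f ∈ F, E f := by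
      rw [← nsmul_eq_mul, ← Finset.sum_const]
      refine Finset.sum_le_sum fun f hf => ?_
      rw [Finset.prod_pow]
      simp only [hE]
      gcongr
      exact expSum_lower q K B f (hFB f hf) hKor
    have s2 : ∑ f ∈ F, E f ≤ ∑ P : ∀ p : PI q, Option (ZMod p.1),
        ∑ f ∈ F.filter (fun f => (fun i => (f i : ZMod q)) ∈ HP Loc P), E f := by
      simp only [Finset.sum_filter]
      rw [Finset.sum_comm]
      refine Finset.sum_le_sum fun f hf => ?_
      choose P hP using hF f hf
      have hmem : (fun i => (f i : ZMod q)) ∈ HP Loc P := by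
        rw [mem_HP]; intro p; rw [red_int]; exact hP p
      refine le_trans (le_of_eq ?_) (Finset.single_le_sum (f := fun P =>
        if (fun i => (f i : ZMod q)) ∈ HP Loc P then E f else 0) ?_ (Finset.mem_univ P))
      · rw [if_pos hmem]
      · intro P' _; split_ifs
        · positivity
        · exact le_rfl
    have fib : ∀ x : Fin 4 → ZMod q, ((F.filter (fun f => (fun i => (f i : ZMod q)) = x)).card : ℝ) ≤ ∏ i, M i := by
      intro x
      set G := F.filter (fun f => (fun i => (f i : ZMod q)) = x) with hG
      have hsub : G ⊆ Fintype.piFinset (fun i => G.image (fun f => f i)) := by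
        intro f hf
        exact Fintype.mem_piFinset.2 fun i => Finset.mem_image_of_mem _ hf
      have h1 := Finset.card_le_card hsub
      rw [Fintype.card_piFinset] at h1
      calc (G.card : ℝ) ≤ ((∏ i, (G.image (fun f => f i)).card : ℕ) : ℝ) := by exact_mod_cast h1
        _ = ∏ i, ((G.image (fun f => f i)).card : ℝ) := by push_cast; rfl
        _ ≤ ∏ i, M i := by
          apply Finset.prod_le_prod
          · intro i _; positivity
          · intro i _
            apply card_congr_le _ q (Nat.pos_of_ne_zero (NeZero.ne q))
            · linarith [hB i]
            · intro a ha b hb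
              obtain ⟨f, hf, rfl⟩ := Finset.mem_image.1 ha
              obtain ⟨g, hg, rfl⟩ := Finset.mem_image.1 hb
              have hf' := Finset.mem_filter.1 hf
              have hg' := Finset.mem_filter.1 hg
              constructor
              · rw [← ZMod.intCast_eq_intCast_iff_dvd_sub]
                have e1 := congrFun hf'.2 i
                have e2 := congrFun hg'.2 i
                rw [e1, e2]
              · have b1 := abs_le.1 (hFB f hf'.1 i)
                have b2 := abs_le.1 (hFB g hg'.1 i)
                push_cast; linarith
    have s3 : ∀ P : ∀ p : PI q, Option (ZMod p.1),
        ∑ f ∈ F.filter (fun f => (fun i => (f i : ZMod q)) ∈ HP Loc P), E f ≤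
        (∏ i, M i) * ∑ x : HP Loc P, ‖expSum q K x.1‖ ^ 2 := by
      intro P
      have e1 : ∑ x : HP Loc P, ‖expSum q K x.1‖ ^ 2 =
          ∑ x ∈ Finset.univ.filter (fun x => x ∈ HP Loc P), ‖expSum q K x‖ ^ 2 := by
        symm
        apply Finset.sum_subtype
        intro x; simp
      rw [e1, Finset.mul_sum]
      rw [← Finset.sum_fiberwise_of_maps_to (s := F.filter (fun f => (fun i => (f i : ZMod q)) ∈ HP Loc P))
        (t := Finset.univ.filter (fun x => x ∈ HP Loc P)) (g := fun f => (fun i => (f i : ZMod q)))]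
      · refine Finset.sum_le_sum fun x _ => ?_
        have : ∀ f ∈ (F.filter (fun f => (fun i => (f i : ZMod q)) ∈ HP Loc P)).filter
            (fun f => (fun i => (f i : ZMod q)) = x), E f = ‖expSum q K x‖ ^ 2 := by
          intro f hf
          rw [← (Finset.mem_filter.1 hf).2]
        rw [Finset.sum_congr rfl this, Finset.sum_const, nsmul_eq_mul]
        gcongr
        refine le_trans ?_ (fib x)
        gcongr
        exact Finset.filter_subset _ _
      · intro f hf
        exact Finset.mem_filter.2 ⟨Finset.mem_univ _, (Finset.mem_filter.1 hf).2⟩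
    have hMp : 0 ≤ ∏ i, M i := Finset.prod_nonneg fun i _ => hMpos i
    refine s1.trans (s2.trans ((Finset.sum_le_sum fun P _ => s3 P).trans ?_))
    rw [← Finset.mul_sum]
    gcongr
    have s4 : ∀ P : ∀ p : PI q, Option (ZMod p.1), ∑ x : HP Loc P, ‖expSum q K x.1‖ ^ 2 ≤
        (∏ p, (w p : ℝ)) * ((∏ i, (K i : ℝ)) * (annSet q K (HP Loc P)).card) := by
      intro P
      refine (fourier_bound q K (HP Loc P)).trans ?_
      gcongr
      have := card_HP hq Loc P w hw
      exact_mod_cast this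
    refine (Finset.sum_le_sum fun P _ => s4 P).trans ?_
    rw [← Finset.mul_sum, ← Finset.mul_sum]
    gcongr
    exact sum_ann hq h3 Loc hc K
  -- final algebra
  set W := ∏ p, (w p : ℝ) with hW
  have hW0 : 0 ≤ W := Finset.prod_nonneg fun p _ => by positivity
  have hPK : 0 < ∏ i, (K i : ℝ) := Finset.prod_pos fun i _ => by linarith [hK1' i]
  have hPM : 0 ≤ ∏ i, M i := Finset.prod_nonneg fun i _ => hMpos i
  have e1 : ∏ i, ((K i : ℝ) / 2) ^ 2 = (∏ i, (K i : ℝ)) ^ 2 / 256 := by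
    rw [Finset.prod_pow, Finset.prod_div_distrib, div_pow]; simp; norm_num
  rw [e1] at main
  have f1 : (F.card : ℝ) ≤ 256 * W * 3 ^ ω * (q * ((∏ i, M i) / ∏ i, (K i : ℝ)) + 64 * 2 ^ ω * ∏ i, M i) := by
    have : (F.card : ℝ) * ((∏ i, (K i : ℝ)) ^ 2 / 256) ≤
      (256 * W * 3 ^ ω * (q * ((∏ i, M i) / ∏ i, (K i : ℝ)) + 64 * 2 ^ ω * ∏ i, M i)) *
        ((∏ i, (K i : ℝ)) ^ 2 / 256) := by
      refine main.trans (le_of_eq ?_)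
      field_simp
    exact le_of_mul_le_mul_right this (by positivity)
  refine f1.trans ?_
  have g1 : (∏ i, M i) / ∏ i, (K i : ℝ) ≤ 2 ^ 20 * ((∏ i, B i) / q ^ 4) := by
    rw [← Finset.prod_div_distrib]
    calc ∏ i, M i / K i ≤ ∏ i, 32 * B i / q := by
          apply Finset.prod_le_prod
          · intro i _; exact div_nonneg (hMpos i) (by positivity)
          · intro i _; exact hMK i
      _ = _ := by
          rw [Finset.prod_div_distrib, Finset.prod_mul_distrib]; simp; ring
  have g2 : ∏ i, M i ≤ 2 ^ 14 * ((∏ i, max (B i) q) / q ^ 4) := by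
    calc ∏ i, M i ≤ ∏ i, 3 * (max (B i) q / q) := by
          apply Finset.prod_le_prod
          · intro i _; exact hMpos i
          · intro i _; exact hM3 i
      _ = 81 * ((∏ i, max (B i) q) / q ^ 4) := by
          rw [Finset.prod_mul_distrib, Finset.prod_div_distrib]; simp; norm_num
      _ ≤ _ := by
          have : 0 ≤ (∏ i, max (B i) q) / (q:ℝ) ^ 4 := by
            apply div_nonneg _ (by positivity)
            exact Finset.prod_nonneg fun i _ => le_max_of_le_right hq0.le
          nlinarith
  have hB0 : 0 ≤ ∏ i, B i := Finset.prod_nonneg fun i _ => by linarith [hB i]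
  have h2w : (1:ℝ) ≤ 2 ^ ω := one_le_pow₀ (by norm_num)
  calc 256 * W * 3 ^ ω * (q * ((∏ i, M i) / ∏ i, (K i : ℝ)) + 64 * 2 ^ ω * ∏ i, M i)
      ≤ 256 * W * 3 ^ ω * (2 ^ ω * (q * (2 ^ 20 * ((∏ i, B i) / q ^ 4))) + 64 * 2 ^ ω * (2 ^ 14 * ((∏ i, max (B i) q) / q ^ 4))) := by
        have g3 : (q:ℝ) * ((∏ i, M i) / ∏ i, (K i : ℝ)) ≤ 2 ^ ω * (q * (2 ^ 20 * ((∏ i, B i) / q ^ 4))) := by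
         calc (q:ℝ) * ((∏ i, M i) / ∏ i, (K i : ℝ)) ≤ q * (2 ^ 20 * ((∏ i, B i) / q ^ 4)) := by gcongr
          _ ≤ _ := le_mul_of_one_le_left (by positivity) h2w
        have g4 : 64 * 2 ^ ω * ∏ i, M i ≤ 64 * 2 ^ ω * (2 ^ 14 * ((∏ i, max (B i) (q:ℝ)) / q ^ 4)) := by gcongr
        exact mul_le_mul_of_nonneg_left (add_le_add g3 g4) (by positivity)
    _ = _ := by
      rw [show (6:ℝ) = 3 * 2 by norm_num, mul_pow]
      field_simp
      ring

end BCF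

namespace BCF

/-- The vector of coefficients. -/
def vec (f : BCF) : Fin 4 → ℤ := ![f.1, f.2.1, f.2.2.1, f.2.2.2]

lemma vec_inj : Function.Injective vec := by
  intro f g h
  have h0 := congrFun h 0
  have h1 := congrFun h 1
  have h2 := congrFun h 2
  have h3 := congrFun h 3
  simp [vec] at h0 h1 h2 h3
  ext <;> assumption

/-- The hom `(m, n) ↦ L_P² (m u + n v)`. -/
def dblHom {F : Type*} [Field F] (P : Option F) : F × F →+ (Fin 4 → F) where
  toFun z := dblVec P z.1 z.2
  map_zero' := by
    cases P <;> funext i <;> fin_cases i <;> simp [dblVec]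
  map_add' x y := by
    cases P <;> funext i <;> fin_cases i <;> simp [dblVec] <;> ring

/-- The hom `k ↦ k L_P³`. -/
def cubeHom {F : Type*} [Field F] (P : Option F) : F →+ (Fin 4 → F) where
  toFun k := k • cubeVec P
  map_zero' := by simp
  map_add' x y := add_smul _ _ _

/-- Subgroups for the local conditions. -/
def locSub {F : Type*} [Field F] (b : Prop) (P : Option F) : AddSubgroup (Fin 4 → F) :=
  if b then (dblHom P).range else (cubeHom P).range

lemma cubeVec_mem {F : Type*} [Field F] (b : Prop) (P : Option F) : cubeVec P ∈ locSub b P := by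
  unfold locSub
  split_ifs
  · cases P with
    | none =>
      refine ⟨(0, 1), ?_⟩
      funext i; fin_cases i <;> simp [dblHom, dblVec, cubeVec]
    | some x =>
      refine ⟨(1, -x), ?_⟩
      funext i; fin_cases i <;> simp [dblHom, dblVec, cubeVec] <;> ring
  · exact ⟨1, by simp [cubeHom]⟩

lemma card_locSub {F : Type*} [Field F] [Finite F] (b : Prop) (P : Option F) :
    Nat.card (locSub b P) ≤ if b then Nat.card F ^ 2 else Nat.card F := by
  unfold locSub
  split_ifs
  · have := Nat.card_le_card_of_surjective (dblHom P).rangeRestrict (dblHom P).rangeRestrict_surjective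
    rw [Nat.card_prod] at this
    rw [sq]; exact this
  · exact Nat.card_le_card_of_surjective (cubeHom P).rangeRestrict (cubeHom P).rangeRestrict_surjective

lemma exists_cube {F : Type*} [Field F] (h3 : (3:F) ≠ 0) (a b c d : F)
    (hA : b ^ 2 - 3 * a * c = 0) (hB : b * c - 9 * a * d = 0) (hC : c ^ 2 - 3 * b * d = 0) :
    ∃ P, ![a, b, c, d] ∈ locSub (F := F) False P := by
  by_cases ha : a = 0
  · subst ha
    have hb : b = 0 := by simpa using hA
    subst hb
    have hc : c = 0 := by simpa using hC
    subst hc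
    refine ⟨none, ?_⟩
    simp only [locSub, if_false]
    refine ⟨d, ?_⟩
    funext i; fin_cases i <;> simp [cubeHom, cubeVec]
  · refine ⟨some (-b / (3 * a)), ?_⟩
    simp only [locSub, if_false]
    refine ⟨a, ?_⟩
    have e1 : c = b ^ 2 / (3 * a) := by field_simp; linear_combination -hA
    have h9 : (9:F) ≠ 0 := by
      rw [show (9:F) = 3 * 3 by norm_num]; exact mul_ne_zero h3 h3
    have e2 : d = b ^ 3 / (27 * a ^ 2) := by
      rw [show (27:F) = 3 * 9 by norm_num]
      field_simp; linear_combination -3 * a * hB - b * hA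
    funext i; fin_cases i
    · simp [cubeHom, cubeVec]
    · simp [cubeHom, cubeVec]; field_simp
    · simp [cubeHom, cubeVec]; rw [e1]; field_simp
    · simp [cubeHom, cubeVec]; rw [e2, show (27:F) = 3 * 3 * 3 by norm_num]; field_simp

lemma exists_dbl {F : Type*} [Field F] (h2 : (2:F) ≠ 0) (h3 : (3:F) ≠ 0) (a b c d : F)
    (h : b ^ 2 * c ^ 2 - 4 * a * c ^ 3 - 4 * b ^ 3 * d - 27 * a ^ 2 * d ^ 2 + 18 * a * b * c * d = 0) :
    ∃ P, ![a, b, c, d] ∈ locSub (F := F) True P := by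
  by_cases hA : b ^ 2 - 3 * a * c = 0
  · have hB : b * c - 9 * a * d = 0 := by
      have : (b * c - 9 * a * d) ^ 2 = 0 := by
        linear_combination -3 * h + 4 * (c ^ 2 - 3 * b * d) * hA
      exact pow_eq_zero_iff (two_ne_zero) |>.1 this
    by_cases ha : a = 0
    · subst ha
      have hb : b = 0 := by simpa using hA
      subst hb
      refine ⟨none, ?_⟩
      simp only [locSub, if_true]
      refine ⟨(c, d), ?_⟩
      funext i; fin_cases i <;> simp [dblHom, dblVec]
    · have hC : c ^ 2 - 3 * b * d = 0 := by
        have : (3 * a) * (c ^ 2 - 3 * b * d) = 0 := by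
          linear_combination b * hB - c * hA
        rcases mul_eq_zero.1 this with h | h
        · exact absurd h (mul_ne_zero h3 ha)
        · exact h
      obtain ⟨P, hP⟩ := exists_cube h3 a b c d hA hB hC
      refine ⟨P, ?_⟩
      simp only [locSub, if_false] at hP
      obtain ⟨k, hk⟩ := hP
      rw [← hk]
      have := cubeVec_mem True P
      simp only [locSub, if_true] at this ⊢
      obtain ⟨z, hz⟩ := this
      refine ⟨(k * z.1, k * z.2), ?_⟩
      show _ = k • cubeVec P
      rw [← hz]
      cases P <;> funext i <;> fin_cases i <;> simp [dblHom, dblVec] <;> ring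
  · obtain ⟨x, hx⟩ : ∃ x, 2 * (b ^ 2 - 3 * a * c) * x = -(b * c - 9 * a * d) :=
      ⟨-(b * c - 9 * a * d) / (2 * (b ^ 2 - 3 * a * c)), by field_simp⟩
    have hne : (2 * (b ^ 2 - 3 * a * c)) ≠ 0 := mul_ne_zero h2 hA
    have ec : 3 * a * x ^ 2 + 2 * b * x + c = 0 := by
      have : (2 * (b ^ 2 - 3 * a * c)) ^ 2 * (3 * a * x ^ 2 + 2 * b * x + c) = 0 := by
        set Y := 2 * (b ^ 2 - 3 * a * c) * x with hY
        have e : (2 * (b ^ 2 - 3 * a * c)) ^ 2 * (3 * a * x ^ 2 + 2 * b * x + c) =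
          3 * a * Y ^ 2 + 2 * b * (2 * (b ^ 2 - 3 * a * c)) * Y + (2 * (b ^ 2 - 3 * a * c)) ^ 2 * c := by
          rw [hY]; ring
        rw [e, hx]
        linear_combination -9 * a * h
      exact (mul_eq_zero.1 this).resolve_left (pow_ne_zero 2 hne)
    have ed : d = 2 * a * x ^ 3 + b * x ^ 2 := by
      have : (2 * (b ^ 2 - 3 * a * c)) ^ 3 * (d - (2 * a * x ^ 3 + b * x ^ 2)) = 0 := by
        set Y := 2 * (b ^ 2 - 3 * a * c) * x with hY
        have e : (2 * (b ^ 2 - 3 * a * c)) ^ 3 * (d - (2 * a * x ^ 3 + b * x ^ 2)) =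
          (2 * (b ^ 2 - 3 * a * c)) ^ 3 * d - 2 * a * Y ^ 3 - b * (2 * (b ^ 2 - 3 * a * c)) * Y ^ 2 := by
          rw [hY]; ring
        rw [e, hx]
        linear_combination (54 * a ^ 2 * d - 2 * b ^ 3) * h
      have := (mul_eq_zero.1 this).resolve_left (pow_ne_zero 3 hne)
      linear_combination this
    refine ⟨some x, ?_⟩
    simp only [locSub, if_true]
    refine ⟨(a, b + 2 * x * a), ?_⟩
    funext i; fin_cases i <;> simp [dblHom, dblVec]
    · linear_combination -ec
    · rw [ed]; ring

end BCF

namespace BCF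

lemma prod_w (r s : ℕ) (hr : Squarefree r) (hq : Squarefree (r * s)) :
    ∏ p : PI (r * s), (((if p.1 ∣ r then p.1 ^ 2 else p.1 : ℕ)) : ℝ) ≤ (r:ℝ) ^ 2 * s := by
  have h1 : ∏ p : PI (r * s), (if p.1 ∣ r then p.1 ^ 2 else p.1 : ℕ) =
      ∏ p ∈ (r * s).primeFactors, (if p ∣ r then p ^ 2 else p : ℕ) :=
    Finset.prod_coe_sort _ (fun p => (if p ∣ r then p ^ 2 else p : ℕ))
  have h2 : ∏ p ∈ (r * s).primeFactors, (if p ∣ r then p ^ 2 else p : ℕ) =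
      (∏ p ∈ (r * s).primeFactors, p) * ∏ p ∈ (r * s).primeFactors.filter (fun p => p ∣ r), p := by
    rw [Finset.prod_filter, ← Finset.prod_mul_distrib]
    refine Finset.prod_congr rfl fun p _ => ?_
    split_ifs <;> ring
  have h3 : ∏ p ∈ (r * s).primeFactors.filter (fun p => p ∣ r), p ≤ r := by
    apply Nat.le_of_dvd (Nat.pos_of_ne_zero hr.ne_zero)
    apply Finset.prod_primes_dvd
    · intro p hp; exact (Nat.prime_of_mem_primeFactors (Finset.mem_filter.1 hp).1).prime
    · intro p hp; exact (Finset.mem_filter.1 hp).2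
  rw [Nat.prod_primeFactors_of_squarefree hq] at h2
  have h4 : ∏ p : PI (r * s), (if p.1 ∣ r then p.1 ^ 2 else p.1 : ℕ) ≤ r ^ 2 * s := by
    rw [h1, h2]
    calc r * s * _ ≤ r * s * r := by gcongr
      _ = _ := by ring
  exact_mod_cast h4

theorem form_count (r s : ℕ) (hr : Squarefree r) (hs : Squarefree s) (hrs : Nat.Coprime r s)
    (h6 : Nat.Coprime (r * s) 6) (F : Finset BCF) (B : Fin 4 → ℝ) (hB : ∀ i, 1 ≤ B i)
    (hFB : ∀ f ∈ F, ∀ i, |(vec f i : ℝ)| ≤ B i)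
    (hF : ∀ f ∈ F, (r:ℤ) ∣ disc f ∧ HDvd s f) :
    (F.card : ℝ) ≤ 2 ^ 28 * 6 ^ (r * s).primeFactors.card *
      (((∏ i, B i) + (∏ i, max (B i) (r * s : ℕ)) / (r * s : ℕ)) / ((r:ℝ) * s ^ 2)) := by
  have hq : Squarefree (r * s) := (Nat.squarefree_mul hrs).2 ⟨hr, hs⟩
  have hq0 := hq.ne_zero
  have : NeZero (r * s) := ⟨hq0⟩
  have hp6 : ∀ p : PI (r * s), ∀ n : ℕ, n ∣ 6 → n ≠ 1 → n.Prime → ((n : ℕ) : ZMod p.1) ≠ 0 := by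
    intro p n hn hn1 hnp h0
    have hp : p.1.Prime := Fact.out
    have h1 : p.1 ∣ n := (ZMod.natCast_eq_zero_iff n p.1).1 h0
    have := Nat.dvd_gcd p.dvd (h1.trans hn)
    rw [h6] at this
    exact hp.one_lt.ne' (Nat.dvd_one.1 this)
  have key := box_count hq (Nat.Coprime.coprime_dvd_right (by norm_num) h6)
    (fun p P => locSub (p.1 ∣ r) P) (fun p P => cubeVec_mem _ P)
    (fun p => if p.1 ∣ r then p.1 ^ 2 else p.1)
    (fun p P => by
      have := card_locSub (p.1 ∣ r) P
      rw [Nat.card_zmod] at this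
      convert this)
    (F.image vec) B hB
    (by
      intro f hf
      obtain ⟨g, hg, rfl⟩ := Finset.mem_image.1 hf
      exact hFB g hg)
    (by
      intro f hf p
      obtain ⟨g, hg, rfl⟩ := Finset.mem_image.1 hf
      have e : (fun i => (vec g i : ZMod p.1)) = ![(g.1 : ZMod p.1), (g.2.1 : ZMod p.1), (g.2.2.1 : ZMod p.1), (g.2.2.2 : ZMod p.1)] := by
        funext i; fin_cases i <;> simp [vec]
      simp only [e]
      have h2 : (2 : ZMod p.1) ≠ 0 := by exact_mod_cast hp6 p 2 (by norm_num) (by norm_num) (by norm_num)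
      have h3 : (3 : ZMod p.1) ≠ 0 := by exact_mod_cast hp6 p 3 (by norm_num) (by norm_num) (by norm_num)
      obtain ⟨hd, hA', hB', hC'⟩ := hF g hg
      by_cases hpr : p.1 ∣ r
      · simp only [hpr]
        apply exists_dbl h2 h3
        have : ((p.1 : ℕ) : ℤ) ∣ disc g := dvd_trans (by exact_mod_cast hpr) hd
        rw [← ZMod.intCast_zmod_eq_zero_iff_dvd] at this
        simpa [disc] using this
      · have hps : ((p.1 : ℕ) : ℤ) ∣ s := by
          have hp : p.1.Prime := Fact.out
          exact_mod_cast ((Nat.Prime.dvd_mul hp).1 p.dvd).resolve_left hpr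
        simp only [hpr]
        have e1 := hps.trans hA'
        have e2 := hps.trans hB'
        have e3 := hps.trans hC'
        rw [← ZMod.intCast_zmod_eq_zero_iff_dvd] at e1 e2 e3
        apply exists_cube h3
        · simpa [hA] using e1
        · simpa [BCF.hB] using e2
        · simpa [hC] using e3)
  rw [Finset.card_image_of_injective _ vec_inj] at key
  have hr0 : (0:ℝ) < r := by exact_mod_cast Nat.pos_of_ne_zero hr.ne_zero
  have hs0 : (0:ℝ) < s := by exact_mod_cast Nat.pos_of_ne_zero hs.ne_zero
  have hB0 : 0 ≤ ∏ i, B i := Finset.prod_nonneg fun i _ => by linarith [hB i]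
  have hB1 : 0 ≤ ∏ i, max (B i) ((r * s : ℕ):ℝ) :=
    Finset.prod_nonneg fun i _ => le_max_of_le_right (by positivity)
  have hW := prod_w r s hr hq
  refine key.trans ?_
  calc _ ≤ 2 ^ 28 * 6 ^ (r * s).primeFactors.card * ((r:ℝ) ^ 2 * s) *
      ((∏ i, B i) / (r * s : ℕ) ^ 3 + (∏ i, max (B i) (r * s : ℕ)) / (r * s : ℕ) ^ 4) := by
        gcongr
    _ = _ := by push_cast; field_simp

end BCF

namespace BCF

/-- The shear `u ↦ u + k v`. -/
def shear (k : ℤ) (f : BCF) : BCF :=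
  (f.1, f.2.1 + 3 * f.1 * k, f.2.2.1 + 2 * f.2.1 * k + 3 * f.1 * k ^ 2,
    f.2.2.2 + f.2.2.1 * k + f.2.1 * k ^ 2 + f.1 * k ^ 3)

lemma shear_GLeq (k : ℤ) (f : BCF) : GLeq f (shear k f) := by
  refine ⟨!![1, 0; k, 1], by simp [Matrix.det_fin_two], ?_⟩
  simp only [act, shear, Matrix.det_fin_two]
  simp
  refine ⟨by ring, by ring, by ring⟩

lemma sum_two_pow (J : ℕ) : ∑ j ∈ Finset.range (J + 1), (2:ℝ) ^ j ≤ 2 * 2 ^ J := by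
  induction J with
  | zero => simp
  | succ n ih => rw [Finset.sum_range_succ]; rw [pow_succ]; linarith

lemma sum_four_pow (J : ℕ) : ∑ j ∈ Finset.range (J + 1), ((2:ℝ) ^ j) ^ 2 ≤ 2 * (2 ^ J) ^ 2 := by
  induction J with
  | zero => simp
  | succ n ih =>
    rw [Finset.sum_range_succ]
    have : ((2:ℝ) ^ (n+1)) ^ 2 = 4 * (2 ^ n) ^ 2 := by rw [pow_succ]; ring
    rw [this]
    have : 0 < ((2:ℝ) ^ n) ^ 2 := by positivity
    linarith

lemma sum_inv_four (J : ℕ) : ∑ j ∈ Finset.range (J + 1), 1 / ((2:ℝ) ^ j) ^ 2 ≤ 2 := by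
  have h : ∑ j ∈ Finset.range (J + 1), 1 / ((2:ℝ) ^ j) ^ 2 ≤ 2 - 1 / (2 ^ J) ^ 2 := by
    induction J with
    | zero => simp; norm_num
    | succ n ih =>
      rw [Finset.sum_range_succ]
      have : 1 / ((2:ℝ) ^ (n+1)) ^ 2 = (1 / (2 ^ n) ^ 2) / 4 := by field_simp; ring
      rw [this]
      have : 0 < 1 / ((2:ℝ) ^ n) ^ 2 := by positivity
      linarith
  have : 0 < 1 / ((2:ℝ) ^ J) ^ 2 := by positivity
  linarith

lemma prod_max_le (B0 B1 B2 B3 q : ℝ) (h0 : 0 ≤ B0) (h1 : B0 ≤ B1) (h2 : B1 ≤ B2) (h3 : B2 ≤ B3)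
    (hq : 0 ≤ q) : max B0 q * max B1 q * max B2 q * max B3 q ≤
      q ^ 4 + q ^ 3 * B3 + q ^ 2 * (B2 * B3) + q * (B1 * B2 * B3) + B0 * B1 * B2 * B3 := by
  have n1 : 0 ≤ B1 := h0.trans h1
  have n2 : 0 ≤ B2 := n1.trans h2
  have n3 : 0 ≤ B3 := n2.trans h3
  have p0 : 0 ≤ q ^ 4 := by positivity
  have p1 : 0 ≤ q ^ 3 * B3 := by positivity
  have p2 : 0 ≤ q ^ 2 * (B2 * B3) := by positivity
  have p3 : 0 ≤ q * (B1 * B2 * B3) := by positivity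
  have p4 : 0 ≤ B0 * B1 * B2 * B3 := by positivity
  rcases le_total q B0 with c0 | c0
  · rw [max_eq_left c0, max_eq_left (c0.trans h1), max_eq_left (c0.trans (h1.trans h2)),
      max_eq_left (c0.trans (h1.trans (h2.trans h3)))]
    linarith
  rw [max_eq_right c0]
  rcases le_total q B1 with c1 | c1
  · rw [max_eq_left c1, max_eq_left (c1.trans h2), max_eq_left (c1.trans (h2.trans h3))]
    linarith
  rw [max_eq_right c1]
  rcases le_total q B2 with c2 | c2
  · rw [max_eq_left c2, max_eq_left (c2.trans h3)]
    linarith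
  rw [max_eq_right c2]
  rcases le_total q B3 with c3 | c3
  · rw [max_eq_left c3]; linarith
  rw [max_eq_right c3]; linarith

/-- one dyadic range -/
lemma count_dyadic (r s : ℕ) (hr : Squarefree r) (hs : Squarefree s) (hrs : Nat.Coprime r s)
    (h6 : Nat.Coprime (r * s) 6) (l : ℝ) (j : ℕ) (hl : ((2:ℝ) ^ j) ^ 3 ≤ l) (G : Finset BCF)
    (hG : ∀ f ∈ G, f.1 ≠ 0 ∧ (r:ℤ) ∣ disc f ∧ HDvd s f ∧ ∃ t : ℝ, (2:ℝ) ^ j ≤ t ∧ t ≤ 2 * 2 ^ j ∧ InBox l t f)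
    (hine : ∀ f ∈ G, ∀ g ∈ G, f ≠ g → ¬ GLeq f g) :
    (G.card : ℝ) ≤ 2 ^ 28 * 6 ^ (r * s).primeFactors.card / ((r:ℝ) * s ^ 2) *
      ((2 * (12 * l) ^ 4 + ((r * s : ℕ) : ℝ) ^ 3) * (1 / (2 ^ j) ^ 2) +
        (((r * s : ℕ) : ℝ) ^ 2 * (12 * l) + (12 * l) ^ 3) * 2 ^ j +
        ((r * s : ℕ) : ℝ) * (12 * l) ^ 2 * (2 ^ j) ^ 2) := by
  set T : ℝ := 2 ^ j with hT
  have hT1 : 1 ≤ T := one_le_pow₀ (by norm_num)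
  have hT0 : 0 < T := by linarith
  have hl1 : 1 ≤ l := (one_le_pow₀ hT1).trans hl
  set L : ℝ := 12 * l with hL
  have hr0 : (0:ℝ) < r := by exact_mod_cast Nat.pos_of_ne_zero hr.ne_zero
  have hs0 : (0:ℝ) < s := by exact_mod_cast Nat.pos_of_ne_zero hs.ne_zero
  set q : ℝ := ((r * s : ℕ) : ℝ) with hq
  have hq1 : 1 ≤ q := by
    rw [hq]; exact_mod_cast Nat.pos_of_ne_zero (Nat.mul_ne_zero hr.ne_zero hs.ne_zero)
  set B : Fin 4 → ℝ := ![L / T ^ 3, L / T, L * T, L * T ^ 3] with hB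
  set F : Finset BCF := (G ×ˢ Finset.range (4 ^ j)).image (fun x => shear (x.2:ℤ) x.1) with hF
  have hcard : F.card = G.card * 4 ^ j := by
    rw [hF, Finset.card_image_of_injOn, Finset.card_product, Finset.card_range]
    rintro ⟨f, k⟩ hf ⟨g, k'⟩ hg h
    have hf' := (Finset.mem_product.1 (Finset.mem_coe.1 hf)).1
    have hg' := (Finset.mem_product.1 (Finset.mem_coe.1 hg)).1
    simp only at h hf' hg'
    have e : f = g := by
      by_contra hne
      apply hine f hf' g hg' hne
      exact (shear_GLeq k f).trans (h ▸ (shear_GLeq k' g).symm)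
    subst e
    have h2 : f.2.1 + 3 * f.1 * (k:ℤ) = f.2.1 + 3 * f.1 * (k':ℤ) := congrArg (fun z : BCF => z.2.1) h
    have h3 : (3 * f.1) * (k:ℤ) = (3 * f.1) * (k':ℤ) := by linarith
    have h4 := mul_left_cancel₀ (mul_ne_zero (by norm_num) (hG f hf').1) h3
    have : k = k' := by exact_mod_cast h4
    rw [this]
  have hT3 : 1 ≤ L / T ^ 3 := by rw [le_div_iff₀ (by positivity)]; linarith
  have hb01 : L / T ^ 3 ≤ L / T := by
    gcongr; exact le_self_pow₀ hT1 (by norm_num)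
  have hb12 : L / T ≤ L * T := by
    rw [div_le_iff₀ hT0]
    have : 1 ≤ T * T := by nlinarith
    nlinarith
  have hb23 : L * T ≤ L * T ^ 3 := by
    gcongr; exact le_self_pow₀ hT1 (by norm_num)
  have key := form_count r s hr hs hrs h6 F B
    (by
      intro i
      fin_cases i <;> simp [hB] <;> linarith)
    (by
      intro f hf
      obtain ⟨⟨g, k⟩, hgk, rfl⟩ := Finset.mem_image.1 hf
      obtain ⟨hg, hk⟩ := Finset.mem_product.1 hgk
      have hk' : (k:ℝ) ≤ T ^ 2 := by
        have := (Finset.mem_range.1 hk).le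
        have h4 : ((4 ^ j : ℕ) : ℝ) = T ^ 2 := by
          rw [hT]; push_cast; rw [← pow_mul, mul_comm, pow_mul]; norm_num
        rw [← h4]; exact_mod_cast this
      simp only at hg
      obtain ⟨_, _, _, t, ht1, ht2, i1, i2, i3, i4⟩ := hG g hg
      have hk0 : (0:ℝ) ≤ k := Nat.cast_nonneg k
      have ht0 : 0 ≤ t := hT0.le.trans ht1
      have ha : |(g.1:ℝ)| ≤ l / T ^ 3 := by
        rw [le_div_iff₀ (by positivity)]
        refine le_trans ?_ i1; gcongr
      have hb : |(g.2.1:ℝ)| ≤ l / T := by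
        rw [le_div_iff₀ (by positivity)]
        refine le_trans ?_ i2; gcongr
      have hc : |(g.2.2.1:ℝ)| ≤ 2 * l * T := by
        refine i3.trans ?_
        calc l * t ≤ l * (2 * T) := by gcongr
          _ = _ := by ring
      have hd : |(g.2.2.2:ℝ)| ≤ 8 * l * T ^ 3 := by
        refine i4.trans ?_
        calc l * t ^ 3 ≤ l * (2 * T) ^ 3 := by gcongr
          _ = _ := by ring
      have tri : ∀ x y : ℝ, |x + y| ≤ |x| + |y| := abs_add_le
      have ak1 : |(g.1:ℝ)| * k ≤ l / T := by
        calc |(g.1:ℝ)| * k ≤ l / T ^ 3 * T ^ 2 := by gcongr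
          _ = l / T := by field_simp
      have ak2 : |(g.1:ℝ)| * k ^ 2 ≤ l * T := by
        calc |(g.1:ℝ)| * k ^ 2 ≤ l / T ^ 3 * (T ^ 2) ^ 2 := by gcongr
          _ = l * T := by field_simp
      have ak3 : |(g.1:ℝ)| * k ^ 3 ≤ l * T ^ 3 := by
        calc |(g.1:ℝ)| * k ^ 3 ≤ l / T ^ 3 * (T ^ 2) ^ 3 := by gcongr
          _ = l * T ^ 3 := by field_simp
      have bk1 : |(g.2.1:ℝ)| * k ≤ l * T := by
        calc |(g.2.1:ℝ)| * k ≤ l / T * T ^ 2 := by gcongr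
          _ = l * T := by field_simp
      have bk2 : |(g.2.1:ℝ)| * k ^ 2 ≤ l * T ^ 3 := by
        calc |(g.2.1:ℝ)| * k ^ 2 ≤ l / T * (T ^ 2) ^ 2 := by gcongr
          _ = l * T ^ 3 := by field_simp
      have ck1 : |(g.2.2.1:ℝ)| * k ≤ 2 * l * T ^ 3 := by
        calc |(g.2.2.1:ℝ)| * k ≤ 2 * l * T * T ^ 2 := by gcongr
          _ = 2 * l * T ^ 3 := by ring
      have hlT : 0 ≤ l / T := by positivity
      have hlT' : 0 ≤ l * T := by positivity
      have hlT3 : 0 ≤ l * T ^ 3 := by positivity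
      have hlT4 : 0 ≤ l / T ^ 3 := by positivity
      have n1 : |(k:ℝ)| = k := abs_of_nonneg hk0
      intro i
      fin_cases i
      · simp [hB, vec, shear]
        calc |(g.1:ℝ)| ≤ l / T ^ 3 := ha
          _ ≤ L / T ^ 3 := by gcongr; linarith
      · simp [hB, vec, shear]
        have e1 : |3 * (g.1:ℝ) * k| = 3 * (|(g.1:ℝ)| * k) := by
          rw [abs_mul, abs_mul, n1]; norm_num; ring
        have := tri (g.2.1:ℝ) (3 * g.1 * k)
        rw [e1] at this
        have e2 : L / T = 12 * (l / T) := by rw [hL]; ring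
        linarith
      · simp [hB, vec, shear]
        have e1 : |3 * (g.1:ℝ) * k ^ 2| = 3 * (|(g.1:ℝ)| * k ^ 2) := by
          rw [abs_mul, abs_mul, abs_pow, n1]; norm_num; ring
        have e2 : |2 * (g.2.1:ℝ) * k| = 2 * (|(g.2.1:ℝ)| * k) := by
          rw [abs_mul, abs_mul, n1]; norm_num; ring
        have t1 := tri ((g.2.2.1:ℝ) + 2 * g.2.1 * k) (3 * g.1 * k ^ 2)
        have t2 := tri (g.2.2.1:ℝ) (2 * g.2.1 * k)
        rw [e1] at t1; rw [e2] at t2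
        have e3 : L * T = 12 * (l * T) := by rw [hL]; ring
        linarith
      · simp [hB, vec, shear]
        have e1 : |(g.1:ℝ) * k ^ 3| = (|(g.1:ℝ)| * k ^ 3) := by
          rw [abs_mul, abs_pow, n1]
        have e2 : |(g.2.1:ℝ) * k ^ 2| = (|(g.2.1:ℝ)| * k ^ 2) := by
          rw [abs_mul, abs_pow, n1]
        have e4 : |(g.2.2.1:ℝ) * k| = (|(g.2.2.1:ℝ)| * k) := by
          rw [abs_mul, n1]
        have t1 := tri ((g.2.2.2:ℝ) + g.2.2.1 * k + g.2.1 * k ^ 2) (g.1 * k ^ 3)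
        have t2 := tri ((g.2.2.2:ℝ) + g.2.2.1 * k) (g.2.1 * k ^ 2)
        have t3 := tri (g.2.2.2:ℝ) (g.2.2.1 * k)
        rw [e1] at t1; rw [e2] at t2; rw [e4] at t3
        have e3 : L * T ^ 3 = 12 * (l * T ^ 3) := by rw [hL]; ring
        linarith)
    (by
      intro f hf
      obtain ⟨⟨g, k⟩, hgk, rfl⟩ := Finset.mem_image.1 hf
      obtain ⟨hg, hk⟩ := Finset.mem_product.1 hgk
      simp only at hg
      obtain ⟨_, h1, h2, _⟩ := hG g hg
      have hgl := shear_GLeq k g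
      exact ⟨by rw [hgl.disc_eq]; exact h1, hgl.hdvd h2⟩)
  rw [hcard] at key
  have e4 : ((G.card * 4 ^ j : ℕ) : ℝ) = G.card * T ^ 2 := by
    rw [hT]; push_cast; rw [← pow_mul, mul_comm j, pow_mul]; norm_num
  rw [e4, Fin.prod_univ_four, Fin.prod_univ_four] at key
  simp only [hB, Matrix.cons_val_zero, Matrix.cons_val_one, Matrix.cons_val] at key
  have hpm := prod_max_le (L / T ^ 3) (L / T) (L * T) (L * T ^ 3) q (by linarith) hb01 hb12 hb23 (by linarith)
  have hL0 : 0 < L := by linarith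
  have k2 : max (L / T ^ 3) q * max (L / T) q * max (L * T) q * max (L * T ^ 3) q / q ≤
      q ^ 3 + q ^ 2 * L * T ^ 3 + q * L ^ 2 * T ^ 4 + L ^ 3 * T ^ 3 + L ^ 4 := by
    rw [div_le_iff₀ (by linarith)]
    refine hpm.trans ?_
    have e : L / T ^ 3 * (L / T) * (L * T) * (L * T ^ 3) = L ^ 4 := by field_simp
    have e' : L / T * (L * T) * (L * T ^ 3) = L ^ 3 * T ^ 3 := by field_simp
    rw [e, e']
    have : L ^ 4 ≤ L ^ 4 * q := le_mul_of_one_le_right (by positivity) hq1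
    nlinarith
  have e5 : L / T ^ 3 * (L / T) * (L * T) * (L * T ^ 3) = L ^ 4 := by field_simp
  rw [e5] at key
  set κ : ℝ := 2 ^ 28 * 6 ^ (r * s).primeFactors.card with hκ
  have hκ0 : 0 < κ := by positivity
  have k3 : (G.card : ℝ) * T ^ 2 ≤ κ * ((L ^ 4 + (q ^ 3 + q ^ 2 * L * T ^ 3 + q * L ^ 2 * T ^ 4 + L ^ 3 * T ^ 3 + L ^ 4)) / ((r:ℝ) * s ^ 2)) := by
    refine key.trans ?_
    gcongr
  have k4 : (G.card : ℝ) ≤ κ * ((L ^ 4 + (q ^ 3 + q ^ 2 * L * T ^ 3 + q * L ^ 2 * T ^ 4 + L ^ 3 * T ^ 3 + L ^ 4)) / ((r:ℝ) * s ^ 2)) / T ^ 2 := by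
    rwa [le_div_iff₀ (by positivity)]
  refine k4.trans (le_of_eq ?_)
  field_simp
  ring

end BCF

namespace BCF

lemma count_ne (r s : ℕ) (hr : Squarefree r) (hs : Squarefree s) (hrs : Nat.Coprime r s)
    (h6 : Nat.Coprime (r * s) 6) (l : ℝ) (G : Finset BCF)
    (hG : ∀ f ∈ G, f.1 ≠ 0 ∧ (r:ℤ) ∣ disc f ∧ HDvd s f ∧ ∃ t : ℝ, 1 ≤ t ∧ InBox l t f)
    (hine : ∀ f ∈ G, ∀ g ∈ G, f ≠ g → ¬ GLeq f g) :
    (G.card : ℝ) ≤ 2 ^ 46 * 6 ^ (r * s).primeFactors.card *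
      (l ^ 4 / ((r:ℝ) * s ^ 2) + ((r * s : ℕ) : ℝ) ^ 2) := by
  have hr0 : (0:ℝ) < r := by exact_mod_cast Nat.pos_of_ne_zero hr.ne_zero
  have hs0 : (0:ℝ) < s := by exact_mod_cast Nat.pos_of_ne_zero hs.ne_zero
  have hr1 : (1:ℝ) ≤ r := by exact_mod_cast Nat.pos_of_ne_zero hr.ne_zero
  have hs1 : (1:ℝ) ≤ s := by exact_mod_cast Nat.pos_of_ne_zero hs.ne_zero
  rcases G.eq_empty_or_nonempty with rfl | hne
  · simp; positivity
  have hj : ∀ f ∈ G, ∃ j : ℕ, ((2:ℝ) ^ j) ^ 3 ≤ l ∧ ∃ t : ℝ, (2:ℝ) ^ j ≤ t ∧ t ≤ 2 * 2 ^ j ∧ InBox l t f := by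
    intro f hf
    obtain ⟨h1, h2, h3, t, ht, hbox⟩ := hG f hf
    obtain ⟨j, hj1, hj2⟩ := exists_nat_pow_near ht (by norm_num : (1:ℝ) < 2)
    refine ⟨j, ?_, t, hj1, ?_, hbox⟩
    · refine le_trans ?_ hbox.1
      have : (1:ℝ) ≤ |(f.1:ℝ)| := by
        have := Int.one_le_abs h1
        exact_mod_cast this
      calc ((2:ℝ) ^ j) ^ 3 ≤ t ^ 3 := by gcongr
        _ ≤ _ := le_mul_of_one_le_left (by positivity) this
    · rw [pow_succ] at hj2; linarith
  have hj' : ∀ f : BCF, ∃ j : ℕ, f ∈ G → (((2:ℝ) ^ j) ^ 3 ≤ l ∧ ∃ t : ℝ, (2:ℝ) ^ j ≤ t ∧ t ≤ 2 * 2 ^ j ∧ InBox l t f) := by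
    intro f
    by_cases hf : f ∈ G
    · obtain ⟨j, h⟩ := hj f hf; exact ⟨j, fun _ => h⟩
    · exact ⟨0, fun h => absurd h hf⟩
  choose J hJ using hj'
  obtain ⟨f0, hf0, hmax⟩ := Finset.exists_max_image G J hne
  set N := J f0 with hN
  set M : ℝ := 2 ^ N with hM
  set L : ℝ := 12 * l with hL
  set q : ℝ := ((r * s : ℕ) : ℝ) with hq
  set κ : ℝ := 2 ^ 28 * 6 ^ (r * s).primeFactors.card / ((r:ℝ) * s ^ 2) with hκ
  have hM1 : 1 ≤ M := one_le_pow₀ (by norm_num)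
  have hMl : M ^ 3 ≤ l := (hJ f0 hf0).1
  have hl1 : 1 ≤ l := (one_le_pow₀ hM1).trans hMl
  have hML : M ^ 3 ≤ L := by linarith
  have hL1 : 1 ≤ L := by linarith
  have hq0 : 0 < q := by rw [hq]; push_cast; positivity
  have hκ0 : 0 < κ := by positivity
  have hsum : (G.card : ℝ) ≤ ∑ j ∈ Finset.range (N + 1), κ * ((2 * L ^ 4 + q ^ 3) * (1 / (2 ^ j) ^ 2) +
        (q ^ 2 * L + L ^ 3) * 2 ^ j + q * L ^ 2 * (2 ^ j) ^ 2) := by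
    rw [Finset.card_eq_sum_card_fiberwise (f := J) (t := Finset.range (N + 1))]
    · push_cast
      refine Finset.sum_le_sum fun j _ => ?_
      set Gj := G.filter (fun f => J f = j) with hGj
      rcases Gj.eq_empty_or_nonempty with he | ⟨g, hg⟩
      · rw [he]; simp only [Finset.card_empty, Nat.cast_zero]; positivity
      · have hg' := Finset.mem_filter.1 hg
        apply count_dyadic r s hr hs hrs h6 l j
        · rw [← hg'.2]; exact (hJ g hg'.1).1
        · intro f hf
          have hf' := Finset.mem_filter.1 hf
          obtain ⟨a1, a2, a3, _⟩ := hG f hf'.1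
          refine ⟨a1, a2, a3, ?_⟩
          rw [← hf'.2]; exact (hJ f hf'.1).2
        · intro f hf g hg
          exact hine f (Finset.mem_filter.1 hf).1 g (Finset.mem_filter.1 hg).1
    · intro f hf
      have := hmax f hf
      simp only [Finset.coe_range, Set.mem_Iio]; omega
  rw [← Finset.mul_sum, Finset.sum_add_distrib, Finset.sum_add_distrib, ← Finset.mul_sum,
    ← Finset.mul_sum, ← Finset.mul_sum] at hsum
  have b1 := sum_inv_four N
  have b2 := sum_two_pow N
  have b3 := sum_four_pow N
  rw [← hM] at b2 b3
  have hz3 : (L * M) ^ 3 ≤ L ^ 4 := by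
    calc (L * M) ^ 3 = L ^ 3 * M ^ 3 := by ring
      _ ≤ L ^ 3 * L := by gcongr
      _ = _ := by ring
  have hz0 : 0 < L * M := by positivity
  have am1 : ∀ x y : ℝ, 0 < x → 0 < y → x ^ 2 * y ≤ x ^ 3 + y ^ 3 := by
    intro x y hx hy
    rcases le_total x y with h | h
    · have : x ^ 2 * y ≤ y ^ 2 * y := by gcongr
      have : 0 < x ^ 3 := by positivity
      nlinarith
    · have : x ^ 2 * y ≤ x ^ 2 * x := by gcongr
      have : 0 < y ^ 3 := by positivity
      nlinarith
  have c1 := am1 q (L * M) hq0 hz0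
  have c2 := am1 (L * M) q hz0 hq0
  have hM_le : M ≤ L := (le_self_pow₀ hM1 (by norm_num)).trans hML
  have c3 : L ^ 3 * M ≤ L ^ 4 := by
    calc L ^ 3 * M ≤ L ^ 3 * L := by gcongr
      _ = _ := by ring
  have tot : (G.card : ℝ) ≤ κ * (10 * L ^ 4 + 6 * q ^ 3) := by
    refine hsum.trans ?_
    refine mul_le_mul_of_nonneg_left ?_ hκ0.le
    have d1 := mul_le_mul_of_nonneg_left b1 (show 0 ≤ 2 * L ^ 4 + q ^ 3 by positivity)
    have d2 := mul_le_mul_of_nonneg_left b2 (show 0 ≤ q ^ 2 * L + L ^ 3 by positivity)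
    have d3 := mul_le_mul_of_nonneg_left b3 (show 0 ≤ q * L ^ 2 by positivity)
    calc _ ≤ (2 * L ^ 4 + q ^ 3) * 2 + (q ^ 2 * L + L ^ 3) * (2 * M) + q * L ^ 2 * (2 * M ^ 2) := by
          linarith
      _ = 4 * L ^ 4 + 2 * q ^ 3 + 2 * (q ^ 2 * (L * M)) + 2 * (L ^ 3 * M) + 2 * ((L * M) ^ 2 * q) := by ring
      _ ≤ _ := by linarith
  refine tot.trans ?_
  have e1 : κ * (10 * L ^ 4 + 6 * q ^ 3) = 2 ^ 28 * 6 ^ (r * s).primeFactors.card *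
      (207360 * (l ^ 4 / ((r:ℝ) * s ^ 2)) + 6 * ((r:ℝ) ^ 2 * s)) := by
    rw [hκ, hL, hq]; push_cast; field_simp; ring
  have e2 : (r:ℝ) ^ 2 * s ≤ q ^ 2 := by
    rw [hq]; push_cast; rw [mul_pow]
    gcongr
    exact le_self_pow₀ hs1 (by norm_num)
  rw [e1]
  have e3 : 0 ≤ l ^ 4 / ((r:ℝ) * s ^ 2) := by positivity
  calc _ ≤ 2 ^ 28 * 6 ^ (r * s).primeFactors.card * (2 ^ 18 * (l ^ 4 / ((r:ℝ) * s ^ 2) + q ^ 2)) := by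
        gcongr
        nlinarith
    _ = _ := by ring

end BCF

namespace BCF

lemma sum_inv_sq (N : ℕ) : ∑ k ∈ Finset.Icc 1 N, 1 / (k:ℝ) ^ 2 ≤ 2 := by
  have h : ∀ n : ℕ, ∑ k ∈ Finset.Icc 1 (n + 1), 1 / (k:ℝ) ^ 2 ≤ 2 - 1 / ((n + 1 : ℕ) : ℝ) := by
    intro n
    induction n with
    | zero => simp; norm_num
    | succ n ih =>
      rw [Finset.sum_Icc_succ_top (by omega)]
      have h1 : (0:ℝ) < (n + 1 : ℕ) := by positivity
      have e : ((n + 1 + 1 : ℕ) : ℝ) = ((n + 1 : ℕ) : ℝ) + 1 := by push_cast; ring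
      rw [e]
      set x : ℝ := ((n + 1 : ℕ) : ℝ)
      have : 1 / (x + 1) ^ 2 ≤ 1 / x - 1 / (x + 1) := by
        rw [div_sub_div _ _ h1.ne' (by positivity), div_le_div_iff₀ (by positivity) (by positivity)]
        nlinarith
      linarith
  cases N with
  | zero => simp
  | succ n =>
    have := h n
    have : (0:ℝ) < 1 / ((n + 1 : ℕ) : ℝ) := by positivity
    linarith

lemma sum_inv_sq_dvd (N m : ℕ) (hm : 0 < m) :
    ∑ b ∈ (Finset.Icc 1 N).filter (fun b => m ∣ b), 1 / (b:ℝ) ^ 2 ≤ 2 / (m:ℝ) ^ 2 := by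
  have hsub : (Finset.Icc 1 N).filter (fun b => m ∣ b) ⊆ (Finset.Icc 1 N).image (fun k => m * k) := by
    intro b hb
    obtain ⟨h1, k, rfl⟩ := Finset.mem_filter.1 hb
    rw [Finset.mem_Icc] at h1
    refine Finset.mem_image.2 ⟨k, Finset.mem_Icc.2 ⟨?_, ?_⟩, rfl⟩
    · rcases Nat.eq_zero_or_pos k with rfl | h
      · simp at h1
      · exact h
    · exact (Nat.le_mul_of_pos_left k hm).trans h1.2
  refine (Finset.sum_le_sum_of_subset_of_nonneg hsub (fun _ _ _ => by positivity)).trans ?_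
  rw [Finset.sum_image (by intro x _ y _ h; exact Nat.eq_of_mul_eq_mul_left hm h)]
  have e : ∀ k ∈ Finset.Icc 1 N, 1 / ((m * k : ℕ) : ℝ) ^ 2 = 1 / (m:ℝ) ^ 2 * (1 / (k:ℝ) ^ 2) := by
    intro k _; push_cast; rw [mul_pow, div_mul_div_comm, one_mul]
  rw [Finset.sum_congr rfl e, ← Finset.mul_sum]
  calc 1 / (m:ℝ) ^ 2 * _ ≤ 1 / (m:ℝ) ^ 2 * 2 := by gcongr; exact sum_inv_sq N
    _ = _ := by ring

lemma card_divisors_sqf (r : ℕ) (hr : Squarefree r) : r.divisors.card = 2 ^ r.primeFactors.card := by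
  rw [Nat.card_divisors hr.ne_zero]
  rw [Finset.prod_congr rfl (g := fun _ => 2), Finset.prod_const]
  intro p hp
  have := (Nat.squarefree_iff_factorization_le_one hr.ne_zero).1 hr p
  have h4 := (Nat.prime_of_mem_primeFactors hp).factorization_pos_of_dvd hr.ne_zero (Nat.dvd_of_mem_primeFactors hp)
  omega

lemma sum_gcd_inv_sq (r s N : ℕ) (hr : Squarefree r) (hs : 0 < s) (hrs : Nat.Coprime r s) :
    ∑ b ∈ (Finset.Icc 1 N).filter (fun b => s ∣ b), (Nat.gcd r b : ℝ) / (b:ℝ) ^ 2 ≤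
      2 ^ r.primeFactors.card * (2 / (s:ℝ) ^ 2) := by
  have h1 : ∀ b ∈ (Finset.Icc 1 N).filter (fun b => s ∣ b), (Nat.gcd r b : ℝ) / (b:ℝ) ^ 2 ≤
      ∑ g ∈ r.divisors, if g ∣ b then (g:ℝ) / (b:ℝ) ^ 2 else 0 := by
    intro b _
    have hmem : Nat.gcd r b ∈ r.divisors := Nat.mem_divisors.2 ⟨Nat.gcd_dvd_left _ _, hr.ne_zero⟩
    refine le_trans (le_of_eq ?_) (Finset.single_le_sum
      (f := fun g : ℕ => if g ∣ b then (g:ℝ) / (b:ℝ) ^ 2 else 0) ?_ hmem)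
    · simp only [Nat.gcd_dvd_right r b, if_true]
    · intro g _; positivity
  refine (Finset.sum_le_sum h1).trans ?_
  rw [Finset.sum_comm]
  have h2 : ∀ g ∈ r.divisors, (∑ b ∈ (Finset.Icc 1 N).filter (fun b => s ∣ b),
      if g ∣ b then (g:ℝ) / (b:ℝ) ^ 2 else 0) ≤ 2 / (s:ℝ) ^ 2 := by
    intro g hg
    have hg0 : 0 < g := Nat.pos_of_mem_divisors hg
    have hg1 : (1:ℝ) ≤ g := by exact_mod_cast hg0
    have hcop : Nat.Coprime s g := (Nat.Coprime.coprime_dvd_left (Nat.dvd_of_mem_divisors hg) hrs).symm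
    rw [← Finset.sum_filter, Finset.filter_filter]
    have e : (Finset.Icc 1 N).filter (fun b => s ∣ b ∧ g ∣ b) ⊆ (Finset.Icc 1 N).filter (fun b => s * g ∣ b) := by
      intro b hb
      obtain ⟨a1, a2, a3⟩ := Finset.mem_filter.1 hb
      exact Finset.mem_filter.2 ⟨a1, hcop.mul_dvd_of_dvd_of_dvd a2 a3⟩
    calc ∑ b ∈ (Finset.Icc 1 N).filter (fun b => s ∣ b ∧ g ∣ b), (g:ℝ) / (b:ℝ) ^ 2
        ≤ ∑ b ∈ (Finset.Icc 1 N).filter (fun b => s * g ∣ b), (g:ℝ) / (b:ℝ) ^ 2 :=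
          Finset.sum_le_sum_of_subset_of_nonneg e (fun _ _ _ => by positivity)
      _ = g * ∑ b ∈ (Finset.Icc 1 N).filter (fun b => s * g ∣ b), 1 / (b:ℝ) ^ 2 := by
          rw [Finset.mul_sum]; exact Finset.sum_congr rfl fun b _ => by ring
      _ ≤ g * (2 / ((s * g : ℕ) : ℝ) ^ 2) := by
          gcongr; exact sum_inv_sq_dvd N (s * g) (Nat.mul_pos hs hg0)
      _ = 2 / (s:ℝ) ^ 2 / g := by
          have : (0:ℝ) < s := by exact_mod_cast hs
          push_cast; field_simp
      _ ≤ 2 / (s:ℝ) ^ 2 := div_le_self (by positivity) hg1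
  refine (Finset.sum_le_sum h2).trans ?_
  rw [Finset.sum_const, nsmul_eq_mul, card_divisors_sqf r hr]; push_cast; rfl

lemma normalise_zero (f : BCF) (ha : f.1 = 0) (hb : f.2.1 ≠ 0) :
    ∃ g : BCF, GLeq f g ∧ g.1 = 0 ∧ g.2.1 = |f.2.1| ∧ 0 ≤ g.2.2.1 ∧ g.2.2.1 < 2 * g.2.1 := by
  have h1 : ∃ g : BCF, GLeq f g ∧ g.1 = 0 ∧ g.2.1 = |f.2.1| := by
    rcases lt_or_gt_of_ne hb with h | h
    · refine ⟨-f, ⟨!![-1, 0; 0, -1], by simp [Matrix.det_fin_two], ?_⟩, ?_, ?_⟩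
      · simp only [act, Matrix.det_fin_two]
        ext <;> simp
      · simp [ha]
      · rw [abs_of_neg h]; rfl
    · exact ⟨f, GLeq.refl f, ha, (abs_of_pos h).symm⟩
  obtain ⟨g, hg, hg1, hg2⟩ := h1
  have hpos : 0 < g.2.1 := by rw [hg2]; exact abs_pos.2 hb
  refine ⟨shear (-(g.2.2.1 / (2 * g.2.1))) g, hg.trans (shear_GLeq _ _), ?_, ?_, ?_, ?_⟩
  · exact hg1
  · simp only [shear, hg1]; rw [← hg2]; ring
  · have := Int.emod_nonneg g.2.2.1 (show 2 * g.2.1 ≠ 0 by positivity)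
    have e := Int.emod_add_mul_ediv g.2.2.1 (2 * g.2.1)
    simp only [shear, hg1]
    linarith
  · have := Int.emod_lt_of_pos g.2.2.1 (show 0 < 2 * g.2.1 by positivity)
    have e := Int.emod_add_mul_ediv g.2.2.1 (2 * g.2.1)
    simp only [shear, hg1]
    linarith

end BCF

namespace BCF

lemma count_zero_fibre (r : ℕ) (hr : Squarefree r) (h2 : Nat.Coprime r 2) (X : ℝ) (hX : 0 < X)
    (b : ℕ) (hb : 1 ≤ b) (c : ℤ) (G : Finset BCF)
    (hG : ∀ f ∈ G, f.1 = 0 ∧ f.2.1 = b ∧ f.2.2.1 = c ∧ |(disc f : ℝ)| < X ∧ (r:ℤ) ∣ disc f) :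
    (G.card : ℝ) ≤ X / (2 * r) * ((Nat.gcd r b : ℝ) / (b:ℝ) ^ 3) + 1 := by
  obtain ⟨r2, hr2⟩ := Nat.gcd_dvd_left r b
  set g := Nat.gcd r b with hg
  have hr0 : r ≠ 0 := hr.ne_zero
  have hg0 : g ≠ 0 := by rintro h; rw [h, zero_mul] at hr2; exact hr0 hr2
  have hr20 : r2 ≠ 0 := by rintro h; rw [h, mul_zero] at hr2; exact hr0 hr2
  have hcop : Nat.Coprime r2 b := by
    rw [hr2] at hr
    have hgr : Nat.Coprime g r2 := Nat.coprime_of_squarefree_mul hr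
    rw [Nat.coprime_iff_gcd_eq_one]
    have d1 : Nat.gcd r2 b ∣ g := by
      rw [hg]; apply Nat.dvd_gcd
      · exact (Nat.gcd_dvd_left _ _).trans ⟨g, by rw [mul_comm]; exact hr2⟩
      · exact Nat.gcd_dvd_right _ _
    have d2 : Nat.gcd r2 b ∣ Nat.gcd g r2 := Nat.dvd_gcd d1 (Nat.gcd_dvd_left _ _)
    rw [hgr] at d2
    exact Nat.dvd_one.1 d2
  have hr2d : (r2:ℤ) ∣ r := by rw [hr2]; push_cast; exact dvd_mul_left _ _
  have hcb : IsCoprime (r2:ℤ) (b:ℤ) := Nat.isCoprime_iff_coprime.2 hcop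
  have hc2 : IsCoprime (r2:ℤ) (4:ℤ) := by
    have : Nat.Coprime r2 2 := Nat.Coprime.coprime_dvd_left (by exact_mod_cast hr2d) h2
    have h := (Nat.isCoprime_iff_coprime.2 this).pow_right (n := 2)
    norm_num at h; exact h
  have hinj : Set.InjOn (fun f : BCF => f.2.2.2) G := by
    intro f hf f' hf' h
    obtain ⟨a1, a2, a3, _⟩ := hG f hf
    obtain ⟨b1, b2, b3, _⟩ := hG f' hf'
    simp only at h
    ext
    · rw [a1, b1]
    · rw [a2, b2]
    · rw [a3, b3]
    · exact h
  rw [← Finset.card_image_of_injOn hinj]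
  have hb0 : (0:ℝ) < b := by exact_mod_cast hb
  have hgR : (0:ℝ) < g := by exact_mod_cast Nat.pos_of_ne_zero hg0
  have hr2R : (0:ℝ) < r2 := by exact_mod_cast Nat.pos_of_ne_zero hr20
  have hdisc : ∀ f ∈ G, disc f = (b:ℤ) ^ 2 * (c ^ 2 - 4 * b * f.2.2.2) := by
    intro f hf
    obtain ⟨a1, a2, a3, _⟩ := hG f hf
    simp only [disc, a1, a2, a3]; ring
  have key := card_congr_le (G.image (fun f : BCF => f.2.2.2)) r2 (Nat.pos_of_ne_zero hr20)
    (X / (2 * (b:ℝ) ^ 3)) (by positivity)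
    (by
      intro x hx y hy
      obtain ⟨f, hf, rfl⟩ := Finset.mem_image.1 hx
      obtain ⟨f', hf', rfl⟩ := Finset.mem_image.1 hy
      obtain ⟨_, _, _, a4, a5⟩ := hG f hf
      obtain ⟨_, _, _, b4, b5⟩ := hG f' hf'
      rw [hdisc f hf] at a4 a5
      rw [hdisc f' hf'] at b4 b5
      constructor
      · have c1 := (hcb.pow_right (n := 2)).dvd_of_dvd_mul_left (hr2d.trans a5)
        have c2 := (hcb.pow_right (n := 2)).dvd_of_dvd_mul_left (hr2d.trans b5)
        have c3 : (r2:ℤ) ∣ 4 * (b * (f.2.2.2 - f'.2.2.2)) := by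
          have := dvd_sub c2 c1
          have e : 4 * (b * (f.2.2.2 - f'.2.2.2)) = (c ^ 2 - 4 * b * f'.2.2.2) - (c ^ 2 - 4 * b * f.2.2.2) := by ring
          rw [e]; exact this
        exact hcb.dvd_of_dvd_mul_left (hc2.dvd_of_dvd_mul_left c3)
      · rw [le_div_iff₀ (by positivity)]
        have e1 := (abs_lt.1 a4).1
        have e2 := (abs_lt.1 b4).2
        push_cast at e1 e2 ⊢
        nlinarith)
  refine key.trans (le_of_eq ?_)
  have : (r:ℝ) = g * r2 := by exact_mod_cast hr2
  rw [this]; field_simp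

lemma count_zero_norm (r s : ℕ) (hr : Squarefree r) (hs : Squarefree s) (hrs : Nat.Coprime r s)
    (h2 : Nat.Coprime r 2) (X L : ℝ) (hX : 0 < X) (hL : 0 ≤ L) (G : Finset BCF)
    (hG : ∀ f ∈ G, f.1 = 0 ∧ 1 ≤ f.2.1 ∧ (f.2.1 : ℝ) ≤ L ∧ 0 ≤ f.2.2.1 ∧ f.2.2.1 < 2 * f.2.1 ∧
      |(disc f : ℝ)| < X ∧ (r:ℤ) ∣ disc f ∧ HDvd s f) :
    (G.card : ℝ) ≤ 2 * 2 ^ r.primeFactors.card * (X / ((r:ℝ) * s ^ 2)) + 2 * L ^ 2 := by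
  set N := ⌊L⌋₊ with hN
  have hr0 : (0:ℝ) < r := by exact_mod_cast Nat.pos_of_ne_zero hr.ne_zero
  have hs0 : (0:ℝ) < s := by exact_mod_cast Nat.pos_of_ne_zero hs.ne_zero
  set T := (Finset.Icc 1 N).filter (fun b => s ∣ b) with hT
  have hfib : ∀ b ∈ T, ((G.filter (fun f => f.2.1.toNat = b)).card : ℝ) ≤
      X / r * ((Nat.gcd r b : ℝ) / (b:ℝ) ^ 2) + 2 * b := by
    intro b hb
    have hb1 : 1 ≤ b := (Finset.mem_Icc.1 (Finset.mem_filter.1 hb).1).1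
    have hb0 : (0:ℝ) < b := by exact_mod_cast hb1
    rw [Finset.card_eq_sum_card_fiberwise (f := fun f : BCF => f.2.2.1) (t := Finset.Ico (0:ℤ) (2 * b))]
    · push_cast
      have : ∀ c ∈ Finset.Ico (0:ℤ) (2 * b), ((((G.filter (fun f => f.2.1.toNat = b))).filter (fun f => f.2.2.1 = c)).card : ℝ) ≤
          X / (2 * r) * ((Nat.gcd r b : ℝ) / (b:ℝ) ^ 3) + 1 := by
        intro c _
        apply count_zero_fibre r hr h2 X hX b hb1 c
        intro f hf
        obtain ⟨hf1, hf2⟩ := Finset.mem_filter.1 hf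
        obtain ⟨hf3, hf4⟩ := Finset.mem_filter.1 hf1
        obtain ⟨g1, g2, g3, g4, g5, g6, g7, g8⟩ := hG f hf3
        refine ⟨g1, ?_, hf2, g6, g7⟩
        omega
      refine (Finset.sum_le_sum this).trans ?_
      rw [Finset.sum_const, Int.card_Ico, nsmul_eq_mul]
      have e : (((2 * (b:ℤ) - 0).toNat : ℕ) : ℝ) = 2 * b := by
        have : (2 * (b:ℤ) - 0).toNat = 2 * b := by omega
        rw [this]; push_cast; rfl
      rw [e]
      apply le_of_eq; field_simp
    · intro f hf
      obtain ⟨hf3, hf4⟩ := Finset.mem_filter.1 (Finset.mem_coe.1 hf)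
      obtain ⟨g1, g2, g3, g4, g5, g6, g7, g8⟩ := hG f hf3
      simp only [Finset.coe_Ico, Set.mem_Ico]
      omega
  have hmap : ∀ f ∈ G, f.2.1.toNat ∈ T := by
    intro f hf
    obtain ⟨g1, g2, g3, g4, g5, g6, g7, g8, _, _⟩ := hG f hf
    obtain ⟨b, hb⟩ := Int.eq_ofNat_of_zero_le (show 0 ≤ f.2.1 by omega)
    rw [hb, Int.toNat_natCast]
    rw [hb] at g2 g3
    refine Finset.mem_filter.2 ⟨Finset.mem_Icc.2 ⟨by omega, ?_⟩, ?_⟩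
    · exact Nat.le_floor (by exact_mod_cast g3)
    · have : (s:ℤ) ∣ (b:ℤ) := by
        apply sqf_dvd hs
        intro p hp hps
        have h1 : (p:ℤ) ∣ hA f := dvd_trans (by exact_mod_cast hps) g8
        simp only [hA, g1, hb] at h1
        have h3 : (p:ℤ) ∣ (b:ℤ) ^ 2 := by simpa using h1
        exact (Nat.prime_iff_prime_int.1 hp).dvd_of_dvd_pow h3
      exact_mod_cast this
  rw [Finset.card_eq_sum_card_fiberwise (f := fun f : BCF => f.2.1.toNat) (t := T) hmap]
  push_cast
  refine (Finset.sum_le_sum hfib).trans ?_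
  rw [Finset.sum_add_distrib, ← Finset.mul_sum]
  have s1 := sum_gcd_inv_sq r s N hr (Nat.pos_of_ne_zero hs.ne_zero) hrs
  have s2 : ∑ b ∈ T, 2 * (b:ℝ) ≤ 2 * L ^ 2 := by
    have hNL : (N:ℝ) ≤ L := Nat.floor_le hL
    calc ∑ b ∈ T, 2 * (b:ℝ) ≤ ∑ b ∈ Finset.Icc 1 N, 2 * (b:ℝ) :=
          Finset.sum_le_sum_of_subset_of_nonneg (Finset.filter_subset _ _) (fun _ _ _ => by positivity)
      _ ≤ ∑ b ∈ Finset.Icc 1 N, 2 * L := by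
          refine Finset.sum_le_sum fun b hb => ?_
          have : (b:ℝ) ≤ N := by exact_mod_cast (Finset.mem_Icc.1 hb).2
          linarith
      _ = N * (2 * L) := by rw [Finset.sum_const, nsmul_eq_mul]; simp
      _ ≤ L * (2 * L) := by gcongr
      _ = _ := by ring
  have s3 := mul_le_mul_of_nonneg_left s1 (show 0 ≤ X / r by positivity)
  refine add_le_add (s3.trans (le_of_eq ?_)) s2
  field_simp

end BCF

namespace BCF

lemma transfer (S : Finset BCF) (φ : BCF → BCF) (hφ : ∀ f ∈ S, GLeq f (φ f))
    (hine : ∀ f ∈ S, ∀ g ∈ S, f ≠ g → ¬ GLeq f g) :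
    (S.image φ).card = S.card ∧
      ∀ f ∈ S.image φ, ∀ g ∈ S.image φ, f ≠ g → ¬ GLeq f g := by
  have key : ∀ f ∈ S, ∀ g ∈ S, GLeq (φ f) (φ g) → f = g := by
    intro f hf g hg h
    by_contra hne
    exact hine f hf g hg hne (((hφ f hf).trans h).trans (hφ g hg).symm)
  constructor
  · apply Finset.card_image_of_injOn
    intro f hf g hg h
    exact key f hf g hg (by rw [h]; exact GLeq.refl _)
  · intro f hf g hg hne h
    rw [Finset.mem_image] at hf hg
    obtain ⟨f', hf', rfl⟩ := hf
    obtain ⟨g', hg', rfl⟩ := hg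
    exact hne (by rw [key f' hf' g' hg' h])

/-- The count of forms with reducible leading coefficient zero. -/
lemma count_zero (r s : ℕ) (hr : Squarefree r) (hs : Squarefree s) (hrs : Nat.Coprime r s)
    (h2 : Nat.Coprime r 2) (X L : ℝ) (hX : 0 < X) (hL : 0 ≤ L) (G : Finset BCF)
    (hG : ∀ f ∈ G, f.1 = 0 ∧ disc f ≠ 0 ∧ |(f.2.1 : ℝ)| ≤ L ∧ |(disc f : ℝ)| < X ∧
      (r:ℤ) ∣ disc f ∧ HDvd s f)
    (hine : ∀ f ∈ G, ∀ g ∈ G, f ≠ g → ¬ GLeq f g) :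
    (G.card : ℝ) ≤ 2 * 2 ^ r.primeFactors.card * (X / ((r:ℝ) * s ^ 2)) + 2 * L ^ 2 := by
  have hb : ∀ f ∈ G, f.2.1 ≠ 0 := by
    intro f hf h
    obtain ⟨h1, h2, -⟩ := hG f hf
    apply h2
    simp [disc, h, h1]
  have : ∀ f : BCF, ∃ g : BCF, f ∈ G → GLeq f g ∧ g.1 = 0 ∧ g.2.1 = |f.2.1| ∧ 0 ≤ g.2.2.1 ∧
      g.2.2.1 < 2 * g.2.1 := by
    intro f
    by_cases hf : f ∈ G
    · obtain ⟨g, hg⟩ := normalise_zero f (hG f hf).1 (hb f hf)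
      exact ⟨g, fun _ => hg⟩
    · exact ⟨f, fun h => absurd h hf⟩
  choose φ hφ using this
  obtain ⟨hc, -⟩ := transfer G φ (fun f hf => (hφ f hf).1) hine
  rw [← hc]
  apply count_zero_norm r s hr hs hrs h2 X L hX hL
  intro g hg
  rw [Finset.mem_image] at hg
  obtain ⟨f, hf, rfl⟩ := hg
  obtain ⟨h1, h2, h3, h4, h5, h6⟩ := hG f hf
  obtain ⟨e1, e2, e3, e4, e5⟩ := hφ f hf
  refine ⟨e2, ?_, ?_, e4, e5, ?_, ?_, e1.hdvd h6⟩
  · rw [e3]; exact Int.one_le_abs (hb f hf)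
  · rw [e3]; push_cast; exact h3
  · rw [e1.disc_eq]; exact h4
  · rw [e1.disc_eq]; exact h5

theorem count_base (r s : ℕ) (hr : Squarefree r) (hs : Squarefree s) (hrs : Nat.Coprime r s)
    (h6 : Nat.Coprime (r * s) 6) (X : ℝ) (hX : 0 < X) (S : Finset BCF)
    (hS : ∀ f ∈ S, disc f ≠ 0 ∧ |(disc f : ℝ)| < X ∧ (r:ℤ) ∣ disc f ∧ HDvd s f)
    (hine : ∀ f ∈ S, ∀ g ∈ S, f ≠ g → ¬ GLeq f g) :
    (S.card : ℝ) ≤ 2 ^ 56 * 6 ^ (r * s).primeFactors.card *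
      (X / ((r:ℝ) * s ^ 2) + ((r * s : ℕ) : ℝ) ^ 2) := by
  obtain ⟨l, hl, hlX⟩ : ∃ l : ℝ, 0 < l ∧ l ^ 4 = X := by
    refine ⟨√√X, by positivity, ?_⟩
    rw [show (4:ℕ) = 2 * 2 from rfl, pow_mul, Real.sq_sqrt (Real.sqrt_nonneg _),
      Real.sq_sqrt hX.le]
  have : ∀ f : BCF, ∃ g : BCF, f ∈ S → GLeq f g ∧ ∃ t : ℝ, 1 ≤ t ∧ InBox (4 * l) t g := by
    intro f
    by_cases hf : f ∈ S
    · obtain ⟨g, hg⟩ := exists_box f l hl (hS f hf).1 (by rw [hlX]; exact (hS f hf).2.1.le)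
      exact ⟨g, fun _ => hg⟩
    · exact ⟨f, fun h => absurd h hf⟩
  choose φ hφ using this
  obtain ⟨hc, hine'⟩ := transfer S φ (fun f hf => (hφ f hf).1) hine
  have hT : ∀ g ∈ S.image φ, disc g ≠ 0 ∧ |(disc g : ℝ)| < X ∧ (r:ℤ) ∣ disc g ∧ HDvd s g ∧
      ∃ t : ℝ, 1 ≤ t ∧ InBox (4 * l) t g := by
    intro g hg
    rw [Finset.mem_image] at hg
    obtain ⟨f, hf, rfl⟩ := hg
    obtain ⟨h1, h2, h3, h4⟩ := hS f hf
    obtain ⟨e1, e2⟩ := hφ f hf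
    rw [e1.disc_eq]
    exact ⟨h1, h2, h3, e1.hdvd h4, e2⟩
  set T := S.image φ with hTdef
  clear_value T
  rw [← hc]
  have hsplit := Finset.card_filter_add_card_filter_not (s := T) (fun f : BCF => f.1 = 0)
  have hne := count_ne r s hr hs hrs h6 (4 * l) (T.filter (fun f => ¬ f.1 = 0)) (by
    intro f hf
    rw [Finset.mem_filter] at hf
    obtain ⟨h1, h2, h3, h4, h5⟩ := hT f hf.1
    exact ⟨hf.2, h3, h4, h5⟩) (by
    intro f hf g hg
    exact hine' f (Finset.mem_filter.1 hf).1 g (Finset.mem_filter.1 hg).1)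
  have hz := count_zero r s hr hs hrs
    ((Nat.Coprime.coprime_mul_right h6).coprime_dvd_right (by norm_num)) X (4 * l) hX
    (by positivity) (T.filter (fun f => f.1 = 0)) (by
    intro f hf
    rw [Finset.mem_filter] at hf
    obtain ⟨h1, h2, h3, h4, t, ht, h5⟩ := hT f hf.1
    refine ⟨hf.2, h1, ?_, h2, h3, h4⟩
    have := h5.2.1
    have h7 : |(f.2.1:ℝ)| * 1 ≤ |(f.2.1:ℝ)| * t := by gcongr
    linarith) (by
    intro f hf g hg
    exact hine' f (Finset.mem_filter.1 hf).1 g (Finset.mem_filter.1 hg).1)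
  have hr0 : 0 < r := Nat.pos_of_ne_zero hr.ne_zero
  have hs0 : 0 < s := Nat.pos_of_ne_zero hs.ne_zero
  set D : ℝ := (r:ℝ) * s ^ 2 with hD
  have hD0 : 0 < D := by positivity
  have hD2 : D ≤ ((r * s : ℕ) : ℝ) ^ 2 := by
    have : (r:ℝ) ≤ r ^ 2 := by
      have : (1:ℝ) ≤ r := by exact_mod_cast hr0
      nlinarith
    push_cast
    rw [mul_pow, hD]; gcongr
  have hcast : (T.card : ℝ) = ((T.filter (fun f => f.1 = 0)).card : ℝ) +
      ((T.filter (fun f => ¬ f.1 = 0)).card : ℝ) := by rw [← hsplit]; push_cast; rfl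
  have hsq : 2 * l ^ 2 ≤ X / D + D := by
    have h1 : 0 ≤ (l ^ 2 / D - 1) ^ 2 * D := by positivity
    have h2 : (l ^ 2 / D - 1) ^ 2 * D = l ^ 4 / D + D - 2 * l ^ 2 := by field_simp; ring
    rw [← hlX]; linarith
  have hom : (2:ℝ) ^ r.primeFactors.card ≤ 6 ^ (r * s).primeFactors.card := by
    have h1 : r.primeFactors.card ≤ (r * s).primeFactors.card := by
      apply Finset.card_le_card
      exact Nat.primeFactors_mono (dvd_mul_right r s) (by positivity)
    calc (2:ℝ) ^ r.primeFactors.card ≤ 2 ^ (r * s).primeFactors.card :=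
          pow_le_pow_right₀ (by norm_num) h1
      _ ≤ _ := by gcongr; norm_num
  have hK1 : (1:ℝ) ≤ 6 ^ (r * s).primeFactors.card := one_le_pow₀ (by norm_num)
  have e1 : (4 * l) ^ 4 / D = 256 * (X / D) := by rw [mul_pow, hlX]; ring
  have e2 : 2 * (4 * l) ^ 2 = 16 * (2 * l ^ 2) := by ring
  rw [e1] at hne
  rw [e2] at hz
  set K : ℝ := 6 ^ (r * s).primeFactors.card
  set x := X / D
  have hx : 0 < x := by positivity
  set y : ℝ := ((r * s : ℕ) : ℝ) ^ 2
  have hy : 0 < y := lt_of_lt_of_le hD0 hD2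
  rw [hcast]
  have a1 : 2 * 2 ^ r.primeFactors.card * x ≤ 2 * K * x := by gcongr
  have a2 : x + y ≤ K * (x + y) := by nlinarith
  have a3 : 0 ≤ K * x := by positivity
  have a4 : 0 ≤ K * y := by positivity
  nlinarith
end BCF

namespace BCF

/-- Forms strongly divisible at `p` move to a form with `p² ∣ a`, `p ∣ b`. -/
lemma move_zero (p : ℕ) (hp : p.Prime) (h6 : Nat.Coprime p 6) (f : BCF)
    (hA0 : (p:ℤ) ∣ hA f) (hB0 : (p:ℤ) ∣ hB f) (hC0 : ¬ (p:ℤ) ∣ hC f)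
    (hd : (p:ℤ) ^ 2 ∣ disc f) :
    (p:ℤ) ^ 2 ∣ f.1 ∧ (p:ℤ) ∣ f.2.1 ∧ ¬ (p:ℤ) ∣ f.2.2.1 := by
  obtain ⟨a, b, c, d⟩ := f
  have hP : Prime (p:ℤ) := Nat.prime_iff_prime_int.1 hp
  have h3 : ¬ (p:ℤ) ∣ 3 := by
    intro h
    have h' : p ∣ 3 := by exact_mod_cast h
    have := Nat.dvd_gcd dvd_rfl (h'.trans (show 3 ∣ 6 by norm_num))
    rw [h6] at this
    exact hp.one_lt.ne' (Nat.dvd_one.1 this)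
  have h2 : ¬ (p:ℤ) ∣ 2 := by
    intro h
    have h' : p ∣ 2 := by exact_mod_cast h
    have := Nat.dvd_gcd dvd_rfl (h'.trans (show 2 ∣ 6 by norm_num))
    rw [h6] at this
    exact hp.one_lt.ne' (Nat.dvd_one.1 this)
  simp only
  have ha : (p:ℤ) ∣ a := by
    have e : 3 * a * hC (a, b, c, d) = hB (a,b,c,d) * b - hA (a,b,c,d) * c := by
      simp only [hA, hB, hC]; ring
    have : (p:ℤ) ∣ 3 * a * hC (a, b, c, d) := by
      rw [e]; exact dvd_sub (hB0.mul_right _) (hA0.mul_right _)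
    rcases hP.dvd_or_dvd this with h | h
    · rcases hP.dvd_or_dvd h with h | h
      · exact absurd h h3
      · exact h
    · exact absurd h hC0
  have hb : (p:ℤ) ∣ b := by
    have e : hC (a, b, c, d) * b = hB (a,b,c,d) * c - 3 * hA (a,b,c,d) * d := by
      simp only [hA, hB, hC]; ring
    have : (p:ℤ) ∣ hC (a, b, c, d) * b := by
      rw [e]; exact dvd_sub (hB0.mul_right _) ((hA0.mul_left _).mul_right _)
    rcases hP.dvd_or_dvd this with h | h
    · exact absurd h hC0
    · exact h
  have hc : ¬ (p:ℤ) ∣ c := by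
    intro h
    apply hC0
    simp only [hC]
    exact dvd_sub (h.trans (dvd_pow_self _ two_ne_zero)) ((hb.mul_left _).mul_right _)
  refine ⟨?_, hb, hc⟩
  obtain ⟨a', rfl⟩ := ha
  obtain ⟨b', rfl⟩ := hb
  obtain ⟨k, hk⟩ := hd
  have hp0 : (p:ℤ) ≠ 0 := by exact_mod_cast hp.ne_zero
  have : (p:ℤ) ∣ 2 * (2 * (a' * c ^ 3)) := by
    simp only [disc] at hk
    have e : (p:ℤ) * (2 * (2 * (a' * c ^ 3))) = p * (p * (b' ^ 2 * c ^ 2 - 4 * p * b' ^ 3 * d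
      - 27 * a' ^ 2 * d ^ 2 + 18 * a' * b' * c * d - k)) := by linear_combination -hk
    exact ⟨_, mul_left_cancel₀ hp0 e⟩
  rcases hP.dvd_or_dvd this with h | h
  · exact absurd h h2
  rcases hP.dvd_or_dvd h with h | h
  · exact absurd h h2
  rcases hP.dvd_or_dvd h with h | h
  · obtain ⟨x, rfl⟩ := h
    exact ⟨x, by ring⟩
  · exact absurd (hP.dvd_of_dvd_pow h) hc

lemma exists_move (p : ℕ) (hp : p.Prime) (h6 : Nat.Coprime p 6) (f : BCF)
    (hn : ¬ HDvd p f) (hd : (p:ℤ) ^ 2 ∣ disc f) :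
    ∃ g, GLeq f g ∧ (p:ℤ) ^ 2 ∣ g.1 ∧ (p:ℤ) ∣ g.2.1 ∧ ¬ (p:ℤ) ∣ g.2.2.1 := by
  have hP : Prime (p:ℤ) := Nat.prime_iff_prime_int.1 hp
  have h2 : ¬ (p:ℤ) ∣ 2 := by
    intro h
    have h' : p ∣ 2 := by exact_mod_cast h
    have := Nat.dvd_gcd dvd_rfl (h'.trans (show 2 ∣ 6 by norm_num))
    rw [h6] at this
    exact hp.one_lt.ne' (Nat.dvd_one.1 this)
  suffices h : ∃ g, GLeq f g ∧ (p:ℤ) ∣ hA g ∧ (p:ℤ) ∣ hB g by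
    obtain ⟨g, hg, h1, h3⟩ := h
    refine ⟨g, hg, move_zero p hp h6 g h1 h3 ?_ (by rw [hg.disc_eq]; exact hd)⟩
    intro h4
    exact hn (hg.symm.hdvd ⟨h1, h3, h4⟩)
  have hdp : (p:ℤ) ∣ disc f := (dvd_pow_self _ two_ne_zero).trans hd
  have hess := hess_disc f
  by_cases hA0 : (p:ℤ) ∣ hA f
  · refine ⟨f, GLeq.refl f, hA0, ?_⟩
    have : (p:ℤ) ∣ hB f ^ 2 := by
      have e : hB f ^ 2 = 4 * hA f * hC f - 3 * disc f := by linarith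
      rw [e]
      exact dvd_sub ((hA0.mul_left _).mul_right _) (hdp.mul_left _)
    exact hP.dvd_of_dvd_pow this
  · have hcop : IsCoprime (2 * hA f) (p:ℤ) := by
      rw [isCoprime_comm, hP.coprime_iff_not_dvd]
      intro h
      rcases hP.dvd_or_dvd h with h | h
      · exact h2 h
      · exact hA0 h
    obtain ⟨u, v, huv⟩ := hcop
    -- x = -u * B
    set x := -u * hB f with hx
    have hlin : (p:ℤ) ∣ 2 * hA f * x + hB f := ⟨v * hB f, by rw [hx]; linear_combination (-hB f) * huv⟩
    have hquad : (p:ℤ) ∣ hA f * x ^ 2 + hB f * x + hC f := by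
      have h1 : (p:ℤ) ∣ 2 * (2 * (hA f * (hA f * x ^ 2 + hB f * x + hC f))) := by
        have e : 2 * (2 * (hA f * (hA f * x ^ 2 + hB f * x + hC f))) =
          (2 * hA f * x + hB f) * (2 * hA f * x + hB f) + 3 * disc f := by
            linear_combination hess
        rw [e]
        exact dvd_add (hlin.mul_left _) (hdp.mul_left _)
      rcases hP.dvd_or_dvd h1 with h | h
      · exact absurd h h2
      rcases hP.dvd_or_dvd h with h | h
      · exact absurd h h2
      rcases hP.dvd_or_dvd h with h | h
      · exact absurd h hA0
      · exact h
    have hdet : (!![x, 1; -1, 0] : Matrix (Fin 2) (Fin 2) ℤ).det = 1 := by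
      simp [Matrix.det_fin_two]
    refine ⟨act !![x, 1; -1, 0] f, ⟨_, Or.inl hdet, rfl⟩, ?_, ?_⟩
    · rw [hA_act, hdet]
      simpa using hquad
    · rw [hB_act, hdet]
      have : (p:ℤ) ∣ -(2 * hA f * x + hB f) := (dvd_neg).2 hlin
      convert this using 1
      simp; ring

/-- `h` is the `p`-descent of `g`. -/
def Dn (p : ℤ) (g h : BCF) : Prop :=
  g.1 = p ^ 2 * h.1 ∧ g.2.1 = p * h.2.1 ∧ g.2.2.1 = h.2.2.1 ∧ h.2.2.2 = p * g.2.2.2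

lemma Dn.disc_eq {p : ℤ} {g h : BCF} (H : Dn p g h) : disc g = p ^ 2 * disc h := by
  obtain ⟨h1, h2, h3, h4⟩ := H
  simp only [disc, h1, h2, h3, h4]; ring

lemma Dn.hdvd {p : ℤ} {g h : BCF} (H : Dn p g h) {s : ℤ} (hs : IsCoprime s p) (hg : HDvd s g) :
    HDvd s h := by
  obtain ⟨h1, h2, h3, h4⟩ := H
  obtain ⟨a1, a2, a3⟩ := hg
  refine ⟨?_, ?_, ?_⟩
  · have e : hA g = p ^ 2 * hA h := by simp only [hA, h1, h2, h3]; ring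
    rw [e] at a1
    exact (hs.pow_right).dvd_of_dvd_mul_left a1
  · have e : hB g = p * hB h := by simp only [hB, h1, h2, h3, h4]; ring
    rw [e] at a2
    exact hs.dvd_of_dvd_mul_left a2
  · have e : hC g = hC h := by simp only [hC, h2, h3, h4]; ring
    rwa [e] at a3

lemma Dn.lift {p : ℤ} (hp : p ≠ 0) {g h g' h' : BCF} (H : Dn p g h) (H' : Dn p g' h')
    (η : Matrix (Fin 2) (Fin 2) ℤ) (hdet : η.det = 1 ∨ η.det = -1) (hη : p ∣ η 1 0)
    (e : act η h = h') : GLeq g g' := by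
  obtain ⟨h1, h2, h3, h4⟩ := H
  obtain ⟨k1, k2, k3, k4⟩ := H'
  obtain ⟨b, hb⟩ := hη
  have hd : (!![η 0 0, p * η 0 1; b, η 1 1] : Matrix (Fin 2) (Fin 2) ℤ).det = η.det := by
    simp only [Matrix.det_fin_two, hb]; simp; ring
  refine ⟨!![η 0 0, p * η 0 1; b, η 1 1], by rw [hd]; exact hdet, ?_⟩
  subst e
  simp only [act, hd, hb] at k1 k2 k3 k4 ⊢
  simp only [Matrix.of_apply, Matrix.cons_val', Matrix.cons_val_zero, Matrix.cons_val_one,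
    Matrix.cons_val_fin_one]
  refine Prod.ext ?_ (Prod.ext ?_ (Prod.ext ?_ ?_))
  · simp only; rw [k1, h1, h2, h3, h4]; ring
  · simp only; rw [k2, h1, h2, h3, h4]; ring
  · simp only; rw [k3, h1, h2, h3, h4]; ring
  · simp only
    apply mul_left_cancel₀ hp
    rw [← k4, h1, h2, h3, h4]; ring

lemma exists_Dn (p : ℤ) (g : BCF) (h1 : p ^ 2 ∣ g.1) (h2 : p ∣ g.2.1) : ∃ h, Dn p g h := by
  obtain ⟨a, ha⟩ := h1
  obtain ⟨b, hb⟩ := h2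
  exact ⟨(a, b, g.2.2.1, p * g.2.2.2), ha, hb, rfl, rfl⟩

end BCF

namespace BCF

/-- The point of `P¹(F_p)` of an integer vector. -/
def pt (p : ℕ) [Fact p.Prime] (β δ : ℤ) : Option (ZMod p) :=
  if (δ : ZMod p) = 0 then none else some ((β : ZMod p) / δ)

lemma pt_eq (p : ℕ) [Fact p.Prime] (β δ β' δ' : ℤ) (h : pt p β δ = pt p β' δ') :
    (p:ℤ) ∣ β * δ' - δ * β' := by
  rw [← ZMod.intCast_zmod_eq_zero_iff_dvd]
  push_cast
  unfold pt at h
  by_cases h1 : (δ : ZMod p) = 0 <;> by_cases h2 : (δ' : ZMod p) = 0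
  · simp [h1, h2]
  · simp [h1, h2] at h
  · simp [h1, h2] at h
  · simp only [h1, h2, if_false, Option.some.injEq] at h
    rw [div_eq_div_iff h1 h2] at h
    rw [h]; ring

lemma evP_pt (p : ℕ) [Fact p.Prime] (a b c d β δ : ℤ) (hβδ : ¬ ((p:ℤ) ∣ β ∧ (p:ℤ) ∣ δ))
    (h : (p:ℤ) ∣ a * β ^ 3 + b * β ^ 2 * δ + c * β * δ ^ 2 + d * δ ^ 3) :
    evP (a : ZMod p) b c d (pt p β δ) = 0 := by
  rw [← ZMod.intCast_zmod_eq_zero_iff_dvd] at h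
  rw [← ZMod.intCast_zmod_eq_zero_iff_dvd, ← ZMod.intCast_zmod_eq_zero_iff_dvd] at hβδ
  push_cast at h
  unfold pt
  by_cases h1 : (δ : ZMod p) = 0
  · have h2 : (β : ZMod p) ≠ 0 := fun h2 => hβδ ⟨h2, h1⟩
    simp only [h1, if_true, evP]
    simp only [h1] at h
    simpa [h2] using h
  · simp only [h1, if_false, evP]
    field_simp
    linear_combination h

/-- Fibres of the descent map have at most three elements. -/
lemma fibre_le (p : ℕ) (hp : p.Prime) (F : Finset BCF) (G H : BCF → BCF) (h : BCF)
    (hF : ∀ f ∈ F, GLeq f (G f) ∧ Dn p (G f) (H f) ∧ ¬ (p:ℤ) ∣ (H f).2.2.1 ∧ GLeq h (H f))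
    (hine : ∀ f ∈ F, ∀ g ∈ F, f ≠ g → ¬ GLeq f g) : F.card ≤ 3 := by
  have : Fact p.Prime := ⟨hp⟩
  rcases F.eq_empty_or_nonempty with rfl | ⟨f0, hf0⟩
  · simp
  have hP : Prime (p:ℤ) := Nat.prime_iff_prime_int.1 hp
  have hne : ¬ ((h.1 : ZMod p) = 0 ∧ (h.2.1 : ZMod p) = 0 ∧ (h.2.2.1 : ZMod p) = 0 ∧
      (h.2.2.2 : ZMod p) = 0) := by
    rintro ⟨h1, h2, h3, h4⟩
    obtain ⟨-, -, h5, γ, -, h6⟩ := hF f0 hf0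
    apply h5
    rw [← ZMod.intCast_zmod_eq_zero_iff_dvd, ← h6]
    simp [act, h1, h2, h3, h4]
  have hδ : ∀ f : BCF, ∃ γ : Matrix (Fin 2) (Fin 2) ℤ, f ∈ F → (γ.det = 1 ∨ γ.det = -1) ∧
      act γ h = H f := by
    intro f
    by_cases hf : f ∈ F
    · obtain ⟨γ, hγ⟩ := (hF f hf).2.2.2
      exact ⟨γ, fun _ => hγ⟩
    · exact ⟨1, fun h => absurd h hf⟩
  choose Γ hΓ using hδ
  refine le_trans ?_ (card_evP (F := ZMod p) h.1 h.2.1 h.2.2.1 h.2.2.2 hne)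
  apply Finset.card_le_card_of_injOn (fun f => pt p (Γ f 1 0) (Γ f 1 1))
  · intro f hf
    have hf : f ∈ F := hf
    obtain ⟨hd, he⟩ := hΓ f hf
    obtain ⟨-, hD, -, -⟩ := hF f hf
    refine Finset.mem_coe.2 ((@Finset.mem_filter _ _ (_) _ _).2 ⟨Finset.mem_univ _, ?_⟩)
    apply evP_pt
    · rintro ⟨⟨x, hx⟩, ⟨y, hy⟩⟩
      rw [Matrix.det_fin_two, hx, hy] at hd
      apply hP.not_dvd_one
      rcases hd with hd | hd
      · exact ⟨Γ f 0 0 * y - Γ f 0 1 * x, by linear_combination -hd⟩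
      · exact ⟨-(Γ f 0 0 * y - Γ f 0 1 * x), by linear_combination hd⟩
    · have h4 := hD.2.2.2
      rw [← he] at h4
      simp only [act] at h4
      rcases hd with hd | hd <;> rw [hd] at h4
      · exact ⟨(G f).2.2.2, by linear_combination h4⟩
      · exact ⟨-(G f).2.2.2, by linear_combination -h4⟩
  · intro f hf g hg hfg
    have hf : f ∈ F := hf
    have hg : g ∈ F := hg
    have hfg' := pt_eq p _ _ _ _ hfg
    by_contra hfgne
    apply hine f hf g hg hfgne
    obtain ⟨hd, he⟩ := hΓ f hf
    obtain ⟨hd', he'⟩ := hΓ g hg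
    obtain ⟨e1, hD, -, -⟩ := hF f hf
    obtain ⟨e1', hD', -, -⟩ := hF g hg
    have hp0 : (p:ℤ) ≠ 0 := by exact_mod_cast hp.ne_zero
    have hu : IsUnit (Γ g).det := by rcases hd' with h | h <;> simp [h]
    have hadj : (Γ g).det • (Γ g).adjugate * Γ g = 1 := by
      rw [Matrix.smul_mul, Matrix.adjugate_mul, smul_smul]
      rcases hd' with h | h <;> simp [h]
    have hback : act ((Γ g).det • (Γ g).adjugate) (H g) = h := by
      rw [← he', act_mul, hadj, act_one]
    have hdet1 : ((Γ g).det • (Γ g).adjugate).det = (Γ g).det := by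
      have := congrArg Matrix.det hadj
      rw [Matrix.det_mul, Matrix.det_one] at this
      rcases hd' with h | h <;> rw [h] at this ⊢ <;> linarith
    have := Dn.lift hp0 hD' hD (Γ f * ((Γ g).det • (Γ g).adjugate)) (by
      rw [Matrix.det_mul, hdet1]
      rcases hd with h | h <;> rcases hd' with h' | h' <;> simp [h, h']) (by
      rw [Matrix.adjugate_fin_two]
      simp only [Matrix.mul_apply, Fin.sum_univ_two, Matrix.smul_apply, smul_eq_mul]
      simp only [Matrix.of_apply, Matrix.cons_val', Matrix.cons_val_zero, Matrix.cons_val_one,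
        Matrix.cons_val_fin_one]
      obtain ⟨k, hk⟩ := hfg'
      exact ⟨(Γ g).det * k, by linear_combination (Γ g).det * hk⟩) (by
      rw [← act_mul, hback, he])
    exact (e1.trans this.symm).trans e1'.symm

/-- Descent at the prime `p`. -/
lemma descend (p : ℕ) (hp : p.Prime) (h6 : Nat.Coprime p 6) (S : Finset BCF)
    (hS : ∀ f ∈ S, ¬ HDvd p f ∧ (p:ℤ) ^ 2 ∣ disc f)
    (hine : ∀ f ∈ S, ∀ g ∈ S, f ≠ g → ¬ GLeq f g) :
    ∃ T : Finset BCF, S.card ≤ 3 * T.card ∧ (∀ f ∈ T, ∀ g ∈ T, f ≠ g → ¬ GLeq f g) ∧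
      ∀ h ∈ T, ∃ f ∈ S, disc f = (p:ℤ) ^ 2 * disc h ∧
        ∀ s : ℤ, IsCoprime s p → HDvd s f → HDvd s h := by
  have h1 : ∀ f : BCF, ∃ GH : BCF × BCF, f ∈ S → GLeq f GH.1 ∧ Dn p GH.1 GH.2 ∧
      ¬ (p:ℤ) ∣ GH.2.2.2.1 := by
    intro f
    by_cases hf : f ∈ S
    · obtain ⟨g, hg, a1, a2, a3⟩ := exists_move p hp h6 f (hS f hf).1 (hS f hf).2
      obtain ⟨h, hh⟩ := exists_Dn p g a1 a2
      refine ⟨(g, h), fun _ => ⟨hg, hh, ?_⟩⟩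
      rw [← hh.2.2.1]; exact a3
    · exact ⟨(f, f), fun h => absurd h hf⟩
  choose GH hGH using h1
  let c : BCF → Quotient glSetoid := fun f => Quotient.mk glSetoid (GH f).2
  have hout : ∀ f : BCF, GLeq (c f).out (GH f).2 := fun f => Quotient.exact (Quotient.out_eq (c f))
  refine ⟨(S.image c).image Quotient.out, ?_, ?_, ?_⟩
  · rw [Finset.card_image_of_injective _ Quotient.out_injective]
    apply Finset.card_le_mul_card_image
    intro q _
    apply fibre_le p hp _ (fun f => (GH f).1) (fun f => (GH f).2) q.out
    · intro f hf
      rw [Finset.mem_filter] at hf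
      obtain ⟨a1, a2, a3⟩ := hGH f hf.1
      refine ⟨a1, a2, a3, ?_⟩
      rw [← hf.2]; exact hout f
    · intro f hf g hg
      exact hine f (Finset.mem_filter.1 hf).1 g (Finset.mem_filter.1 hg).1
  · intro f hf g hg hne he
    rw [Finset.mem_image] at hf hg
    obtain ⟨q, -, rfl⟩ := hf
    obtain ⟨q', -, rfl⟩ := hg
    apply hne
    have : Quotient.mk glSetoid q.out = Quotient.mk glSetoid q'.out := Quotient.sound he
    rw [Quotient.out_eq, Quotient.out_eq] at this
    rw [this]
  · intro h hh
    rw [Finset.mem_image] at hh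
    obtain ⟨q, hq, rfl⟩ := hh
    rw [Finset.mem_image] at hq
    obtain ⟨f, hf, rfl⟩ := hq
    obtain ⟨a1, a2, a3⟩ := hGH f hf
    have a4 := hout f
    refine ⟨f, hf, ?_, ?_⟩
    · rw [← a1.disc_eq, a2.disc_eq, a4.disc_eq]
    · intro s hs hfs
      exact a4.symm.hdvd (a2.hdvd hs (a1.hdvd hfs))

end BCF

namespace BCF

theorem count_ind : ∀ (s2 : ℕ) (r s1 : ℕ), Squarefree (r * s1 * s2) →
    Nat.Coprime (r * s1 * s2) 6 → ∀ (X : ℝ), 0 < X → ∀ S : Finset BCF,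
    (∀ f ∈ S, disc f ≠ 0 ∧ |(disc f : ℝ)| < X ∧ (r:ℤ) ∣ disc f ∧ HDvd s1 f ∧
      (s2:ℤ) ^ 2 ∣ disc f) →
    (∀ f ∈ S, ∀ g ∈ S, f ≠ g → ¬ GLeq f g) →
    (S.card : ℝ) ≤ 2 ^ 56 * 6 ^ (r * s1 * s2).primeFactors.card * 4 ^ s2.primeFactors.card *
      (X / ((r:ℝ) * s1 ^ 2 * s2 ^ 2) + ((r * s1 * s2 : ℕ) : ℝ) ^ 2) := by
  intro s2
  induction s2 using Nat.strong_induction_on with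
  | _ s2 ih =>
  intro r s1 hsq h6 X hX S hS hine
  have hN0 : r * s1 * s2 ≠ 0 := hsq.ne_zero
  by_cases h1 : s2 = 1
  · subst h1
    simp only [mul_one] at hsq h6 ⊢
    have hrs := (Nat.squarefree_mul_iff.1 hsq)
    have := count_base r s1 hrs.2.1 hrs.2.2 hrs.1 h6 X hX S
      (fun f hf => ⟨(hS f hf).1, (hS f hf).2.1, (hS f hf).2.2.1, (hS f hf).2.2.2.1⟩) hine
    simpa using this
  obtain ⟨p, hp, m, rfl⟩ := Nat.exists_prime_and_dvd h1
  have hsq2 := Nat.squarefree_mul_iff.1 hsq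
  have hpm := Nat.squarefree_mul_iff.1 hsq2.2.2
  have hr0 : 0 < r := Nat.pos_of_ne_zero (by rintro rfl; simp at hN0)
  have hs0 : 0 < s1 := Nat.pos_of_ne_zero (by rintro rfl; simp at hN0)
  have hm0 : 0 < m := Nat.pos_of_ne_zero (by rintro rfl; simp at hN0)
  have hp0 : 0 < p := hp.pos
  have hmlt : m < p * m := by nlinarith [hp.two_le]
  have hdvd : r * s1 * m ∣ r * s1 * (p * m) := ⟨p, by ring⟩
  have eN : r * (s1 * p) * m = r * s1 * (p * m) := by ring
  have hp6 : Nat.Coprime p 6 := h6.coprime_dvd_left ⟨r * s1 * m, by ring⟩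
  have hprs : Nat.Coprime (r * s1) p := hsq2.1.coprime_dvd_right (dvd_mul_right p m)
  have hpr : IsCoprime (r:ℤ) p :=
    Nat.isCoprime_iff_coprime.2 (hprs.coprime_dvd_left (dvd_mul_right r s1))
  have hps : IsCoprime (s1:ℤ) p :=
    Nat.isCoprime_iff_coprime.2 (hprs.coprime_dvd_left (dvd_mul_left s1 r))
  have hpmc : IsCoprime (m:ℤ) p := Nat.isCoprime_iff_coprime.2 hpm.1.symm
  have hcast : ((p * m : ℕ) : ℤ) = p * m := by push_cast; rfl
  have hpd : ∀ f ∈ S, (p:ℤ) ^ 2 ∣ disc f ∧ (m:ℤ) ^ 2 ∣ disc f := by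
    intro f hf
    have := (hS f hf).2.2.2.2
    rw [hcast, mul_pow] at this
    exact ⟨(dvd_mul_right _ _).trans this, (dvd_mul_left _ _).trans this⟩
  have hsplit := Finset.card_filter_add_card_filter_not (s := S) (fun f : BCF => HDvd p f)
  have b1 := ih m hmlt r (s1 * p) (by rw [eN]; exact hsq) (by rw [eN]; exact h6) X hX
    (S.filter (fun f => HDvd p f)) (by
      intro f hf
      rw [Finset.mem_filter] at hf
      obtain ⟨a1, a2, a3, a4, a5⟩ := hS f hf.1
      refine ⟨a1, a2, a3, ?_, (hpd f hf.1).2⟩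
      push_cast
      exact ⟨hps.mul_dvd a4.1 hf.2.1, hps.mul_dvd a4.2.1 hf.2.2.1, hps.mul_dvd a4.2.2 hf.2.2.2⟩)
    (by
      intro f hf g hg
      exact hine f (Finset.mem_filter.1 hf).1 g (Finset.mem_filter.1 hg).1)
  obtain ⟨T, hT1, hT2, hT3⟩ := descend p hp hp6 (S.filter (fun f => ¬ HDvd p f)) (by
      intro f hf
      rw [Finset.mem_filter] at hf
      exact ⟨hf.2, (hpd f hf.1).1⟩) (by
      intro f hf g hg
      exact hine f (Finset.mem_filter.1 hf).1 g (Finset.mem_filter.1 hg).1)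
  have hpR : (0:ℝ) < p := by exact_mod_cast hp0
  have b2 := ih m hmlt r s1 (hsq.squarefree_of_dvd hdvd) (h6.coprime_dvd_left hdvd)
    (X / (p:ℝ) ^ 2) (by positivity) T (by
      intro h hh
      obtain ⟨f, hf, e1, e2⟩ := hT3 h hh
      rw [Finset.mem_filter] at hf
      obtain ⟨a1, a2, a3, a4, a5⟩ := hS f hf.1
      refine ⟨?_, ?_, ?_, e2 _ hps a4, ?_⟩
      · intro h0
        rw [h0, mul_zero] at e1
        exact a1 e1
      · rw [e1] at a2
        push_cast at a2
        rw [abs_mul, abs_of_pos (show (0:ℝ) < (p:ℝ) ^ 2 by positivity)] at a2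
        rw [lt_div_iff₀ (by positivity)]
        linarith
      · rw [e1] at a3
        exact (hpr.pow_right).dvd_of_dvd_mul_left a3
      · have a6 := (hpd f hf.1).2
        rw [e1] at a6
        exact (hpmc.pow).dvd_of_dvd_mul_left a6) hT2
  rw [eN] at b1
  have hom : (r * s1 * m).primeFactors.card ≤ (r * s1 * (p * m)).primeFactors.card :=
    Finset.card_le_card (Nat.primeFactors_mono hdvd hN0)
  have hom2 : m.primeFactors.card + 1 ≤ (p * m).primeFactors.card := by
    apply Nat.succ_le_of_lt
    apply Finset.card_lt_card
    rw [Finset.ssubset_iff_of_subset (Nat.primeFactors_mono (dvd_mul_left m p) (by positivity))]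
    refine ⟨p, Nat.mem_primeFactors.2 ⟨hp, dvd_mul_right p m, by positivity⟩, ?_⟩
    intro h
    exact (hp.coprime_iff_not_dvd.1 hpm.1) (Nat.dvd_of_mem_primeFactors h)
  set x : ℝ := X / ((r:ℝ) * s1 ^ 2 * ((p * m : ℕ):ℝ) ^ 2) with hx
  have e1 : X / ((r:ℝ) * ((s1 * p : ℕ) : ℝ) ^ 2 * (m:ℝ) ^ 2) = x := by
    rw [hx]; push_cast; congr 1; ring
  have e2 : X / (p:ℝ) ^ 2 / ((r:ℝ) * s1 ^ 2 * (m:ℝ) ^ 2) = x := by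
    rw [hx, div_div]; push_cast; congr 1; ring
  rw [e1] at b1
  rw [e2] at b2
  have hrR : (0:ℝ) < r := by exact_mod_cast hr0
  have hsR : (0:ℝ) < s1 := by exact_mod_cast hs0
  have hmR : (0:ℝ) < m := by exact_mod_cast hm0
  have hx0 : 0 ≤ x := by positivity
  have hNle : ((r * s1 * m : ℕ) : ℝ) ≤ ((r * s1 * (p * m) : ℕ) : ℝ) := by
    exact_mod_cast Nat.le_of_dvd (Nat.pos_of_ne_zero hN0) hdvd
  have b3 : (T.card : ℝ) ≤ 2 ^ 56 * 6 ^ (r * s1 * (p * m)).primeFactors.card *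
      4 ^ m.primeFactors.card * (x + ((r * s1 * (p * m) : ℕ) : ℝ) ^ 2) := by
    refine b2.trans ?_
    gcongr
    norm_num
  have hc : (S.card : ℝ) ≤ ((S.filter (fun f => HDvd p f)).card : ℝ) + 3 * (T.card : ℝ) := by
    rw [← hsplit]; push_cast
    have : ((S.filter (fun f => ¬ HDvd p f)).card : ℝ) ≤ 3 * (T.card : ℝ) := by exact_mod_cast hT1
    linarith
  calc (S.card : ℝ) ≤ 2 ^ 56 * 6 ^ (r * s1 * (p * m)).primeFactors.card *
      4 ^ (m.primeFactors.card + 1) * (x + ((r * s1 * (p * m) : ℕ) : ℝ) ^ 2) := by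
        rw [pow_succ (4:ℝ)]; linarith
    _ ≤ _ := by
        gcongr
        norm_num
end BCF

namespace BCF

lemma pow_omega_le (K : ℝ) (hK : 1 ≤ K) (ε : ℝ) (hε : 0 < ε) :
    ∃ C : ℝ, 1 ≤ C ∧ ∀ n : ℕ, n ≠ 0 → K ^ n.primeFactors.card ≤ C * (n:ℝ) ^ ε := by
  obtain ⟨P, hP⟩ := exists_nat_ge (K ^ (1 / ε))
  refine ⟨K ^ P, one_le_pow₀ hK, fun n hn => ?_⟩
  have hK0 : 0 < K := by linarith
  have h1 : K ^ n.primeFactors.card ≤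
      ∏ p ∈ n.primeFactors, (if p < P then K else 1) * (p:ℝ) ^ ε := by
    rw [← Finset.prod_const]
    apply Finset.prod_le_prod
    · intro p _; exact hK0.le
    · intro p hp
      have hp1 : (1:ℝ) ≤ p := by exact_mod_cast (Nat.prime_of_mem_primeFactors hp).one_le
      have hpe : (1:ℝ) ≤ (p:ℝ) ^ ε := Real.one_le_rpow hp1 hε.le
      split_ifs with h
      · nlinarith
      · rw [one_mul]
        have h2 : K ^ (1 / ε) ≤ (p:ℝ) := hP.trans (by exact_mod_cast not_lt.1 h)
        calc K = (K ^ (1 / ε)) ^ ε := by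
              rw [← Real.rpow_mul hK0.le, one_div, inv_mul_cancel₀ hε.ne', Real.rpow_one]
          _ ≤ _ := Real.rpow_le_rpow (by positivity) h2 hε.le
  refine h1.trans ?_
  rw [Finset.prod_mul_distrib]
  have h2 : ∏ p ∈ n.primeFactors, (if p < P then K else 1) ≤ K ^ P := by
    rw [← Finset.prod_filter, Finset.prod_const]
    apply pow_le_pow_right₀ hK
    calc _ ≤ (Finset.range P).card := by
          apply Finset.card_le_card
          intro p hp
          rw [Finset.mem_range]
          exact (Finset.mem_filter.1 hp).2
      _ = P := Finset.card_range P
  have h3 : ∏ p ∈ n.primeFactors, (p:ℝ) ^ ε ≤ (n:ℝ) ^ ε := by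
    rw [Real.finsetProd_rpow _ _ (fun p _ => by positivity)]
    apply Real.rpow_le_rpow (by positivity) _ hε.le
    have := Nat.le_of_dvd (Nat.pos_of_ne_zero hn) (Nat.prod_primeFactors_dvd n)
    calc ∏ p ∈ n.primeFactors, (p:ℝ) = ((∏ p ∈ n.primeFactors, p : ℕ) : ℝ) := by push_cast; rfl
      _ ≤ _ := by exact_mod_cast this
  gcongr

lemma remove_six (n : ℕ) (hn : Squarefree n) :
    ∃ g m : ℕ, n = g * m ∧ 0 < g ∧ g ≤ 6 ∧ Nat.Coprime m 6 := by
  obtain ⟨m, hm⟩ := Nat.gcd_dvd_left n 6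
  refine ⟨Nat.gcd n 6, m, hm, Nat.gcd_pos_of_pos_right _ (by norm_num),
    Nat.gcd_le_right _ (by norm_num), ?_⟩
  rw [hm] at hn
  have hc := (Nat.squarefree_mul_iff.1 hn).1
  rw [Nat.coprime_iff_gcd_eq_one] at *
  apply Nat.eq_one_of_dvd_one
  have hd : Nat.gcd m 6 ∣ Nat.gcd n 6 :=
    Nat.dvd_gcd ((Nat.gcd_dvd_left m 6).trans ⟨Nat.gcd n 6, by rw [mul_comm]; exact hm⟩)
      (Nat.gcd_dvd_right m 6)
  have := Nat.dvd_gcd hd (Nat.gcd_dvd_left m 6)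
  rwa [hc] at this

theorem final_count (ε : ℝ) (hε : 0 < ε) : ∃ C : ℝ, 0 < C ∧ ∀ r s : ℕ, Squarefree r →
    Squarefree s → Nat.Coprime r s → ∀ X : ℝ, 0 < X → ∀ S : Finset BCF,
    (∀ f ∈ S, disc f ≠ 0 ∧ (|disc f| : ℝ) < X ∧ (((r * s ^ 2 : ℕ) : ℤ) ∣ disc f)) →
    (∀ f ∈ S, ∀ g ∈ S, f ≠ g → ¬ GLeq f g) →
    (S.card : ℝ) ≤ C * (X / ((r * s ^ 2 : ℕ) : ℝ) ^ (1 - ε) + ((r * s : ℕ) : ℝ) ^ (2 + ε)) := by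
  obtain ⟨C, hC, hCb⟩ := pow_omega_le 24 (by norm_num) ε hε
  refine ⟨2 ^ 56 * 216 * C, by positivity, ?_⟩
  intro r s hr hs hrs X hX S hS hine
  obtain ⟨g, r', hgr, hg0, hg6, hr6⟩ := remove_six r hr
  obtain ⟨k, s', hks, hk0, hk6, hs6⟩ := remove_six s hs
  have hr0 : 0 < r := Nat.pos_of_ne_zero hr.ne_zero
  have hs0 : 0 < s := Nat.pos_of_ne_zero hs.ne_zero
  have hr'd : r' ∣ r := ⟨g, by rw [mul_comm]; exact hgr⟩
  have hs'd : s' ∣ s := ⟨k, by rw [mul_comm]; exact hks⟩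
  have hr'0 : 0 < r' := Nat.pos_of_dvd_of_pos hr'd hr0
  have hs'0 : 0 < s' := Nat.pos_of_dvd_of_pos hs'd hs0
  have hcop : Nat.Coprime r' s' := (hrs.coprime_dvd_left hr'd).coprime_dvd_right hs'd
  have hsq : Squarefree (r' * s') := Nat.squarefree_mul_iff.2
    ⟨hcop, hr.squarefree_of_dvd hr'd, hs.squarefree_of_dvd hs'd⟩
  have h6 : Nat.Coprime (r' * s') 6 := Nat.Coprime.mul_left hr6 hs6
  have main := count_ind s' r' 1 (by simpa using hsq) (by simpa using h6) X hX S (by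
    intro f hf
    obtain ⟨a1, a2, a3⟩ := hS f hf
    have hd1 : (r':ℤ) ∣ disc f := (Int.natCast_dvd_natCast.2 (hr'd.mul_right _)).trans a3
    have hd2 : (s':ℤ) ^ 2 ∣ disc f := by
      refine Dvd.dvd.trans ?_ a3
      have : s' ^ 2 ∣ r * s ^ 2 := (pow_dvd_pow_of_dvd hs'd 2).mul_left _
      exact_mod_cast this
    exact ⟨a1, by exact_mod_cast a2, hd1, by simp [HDvd], hd2⟩) hine
  simp only [mul_one, Nat.cast_one, one_pow] at main
  have hN0 : r' * s' ≠ 0 := by positivity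
  have hom : s'.primeFactors.card ≤ (r' * s').primeFactors.card :=
    Finset.card_le_card (Nat.primeFactors_mono (dvd_mul_left s' r') hN0)
  have h24 : (6:ℝ) ^ (r' * s').primeFactors.card * 4 ^ s'.primeFactors.card ≤
      C * ((r' * s' : ℕ) : ℝ) ^ ε := by
    refine le_trans ?_ (hCb (r' * s') hN0)
    rw [show (24:ℝ) = 6 * 4 by norm_num, mul_pow]
    gcongr
    norm_num
  set n : ℝ := ((r * s : ℕ) : ℝ) with hn
  set d : ℝ := ((r * s ^ 2 : ℕ) : ℝ) with hd
  have hn1 : (1:ℝ) ≤ n := by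
    rw [hn]; exact_mod_cast Nat.mul_pos hr0 hs0
  have hn0 : 0 < n := by linarith
  have hnd : n ≤ d := by
    rw [hn, hd]
    have : r * s ≤ r * s ^ 2 := Nat.mul_le_mul_left _ (Nat.le_self_pow two_ne_zero s)
    exact_mod_cast this
  have hd0 : 0 < d := by linarith
  have hn'n : ((r' * s' : ℕ) : ℝ) ≤ n := by
    rw [hn]
    exact_mod_cast Nat.mul_le_mul (Nat.le_of_dvd hr0 hr'd) (Nat.le_of_dvd hs0 hs'd)
  have hX1 : X / ((r':ℝ) * (s':ℝ) ^ 2) ≤ 216 * (X / d) := by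
    have : d ≤ 216 * ((r':ℝ) * (s':ℝ) ^ 2) := by
      have hg : (g:ℝ) ≤ 6 := by exact_mod_cast hg6
      have hk : (k:ℝ) ≤ 6 := by exact_mod_cast hk6
      calc d = (g:ℝ) * k ^ 2 * ((r':ℝ) * (s':ℝ) ^ 2) := by
            rw [hd, hgr, hks]; push_cast; ring
        _ ≤ 6 * 6 ^ 2 * ((r':ℝ) * (s':ℝ) ^ 2) := by gcongr
        _ = _ := by norm_num
    have hpos : (0:ℝ) < (r':ℝ) * (s':ℝ) ^ 2 := by positivity
    rw [div_le_iff₀ hpos]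
    have e : 216 * (X / d) * ((r':ℝ) * (s':ℝ) ^ 2) = X * (216 * ((r':ℝ) * (s':ℝ) ^ 2)) / d := by
      ring
    rw [e, le_div_iff₀ hd0]
    gcongr
  have e1 : X / d ^ (1 - ε) = d ^ ε * (X / d) := by
    rw [Real.rpow_sub hd0, Real.rpow_one]
    field_simp
  have e2 : n ^ (2 + ε) = n ^ ε * n ^ 2 := by
    rw [Real.rpow_add hn0, mul_comm]
    norm_num
  have hnd' : n ^ ε ≤ d ^ ε := Real.rpow_le_rpow hn0.le hnd hε.le
  have hn'e : ((r' * s' : ℕ) : ℝ) ^ ε ≤ n ^ ε := Real.rpow_le_rpow (by positivity) hn'n hε.le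
  rw [e1, e2]
  have hXd : 0 ≤ X / d := by positivity
  calc (S.card : ℝ) ≤ 2 ^ 56 * (6 ^ (r' * s').primeFactors.card * 4 ^ s'.primeFactors.card) *
        (X / ((r':ℝ) * (s':ℝ) ^ 2) + ((r' * s' : ℕ) : ℝ) ^ 2) := by
        rw [← mul_assoc]; exact main
    _ ≤ 2 ^ 56 * (C * n ^ ε) * (216 * (X / d) + n ^ 2) := by
        have h25 := h24.trans (mul_le_mul_of_nonneg_left hn'e (by linarith : (0:ℝ) ≤ C))
        apply mul_le_mul
        · exact mul_le_mul_of_nonneg_left h25 (by norm_num)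
        · exact add_le_add hX1 (pow_le_pow_left₀ (by positivity) hn'n 2)
        · positivity
        · positivity
    _ ≤ 2 ^ 56 * (C * n ^ ε) * (216 * (X / d) + 216 * n ^ 2) := by
        gcongr
        nlinarith [sq_nonneg n]
    _ = 2 ^ 56 * 216 * C * (n ^ ε * (X / d) + n ^ ε * n ^ 2) := by ring
    _ ≤ _ := by gcongr
end BCF

open BCF in
/-- Lemma 3.7: for `d = r·s²` with `r, s` coprime and squarefree, the number of
`GL₂(ℤ)`-classes of integral binary cubic forms with `0 < |Disc| < X` and
`d | Disc` is `≪_ε X/d^{1−ε} + (rs)^{2+ε}`. -/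
theorem count_discriminants_divisible_by_cubefree :
    ∀ ε : ℝ, 0 < ε → ∃ C : ℝ,
      ∀ r s : ℕ, Squarefree r → Squarefree s → Nat.Coprime r s →
      ∀ X : ℝ, 0 < X →
      ∀ S : Finset BCF,
        (∀ f ∈ S, disc f ≠ 0 ∧ (|disc f| : ℝ) < X ∧ (((r * s ^ 2 : ℕ) : ℤ) ∣ disc f)) →
        (∀ f ∈ S, ∀ g ∈ S, f ≠ g → ¬ GLeq f g) →
        (S.card : ℝ)
          ≤ C * (X / ((r * s ^ 2 : ℕ) : ℝ) ^ (1 - ε) + ((r * s : ℕ) : ℝ) ^ (2 + ε)) := by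
  intro ε hε
  obtain ⟨C, -, hC⟩ := final_count ε hε
  exact ⟨C, hC⟩
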